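/- Let P be a one-parameter FISI deformation of f₀, of degree d ≥ 2. Then the number of vanishing cycles γ(s) := μ(s) + λ(s) is upper semi-continuous at s = 0: there exists ε > 0 such that μ(s) + λ(s) ≥ μ(0) + λ(0) for all s with |s| < ε. -/

import Mathlib

open MvPolynomial Filter CategoryTheory Limits Topology

noncomputable section

abbrev XS (n : ℕ) := Fin n ⊕ Unit
abbrev HV (n : ℕ) := Fin n ⊕ Unit
abbrev TV (n : ℕ) := Fin n ⊕ Fin 3

/-- ℙ^{n-1}, the hyperplane at infinity of ℙⁿ. -/
abbrev PrjInf (n : ℕ) := Projectivization ℂ (Fin n → ℂ)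
/-- ℙⁿ. -/
abbrev Prj (n : ℕ) := Projectivization ℂ (HV n → ℂ)

/-- weights for the degree in the `x`-variables only: `s` has weight `0`. -/
def wtx (n : ℕ) : XS n → ℕ := Sum.elim (fun _ => 1) (fun _ => 0)

/-- `P_q`, the degree-`q` homogeneous part of `P` in the variables `x`. -/
def xpart {n : ℕ} (P : MvPolynomial (XS n) ℂ) (q : ℕ) : MvPolynomial (XS n) ℂ :=
  weightedHomogeneousComponent (wtx n) q P

/-- the evaluation point `(x, s)`. -/
def evA {n : ℕ} (x : Fin n → ℂ) (s : ℂ) : XS n → ℂ := Sum.elim x (fun _ => s)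

/-- `deg_x P(·,s) = d` at the parameter value `s`. -/
def DegXAt {n : ℕ} (d : ℕ) (P : MvPolynomial (XS n) ℂ) (s : ℂ) : Prop :=
  (∀ q, d < q → ∀ x : Fin n → ℂ, eval (evA x s) (xpart P q) = 0) ∧
  (∃ x : Fin n → ℂ, eval (evA x s) (xpart P d) ≠ 0)

/-- the substitution embedding the variables `(x,s)` into the variables `(x,x₀,s,t)`. -/
def embT {n : ℕ} : XS n → MvPolynomial (TV n) ℂ :=
  Sum.elim (fun i => X (Sum.inl i)) (fun _ => X (Sum.inr 1))

/-- The defining polynomial `F = P̃(x,x₀,s) - t·x₀^d` of the total space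
`Y ⊂ ℙⁿ × ℂ_s × ℂ_t`, where `P̃ = Σ_{q ≤ d} x₀^{d-q} P_q(x,s)` is the homogenization
of `P` in `x` by the variable `x₀`. -/
def FY {n : ℕ} (d : ℕ) (P : MvPolynomial (XS n) ℂ) : MvPolynomial (TV n) ℂ :=
  (∑ q ∈ Finset.range (d+1), (X (Sum.inr 0))^(d-q) * aeval embT (xpart P q))
    - X (Sum.inr 2) * (X (Sum.inr 0))^d

/-- the evaluation point `((x,x₀), s, t)` of the variables of `FY`. -/
def evT {n : ℕ} (u : HV n → ℂ) (s t : ℂ) : TV n → ℂ :=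
  Sum.elim (fun i => u (Sum.inl i)) ![u (Sum.inr ()), s, t]

/-- `([u], s, t) ∈ Y`. -/
def OnY {n : ℕ} (d : ℕ) (P : MvPolynomial (XS n) ℂ) (u : HV n → ℂ) (s t : ℂ) : Prop :=
  eval (evT u s t) (FY d P) = 0

/-- all partial derivatives of the defining equation of `Y` — with respect to the
homogeneous coordinates `(x, x₀)` and the affine coordinates `s, t` — vanish at
`([u], s, t)`; together with `OnY` this says `([u],s,t)` is a singular point of `Y`. -/
def AllDerivsVanish {n : ℕ} (d : ℕ) (P : MvPolynomial (XS n) ℂ) (u : HV n → ℂ)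
    (s t : ℂ) : Prop :=
  ∀ v : TV n, eval (evT u s t) (pderiv v (FY d P)) = 0

/-- the partial derivatives with respect to the homogeneous coordinates `(x, x₀)`
vanish at `([u], s, t)`; together with `OnY` this says `[u]` is a singular point of the
projective fiber `Y_{s,t}`. -/
def FiberDerivsVanish {n : ℕ} (d : ℕ) (P : MvPolynomial (XS n) ℂ) (u : HV n → ℂ)
    (s t : ℂ) : Prop :=
  (∀ i : Fin n, eval (evT u s t) (pderiv (Sum.inl i) (FY d P)) = 0) ∧
    eval (evT u s t) (pderiv (Sum.inr 0) (FY d P)) = 0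

/-- the partial derivatives with respect to `(x, x₀)` and `t` (but not `s`) vanish;
together with `OnY` this identifies the singular points of `Y_{s,ℂ}`, resp. the critical
points of the projection `σ : Y → ℂ_s`. -/
def SliceDerivsVanish {n : ℕ} (d : ℕ) (P : MvPolynomial (XS n) ℂ) (u : HV n → ℂ)
    (s t : ℂ) : Prop :=
  FiberDerivsVanish d P u s t ∧ eval (evT u s t) (pderiv (Sum.inr 2) (FY d P)) = 0

/-- `[x] ∈ W_s`: all `∂P_d/∂x_i` vanish at `(x,s)`. -/
def WCond {n : ℕ} (d : ℕ) (P : MvPolynomial (XS n) ℂ) (x : Fin n → ℂ) (s : ℂ) : Prop :=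
  ∀ i : Fin n, eval (evA x s) (pderiv (Sum.inl i) (xpart P d)) = 0

/-- `[x] ∈ Σ_s`: moreover `P_{d-1}(x,s) = 0`. -/
def SCond {n : ℕ} (d : ℕ) (P : MvPolynomial (XS n) ℂ) (x : Fin n → ℂ) (s : ℂ) : Prop :=
  WCond d P x s ∧ eval (evA x s) (xpart P (d-1)) = 0

/-- `φ_d(x) = ∂P_d/∂s (x, 0) = 0`. -/
def PhiCond {n : ℕ} (d : ℕ) (P : MvPolynomial (XS n) ℂ) (x : Fin n → ℂ) : Prop :=
  eval (evA x 0) (pderiv (Sum.inr ()) (xpart P d)) = 0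

/-- `W_s ⊂ ℙ^{n-1}` as a set of projective points. -/
def Wset {n : ℕ} (d : ℕ) (P : MvPolynomial (XS n) ℂ) (s : ℂ) : Set (PrjInf n) :=
  {p | WCond d P p.rep s}

/-- `Σ_s ⊂ ℙ^{n-1}` as a set of projective points. -/
def Sigset {n : ℕ} (d : ℕ) (P : MvPolynomial (XS n) ℂ) (s : ℂ) : Set (PrjInf n) :=
  {p | SCond d P p.rep s}

/-- `f_s = P(·,s)` as a polynomial in `x`. -/
def fS {n : ℕ} (P : MvPolynomial (XS n) ℂ) (s : ℂ) : MvPolynomial (Fin n) ℂ :=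
  aeval (Sum.elim X (fun _ => C s)) P

/-- `x` is an affine critical point of `f_s`, i.e. `∂P/∂x_i(x,s) = 0` for all `i`. -/
def CritPt {n : ℕ} (P : MvPolynomial (XS n) ℂ) (x : Fin n → ℂ) (s : ℂ) : Prop :=
  ∀ i : Fin n, eval (evA x s) (pderiv (Sum.inl i) P) = 0

/-- the set of singular points of the compactified fiber `Y_{s,t} ⊂ ℙⁿ`. -/
def SingYst {n : ℕ} (d : ℕ) (P : MvPolynomial (XS n) ℂ) (s t : ℂ) : Set (Prj n) :=
  {p | OnY d P p.rep s t ∧ FiberDerivsVanish d P p.rep s t}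

/-- `f₀ = P(·,0)` is a FISI polynomial: it has finitely many critical points, the
projective closure of each of its fibers has only isolated (= finitely many) singular
points, and the singular locus `W₀` of the slice at infinity is finite. -/
def FISIat {n : ℕ} (d : ℕ) (P : MvPolynomial (XS n) ℂ) (s : ℂ) : Prop :=
  {x : Fin n → ℂ | CritPt P x s}.Finite ∧ (∀ t : ℂ, (SingYst d P s t).Finite) ∧
    (Wset d P s).Finite

/-- `P` is a FISI deformation: `f₀` is FISI, `W₀` is finite and every `f_s`, for `s` in a
neighbourhood of `0`, has only finitely many critical points. -/
def FISIdef {n : ℕ} (d : ℕ) (P : MvPolynomial (XS n) ℂ) : Prop :=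
  FISIat d P 0 ∧ ∃ ε > (0:ℝ), ∀ s : ℂ, ‖s‖ < ε → {x : Fin n → ℂ | CritPt P x s}.Finite

/-- The "Milnor-type" local dimension: given polynomial germs `gs` at a point `a ∈ ℂᵐ`,
this is the `ℂ`-dimension of the formal power series ring at `a` (identified with
`ℂ[[X]]` via `X ↦ X - a`) modulo the ideal generated by the germs. -/
def germDim {m : ℕ} (gs : Set (MvPolynomial (Fin m) ℂ)) (a : Fin m → ℂ) : ℕ :=
  Module.finrank ℂ (MvPowerSeries (Fin m) ℂ ⧸ Ideal.span
    ((fun g => (MvPolynomial.coeToMvPowerSeries.ringHom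
        (aeval (fun i => X i + C (a i)) g) : MvPowerSeries (Fin m) ℂ)) '' gs))

/-- the (choice of an) index `j` with `p.rep j ≠ 0`, used to normalize `v_j = 1`
and to work in the chart `x_j = 1` of `ℙⁿ`. -/
def jp {n : ℕ} (p : PrjInf n) : Fin n :=
  (Function.ne_iff.mp p.rep_nonzero).choose

lemma jp_spec {n : ℕ} (p : PrjInf n) : p.rep (jp p) ≠ 0 :=
  (Function.ne_iff.mp p.rep_nonzero).choose_spec

/-- the chart coordinates of the point at infinity `p = [v:0]`, where `v` is normalized
by `v_{j(p)} = 1`, in the chart `x_{j(p)} = 1` of `ℙⁿ`; the slot `j(p)` of the chart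
carries the coordinate `x₀`, which is `0` at `p`. -/
def chartPt {n : ℕ} (p : PrjInf n) : Fin n → ℂ :=
  fun i => if i = jp p then 0 else p.rep i / p.rep (jp p)

/-- the chart equation of the compactified fiber `Y_{s,t}` in the chart `x_j = 1` of
`ℙⁿ`: substitute `x_j = 1` in the homogeneous defining equation `FY`, the chart slot `j`
carrying the coordinate `x₀`. -/
def chartEq {n : ℕ} (d : ℕ) (P : MvPolynomial (XS n) ℂ) (j : Fin n) (s t : ℂ) :
    MvPolynomial (Fin n) ℂ :=
  aeval (Sum.elim (fun i => if i = j then 1 else X i) ![X j, C s, C t]) (FY d P)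

/-- the chart equation of the hypersurface `{P_d(·,s) = 0} ⊂ ℙ^{n-1}` in the chart
`x_j = 1` of `ℙ^{n-1}` (the chart variable `X j` is unused). -/
def chartEqInf {n : ℕ} (d : ℕ) (P : MvPolynomial (XS n) ℂ) (j : Fin n) (s : ℂ) :
    MvPolynomial (Fin n) ℂ :=
  aeval (fun i => if i = j then 1 else X i) (aeval (Sum.elim X (fun _ => C s)) (xpart P d))

/-- `μ_p(t,s)`, the Milnor number of the isolated singularity of the compactified fiber
`Y_{s,t}` at the point `p` of the hyperplane at infinity. -/
def muP {n : ℕ} (d : ℕ) (P : MvPolynomial (XS n) ℂ) (p : PrjInf n) (s t : ℂ) : ℕ :=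
  germDim (Set.range fun i => pderiv i (chartEq d P (jp p) s t)) (chartPt p)

/-- `μ_{p,gen}(s) = min_{t ∈ ℂ} μ_p(t,s)`. -/
def muGen {n : ℕ} (d : ℕ) (P : MvPolynomial (XS n) ℂ) (p : PrjInf n) (s : ℂ) : ℕ :=
  sInf (Set.range (muP d P p s))

/-- the local Milnor–Lê number `λ_{p,t}(s) = μ_p(t,s) − μ_{p,gen}(s)`. -/
def lamP {n : ℕ} (d : ℕ) (P : MvPolynomial (XS n) ℂ) (p : PrjInf n) (t s : ℂ) : ℕ :=
  muP d P p s t - muGen d P p s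

/-- `μ_p^∞(s)`, the Milnor number at `p` of the hypersurface `{P_d(·,s)=0} ⊂ ℙ^{n-1}`:
computed in the chart `x_{j(p)} = 1`, adding the generator `X (j p)` to kill the unused
chart variable. -/
def muInf {n : ℕ} (d : ℕ) (P : MvPolynomial (XS n) ℂ) (p : PrjInf n) (s : ℂ) : ℕ :=
  germDim ({g | ∃ i, i ≠ jp p ∧ g = pderiv i (chartEqInf d P (jp p) s)} ∪ {X (jp p)})
    (chartPt p)

/-- the total Milnor number `μ(s)` of the affine singularities of `f_s`. -/
def muTot {n : ℕ} (P : MvPolynomial (XS n) ℂ) (s : ℂ) : ℕ :=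
  Module.finrank ℂ (MvPolynomial (Fin n) ℂ ⧸
    Ideal.span (Set.range fun i => pderiv i (fS P s)))

/-- the local Milnor number `μ_a(f_s)` of `f_s` at the point `a ∈ ℂⁿ`. -/
def muAt {n : ℕ} (P : MvPolynomial (XS n) ℂ) (s : ℂ) (a : Fin n → ℂ) : ℕ :=
  germDim (Set.range fun i => pderiv i (fS P s)) a

/-- the total Milnor–Lê number at infinity `λ(s) = Σ_{p ∈ Σ_s} Σ_{t ∈ ℂ} λ_{p,t}(s)`
(all but finitely many summands vanish). -/
def lamTot {n : ℕ} (d : ℕ) (P : MvPolynomial (XS n) ℂ) (s : ℂ) : ℕ :=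
  ∑ᶠ p ∈ Sigset d P s, ∑ᶠ t : ℂ, lamP d P p t s

/-- the chart coordinates of the affine point `[x : 1] ∈ ℙⁿ` in the chart `x_j = 1`,
the slot `j` carrying the coordinate `x₀` (i.e. `1/x_j`). -/
def chartCo {n : ℕ} (j : Fin n) (x : Fin n → ℂ) : Fin n → ℂ :=
  fun i => if i = j then 1 / x j else x i / x j

/-- the affine discriminant `Δ_P ⊂ ℂ_s × ℂ_t`: the closure of the set of pairs
`(s, f_s(x))` over the affine critical points `x` of `f_s`. -/
def DeltaP {n : ℕ} (P : MvPolynomial (XS n) ℂ) : Set (ℂ × ℂ) :=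
  closure {w : ℂ × ℂ | ∃ x : Fin n → ℂ, CritPt P x w.1 ∧ w.2 = eval (evA x w.1) P}


/-! ### Hahn series over ℚ with the Euler derivation -/

abbrev KK := HahnSeries ℚ ℂ

instance (priority := 10000) kkAlg : Algebra ℂ KK := HahnSeries.instAlgebra

lemma kk_algebraMap (c : ℂ) : algebraMap ℂ KK c = HahnSeries.C c := rfl

/-- The Euler derivation `u d/du`, as a function. -/
def hD0 (x : KK) : KK where
  coeff q := (q : ℂ) * x.coeff q
  isPWO_support' := x.isPWO_support.mono (by
    intro q hq
    simp only [Function.mem_support, ne_eq, HahnSeries.mem_support] at hq ⊢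
    exact right_ne_zero_of_mul hq)

lemma hD0_coeff (x : KK) (q : ℚ) : (hD0 x).coeff q = (q : ℂ) * x.coeff q := rfl

lemma hD0_support (x : KK) : (hD0 x).support ⊆ x.support := by
  intro q hq
  simp only [HahnSeries.mem_support, hD0_coeff, ne_eq] at hq ⊢
  exact right_ne_zero_of_mul hq

lemma hD0_mul (x y : KK) : hD0 (x * y) = x * hD0 y + y * hD0 x := by
  ext q
  rw [mul_comm y, HahnSeries.coeff_add, hD0_coeff, HahnSeries.coeff_mul,
    HahnSeries.coeff_mul_right' y.isPWO_support (hD0_support y),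
    HahnSeries.coeff_mul_left' x.isPWO_support (hD0_support x), Finset.mul_sum,
    ← Finset.sum_add_distrib]
  refine Finset.sum_congr rfl ?_
  rintro ⟨a, b⟩ hab
  rw [Finset.mem_antidiagonal] at hab
  obtain ⟨-, -, h⟩ := hab
  simp only at h
  simp only [hD0_coeff]
  rw [← h]; push_cast; ring

/-- The Euler derivation. -/
def hD : Derivation ℂ KK KK where
  toFun := hD0
  map_add' x y := by ext q; simp [hD0_coeff, mul_add]
  map_smul' c x := by
    ext q
    change (q : ℂ) * (c * x.coeff q) = c * ((q : ℂ) * x.coeff q)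
    ring
  map_one_eq_zero' := by
    ext q
    change (hD0 1).coeff q = 0
    rw [hD0_coeff, HahnSeries.coeff_one]
    split_ifs with h <;> simp [h]
  leibniz' x y := by
    change hD0 (x * y) = _
    rw [hD0_mul]; rfl

lemma hD_coeff (x : KK) (q : ℚ) : (hD x).coeff q = (q : ℂ) * x.coeff q := rfl

lemma hD_single (r : ℚ) (c : ℂ) : hD (HahnSeries.single r c) = HahnSeries.single r (r * c) := by
  ext q
  rw [hD_coeff, HahnSeries.coeff_single, HahnSeries.coeff_single]
  split_ifs with h <;> simp [h]

/-- `orderTop (D x) = orderTop x` if the order is nonzero. -/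
lemma hD_orderTop (x : KK) (hx : x.orderTop ≠ 0) : (hD x).orderTop = x.orderTop := by
  by_cases h0 : x = 0
  · simp [h0]
  apply le_antisymm
  · have hne : x.coeff x.order ≠ 0 := HahnSeries.coeff_order_eq_zero.not.2 h0
    have ho : (x.order : ℚ) ≠ 0 := by
      intro h
      apply hx
      rw [← HahnSeries.order_eq_orderTop_of_ne_zero h0, h]; rfl
    rw [← HahnSeries.order_eq_orderTop_of_ne_zero h0]
    apply HahnSeries.orderTop_le_of_coeff_ne_zero
    rw [hD_coeff]
    exact mul_ne_zero (by exact_mod_cast ho) hne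
  · refine HahnSeries.le_orderTop_iff_forall.2 ?_ 
    intro b hb
    rw [hD_coeff, HahnSeries.coeff_eq_zero_of_lt_orderTop hb, mul_zero]

/-! ### Puiseux theorem -/

lemma pkX_mem_pow (n : ℕ) (x : PowerSeries ℂ) :
    x ∈ (IsLocalRing.maximalIdeal (PowerSeries ℂ)) ^ n • (⊤ : Submodule (PowerSeries ℂ) (PowerSeries ℂ))
      ↔ ∀ m < n, PowerSeries.coeff m x = 0 := by
  rw [PowerSeries.maximalIdeal_eq_span_X, Ideal.span_singleton_pow, ← PowerSeries.X_pow_dvd_iff,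
    smul_eq_mul, Ideal.mul_top, Ideal.mem_span_singleton]

instance pkHaus : IsHausdorff (IsLocalRing.maximalIdeal (PowerSeries ℂ)) (PowerSeries ℂ) where
  haus' x hx := by
    ext n
    have := hx (n+1)
    rw [SModEq.zero, pkX_mem_pow] at this
    simpa using this n (Nat.lt_succ_self n)

instance pkPrec : IsPrecomplete (IsLocalRing.maximalIdeal (PowerSeries ℂ)) (PowerSeries ℂ) where
  prec' f hf := by
    refine ⟨PowerSeries.mk fun m => PowerSeries.coeff m (f (m+1)), fun n => ?_⟩
    rw [SModEq.sub_mem, pkX_mem_pow]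
    intro m hm
    have h := hf (m := m+1) (n := n) (by omega)
    rw [SModEq.sub_mem, pkX_mem_pow] at h
    have := h m (by omega)
    rw [map_sub, sub_eq_zero] at this
    rw [map_sub, PowerSeries.coeff_mk, this, sub_self]

instance pkComplete : IsAdicComplete (IsLocalRing.maximalIdeal (PowerSeries ℂ)) (PowerSeries ℂ) where

/-- Weierstrass factorization for polynomials. -/
lemma pk_factor (g : Polynomial (PowerSeries ℂ)) (m : ℕ)
    (h1 : ∀ i < m, PowerSeries.constantCoeff (g.coeff i) = 0)
    (h2 : PowerSeries.constantCoeff (g.coeff m) ≠ 0) :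
    ∃ f q : Polynomial (PowerSeries ℂ), f.Monic ∧ f.natDegree = m ∧ g = f * q := by
  have hres : ∀ a : PowerSeries ℂ, IsLocalRing.residue (PowerSeries ℂ) a = 0 ↔
      PowerSeries.constantCoeff a = 0 := by
    intro a
    rw [IsLocalRing.residue_eq_zero_iff, PowerSeries.maximalIdeal_eq_span_X,
      Ideal.mem_span_singleton, PowerSeries.X_dvd_iff]
  have hord : ((g : PowerSeries (PowerSeries ℂ)).map
      (IsLocalRing.residue (PowerSeries ℂ))).order = m := by
    rw [PowerSeries.order_eq_nat]
    refine ⟨?_, fun i hi => ?_⟩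
    · rw [PowerSeries.coeff_map, Polynomial.coeff_coe, Ne, hres]; exact h2
    · rw [PowerSeries.coeff_map, Polynomial.coeff_coe, hres]; exact h1 i hi
  have hne : (g : PowerSeries (PowerSeries ℂ)).map (IsLocalRing.residue (PowerSeries ℂ)) ≠ 0 := by
    intro h; rw [h, PowerSeries.order_zero] at hord; exact absurd hord (by simp)
  obtain ⟨f, h, H⟩ := PowerSeries.exists_isWeierstrassFactorization hne
  have hfm := H.isDistinguishedAt.monic
  have hdeg : f.natDegree = m := by
    rw [H.natDegree_eq_toNat_order_map, hord]; rfl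
  refine ⟨f, g /ₘ f, hfm, hdeg, ?_⟩
  have hdiv := H.isDistinguishedAt.isWeierstrassDivisorAt'
  have hf2 : ((f : PowerSeries (PowerSeries ℂ)).map
      (Ideal.Quotient.mk (IsLocalRing.maximalIdeal (PowerSeries ℂ)))).order.toNat = m := by
    rw [← H.isDistinguishedAt.coe_natDegree_eq_order_map f 1
      (by simp) (by simp), hdeg]; rfl
  have hmod := Polynomial.modByMonic_add_div g f
  have key := hdiv.eq_zero_of_mul_eq (q := h - (g /ₘ f : Polynomial _)) (r := g %ₘ f)
    (by
      rw [hf2, ← hdeg, ← Polynomial.degree_eq_natDegree hfm.ne_zero]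
      exact Polynomial.degree_modByMonic_lt _ hfm)
    (by
      have e : (g : PowerSeries (PowerSeries ℂ)) = (g %ₘ f : Polynomial _) + f * (g /ₘ f : Polynomial _) := by
        conv_lhs => rw [← hmod]
        simp
      rw [mul_sub, ← H.eq_mul]
      conv_lhs => rw [e]
      ring)
  rw [key.2, zero_add] at hmod
  exact hmod.symm

/-- the embedding `τ ↦ u^{1/k}`. -/
def jk (k : ℕ) (hk : 0 < k) : PowerSeries ℂ →+* KK :=
  (HahnSeries.embDomainRingHom
    ({ toFun := fun n => (n : ℚ) / k, map_zero' := by simp,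
       map_add' := fun a b => by push_cast; ring } : ℕ →+ ℚ)
    (by
      intro a b h
      have hk' : (k : ℚ) ≠ 0 := by positivity
      simp only [AddMonoidHom.coe_mk, ZeroHom.coe_mk] at h
      rw [div_left_inj' hk'] at h
      exact_mod_cast h)
    (by
      intro a b
      have hk' : (0:ℚ) < k := by positivity
      simp only [AddMonoidHom.coe_mk, ZeroHom.coe_mk]
      rw [div_le_div_iff_of_pos_right hk']
      exact_mod_cast Iff.rfl)).comp (HahnSeries.toPowerSeries.symm : _ ≃+* _).toRingHom

lemma jk_coeff (k : ℕ) (hk : 0 < k) (p : PowerSeries ℂ) (n : ℕ) :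
    (jk k hk p).coeff ((n : ℚ) / k) = PowerSeries.coeff n p := by
  have := HahnSeries.embDomain_coeff (f := (⟨⟨fun n : ℕ => (n : ℚ) / k, ?_⟩, ?_⟩ : ℕ ↪o ℚ)) 
    (x := HahnSeries.toPowerSeries.symm p) (a := n)
  rw [HahnSeries.coeff_toPowerSeries_symm] at this
  exact this

lemma jk_coeff_ne (k : ℕ) (hk : 0 < k) (p : PowerSeries ℂ) (q : ℚ) (hq : (jk k hk p).coeff q ≠ 0) :
    ∃ n : ℕ, q = (n : ℚ) / k := by
  by_contra hcon
  push Not at hcon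
  apply hq
  refine HahnSeries.embDomain_notin_range ?_
  rintro ⟨n, hn⟩
  exact hcon n hn.symm

lemma jk_inj (k : ℕ) (hk : 0 < k) : Function.Injective (jk k hk) := by
  intro a b h
  ext n
  rw [← jk_coeff k hk, ← jk_coeff k hk, h]

lemma jk_range (k : ℕ) (hk : 0 < k) (x : KK) (hx : ∀ q, x.coeff q ≠ 0 → ∃ n : ℕ, q = (n : ℚ) / k) :
    ∃ p, jk k hk p = x := by
  refine ⟨PowerSeries.mk fun n => x.coeff ((n : ℚ) / k), ?_⟩
  ext q
  by_cases h : ∃ n : ℕ, q = (n : ℚ) / k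
  · obtain ⟨n, rfl⟩ := h
    rw [jk_coeff, PowerSeries.coeff_mk]
  · have h1 : x.coeff q = 0 := by by_contra h'; exact h (hx q h')
    have h2 : (jk k hk (PowerSeries.mk fun n => x.coeff ((n : ℚ) / k))).coeff q = 0 := by
      by_contra h'; exact h (jk_coeff_ne k hk _ q h')
    rw [h1, h2]

lemma jk_C (k : ℕ) (hk : 0 < k) (c : ℂ) : jk k hk (PowerSeries.C c) = HahnSeries.C c := by
  ext q
  by_cases h : ∃ n : ℕ, q = (n : ℚ) / k
  · obtain ⟨n, rfl⟩ := h
    have hk' : (k : ℚ) ≠ 0 := by positivity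
    rw [jk_coeff, PowerSeries.coeff_C, HahnSeries.C_apply, HahnSeries.coeff_single]
    simp [hk', hk.ne']
  · have h2 : (jk k hk (PowerSeries.C c)).coeff q = 0 := by
      by_contra h'; exact h (jk_coeff_ne k hk _ q h')
    rw [h2, HahnSeries.C_apply, HahnSeries.coeff_single]
    rw [if_neg]
    rintro rfl
    exact h ⟨0, by simp⟩

lemma jk_X (k : ℕ) (hk : 0 < k) : jk k hk PowerSeries.X = HahnSeries.single (1 / k : ℚ) 1 := by
  ext q
  by_cases h : ∃ n : ℕ, q = (n : ℚ) / k
  · obtain ⟨n, rfl⟩ := h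
    have hk' : (k : ℚ) ≠ 0 := by positivity
    rw [jk_coeff, PowerSeries.coeff_X, HahnSeries.coeff_single]
    rw [div_left_inj' hk']
    norm_cast
  · have h2 : (jk k hk (PowerSeries.X)).coeff q = 0 := by
      by_contra h'; exact h (jk_coeff_ne k hk _ q h')
    rw [h2, HahnSeries.coeff_single]
    rw [if_neg]
    rintro rfl
    exact h ⟨1, by simp⟩

lemma comp_shift_map {R S : Type*} [CommRing R] [CommRing S] (f : R →+* S) (p : Polynomial R)
    (c : R) : p.map f = ((p.comp (Polynomial.X + Polynomial.C c)).map f).comp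
      (Polynomial.X - Polynomial.C (f c)) := by
  rw [Polynomial.map_comp, Polynomial.comp_assoc]
  simp

lemma puis_A (n : ℕ) (k : ℕ) (hk : 0 < k)
    (IH : ∀ m < n, ∀ p : Polynomial (PowerSeries ℂ), p.Monic → p.natDegree = m →
      (p.map (jk k hk)).Splits)
    (p : Polynomial (PowerSeries ℂ)) (hp : p.Monic) (hn : p.natDegree = n) (c : ℂ) (m : ℕ)
    (hm0 : 0 < m) (hmn : m < n)
    (h1 : ∀ i < m, PowerSeries.constantCoeff
      ((p.comp (Polynomial.X + Polynomial.C (PowerSeries.C c))).coeff i) = 0)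
    (h2 : PowerSeries.constantCoeff
      ((p.comp (Polynomial.X + Polynomial.C (PowerSeries.C c))).coeff m) ≠ 0) :
    (p.map (jk k hk)).Splits := by
  obtain ⟨f, q, hf, hfd, hg⟩ := pk_factor _ m h1 h2
  have hgm : (p.comp (Polynomial.X + Polynomial.C (PowerSeries.C c))).Monic := hp.comp_X_add_C _
  have hgd : (p.comp (Polynomial.X + Polynomial.C (PowerSeries.C c))).natDegree = n := by
    rw [Polynomial.natDegree_comp, Polynomial.natDegree_X_add_C, hn, mul_one]
  have hq : q.Monic := by rw [hg] at hgm; exact hf.of_mul_monic_left hgm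
  have hqd : q.natDegree = n - m := by
    rw [hg, hf.natDegree_mul hq] at hgd; omega
  have hs : ((p.comp (Polynomial.X + Polynomial.C (PowerSeries.C c))).map (jk k hk)).Splits := by
    rw [hg, Polynomial.map_mul]
    exact (IH m hmn f hf hfd).mul (IH (n-m) (by omega) q hq hqd)
  have : p.map (jk k hk) = ((p.comp (Polynomial.X + Polynomial.C (PowerSeries.C c))).map
      (jk k hk)).comp (Polynomial.X - Polynomial.C (jk k hk (PowerSeries.C c))) := by
    exact comp_shift_map _ _ _
  rw [this]
  exact hs.comp_X_sub_C _

lemma puis_B (n : ℕ) (hn2 : 2 ≤ n) (k : ℕ) (hk : 0 < k)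
    (IH : ∀ m < n, ∀ p : Polynomial (PowerSeries ℂ), p.Monic → p.natDegree = m →
      (p.map (jk k hk)).Splits)
    (p : Polynomial (PowerSeries ℂ)) (hp : p.Monic) (hn : p.natDegree = n)
    (hz : p.coeff (n-1) = 0) (i : ℕ) (hin : i < n)
    (hi : PowerSeries.constantCoeff (p.coeff i) ≠ 0) :
    (p.map (jk k hk)).Splits := by
  set pb : Polynomial ℂ := p.map PowerSeries.constantCoeff with hpb
  have hpbm : pb.Monic := hp.map _
  have hpbd : pb.natDegree = n := by rw [hpb, hp.natDegree_map, hn]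
  obtain ⟨c, hc⟩ := IsAlgClosed.exists_root pb (by
    rw [Polynomial.degree_eq_natDegree hpbm.ne_zero, hpbd]
    exact_mod_cast (by omega : n ≠ 0))
  obtain ⟨h, hph, hh⟩ := Polynomial.exists_eq_pow_rootMultiplicity_mul_and_not_dvd pb hpbm.ne_zero c
  set m := pb.rootMultiplicity c with hm
  have hm0 : 0 < m := (Polynomial.rootMultiplicity_pos hpbm.ne_zero).2 hc
  have hh0 : h.eval c ≠ 0 := by
    intro h0; exact hh (Polynomial.dvd_iff_isRoot.2 h0)
  have hhm : h.Monic := ((Polynomial.monic_X_sub_C c).pow m).of_mul_monic_left (hph ▸ hpbm)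
  have hdeg : m + h.natDegree = n := by
    rw [← hpbd, hph, ((Polynomial.monic_X_sub_C c).pow m).natDegree_mul hhm,
      Polynomial.natDegree_pow, Polynomial.natDegree_X_sub_C, mul_one]
  have hmn : m < n := by
    rcases Nat.lt_or_ge m n with h' | h'
    · exact h'
    exfalso
    have hmn : m = n := by omega
    have hh1 : h = 1 := hhm.natDegree_eq_zero.1 (by omega)
    rw [hh1, mul_one, hmn] at hph
    have hco : pb.coeff (n-1) = 0 := by rw [hpb, Polynomial.coeff_map, hz, map_zero]
    have hc0 : c = 0 := by
      have : pb.nextCoeff = -(n • c) := by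
        rw [hph, (Polynomial.monic_X_sub_C c).nextCoeff_pow]
        simp
      rw [Polynomial.nextCoeff_of_natDegree_pos (by omega), hpbd, hco] at this
      have h3 := neg_eq_zero.1 this.symm
      rw [nsmul_eq_mul] at h3
      have : (n : ℂ) ≠ 0 := by exact_mod_cast (by omega : n ≠ 0)
      exact (mul_eq_zero.1 h3).resolve_left this
    apply hi
    have : pb.coeff i = 0 := by
      rw [hph, hc0, map_zero, sub_zero, Polynomial.coeff_X_pow, if_neg (by omega)]
    rwa [hpb, Polynomial.coeff_map] at this
  have hmap : (p.comp (Polynomial.X + Polynomial.C (PowerSeries.C c))).map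
      PowerSeries.constantCoeff = Polynomial.X ^ m * h.comp (Polynomial.X + Polynomial.C c) := by
    rw [Polynomial.map_comp, ← hpb]
    conv_lhs => rw [hph]
    simp
  refine puis_A n k hk IH p hp hn c m hm0 hmn ?_ ?_
  · intro i hi
    rw [← Polynomial.coeff_map, hmap, Polynomial.coeff_X_pow_mul', if_neg (by omega)]
  · rw [← Polynomial.coeff_map, hmap, Polynomial.coeff_X_pow_mul', if_pos le_rfl, Nat.sub_self,
      Polynomial.coeff_zero_eq_eval_zero, Polynomial.eval_comp]
    simpa using hh0

lemma puis_C (n : ℕ) (hn2 : 2 ≤ n)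
    (IH : ∀ m < n, ∀ k hk, ∀ p : Polynomial (PowerSeries ℂ), p.Monic → p.natDegree = m →
      (p.map (jk k hk)).Splits) (k : ℕ) (hk : 0 < k)
    (p : Polynomial (PowerSeries ℂ)) (hp : p.Monic) (hn : p.natDegree = n)
    (hz : p.coeff (n-1) = 0) : (p.map (jk k hk)).Splits := by
  by_cases hall : ∀ i < n, p.coeff i = 0
  · have : p = Polynomial.X ^ n := by
      ext1 i
      rw [Polynomial.coeff_X_pow]
      split_ifs with h
      · rw [h, ← hn]; exact hp
      · rcases Nat.lt_or_gt_of_ne h with h' | h'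
        · exact hall i h'
        · exact Polynomial.coeff_eq_zero_of_natDegree_lt (by omega)
    rw [this, Polynomial.map_pow, Polynomial.map_X]
    exact Polynomial.Splits.X_pow n
  push Not at hall
  classical
  -- choose the minimal slope
  let S : Finset ℕ := (Finset.range n).filter fun i => p.coeff i ≠ 0
  have hS : S.Nonempty := by
    obtain ⟨i, h1, h2⟩ := hall
    exact ⟨i, by simp [S, h1, h2]⟩
  obtain ⟨i₀, hi₀, hmin⟩ := S.exists_min_image
    (fun i => ((p.coeff i).order.toNat : ℚ) / ((n - i : ℕ) : ℚ)) hS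
  have hi₀n : i₀ < n := by simp [S] at hi₀; exact hi₀.1
  have hi₀0 : p.coeff i₀ ≠ 0 := by simp [S] at hi₀; exact hi₀.2
  obtain ⟨a, ha⟩ : ∃ a, (p.coeff i₀).order.toNat = a := ⟨_, rfl⟩
  obtain ⟨b, hb⟩ : ∃ b, n - i₀ = b := ⟨_, rfl⟩
  have hb0 : 0 < b := by omega
  have hle : ∀ i < n, ∀ m, PowerSeries.coeff m (p.coeff i) ≠ 0 → a * (n - i) ≤ m * b := by
    intro i hi m hm
    have hpi : p.coeff i ≠ 0 := by rintro h; rw [h] at hm; simp at hm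
    have h1 := hmin i (by simp [S, hi, hpi])
    simp only [ha, hb] at h1
    have h2 : (p.coeff i).order.toNat ≤ m := by
      have := PowerSeries.order_le m hm
      exact ENat.toNat_le_of_le_natCast this
    have hb' : (0:ℚ) < b := by exact_mod_cast hb0
    have hni : (0:ℚ) < ((n - i : ℕ) : ℚ) := by exact_mod_cast (by omega : 0 < n - i)
    rw [div_le_div_iff₀ hb' hni] at h1
    have h1' : a * (n - i) ≤ (p.coeff i).order.toNat * b := by exact_mod_cast h1
    exact h1'.trans (Nat.mul_le_mul_right b h2)
  have hkb : 0 < k * b := Nat.mul_pos hk hb0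
  have hrat : ∀ q : ℕ, ((q * b : ℕ) : ℚ) / ((k * b : ℕ) : ℚ) = (q : ℚ) / k := by
    intro q
    have : (b : ℚ) ≠ 0 := by positivity
    push_cast
    rw [mul_div_mul_right _ _ this]
  -- coefficients after rescaling
  have hco : ∀ i, ∃ r : PowerSeries ℂ, i < n →
      jk (k*b) hkb (PowerSeries.X ^ (a * (n - i)) * r) = jk k hk (p.coeff i) ∧
      (i = i₀ → PowerSeries.constantCoeff r ≠ 0) := by
    intro i
    by_cases hi : i < n
    swap
    · exact ⟨0, fun h => absurd h hi⟩
    obtain ⟨P', hP'⟩ := jk_range (k*b) hkb (jk k hk (p.coeff i)) (by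
      intro q hq
      obtain ⟨m, rfl⟩ := jk_coeff_ne _ _ _ _ hq
      exact ⟨m * b, (hrat m).symm⟩)
    have hco2 : ∀ m, PowerSeries.coeff m P' ≠ 0 → ∃ m', m = m' * b ∧
        PowerSeries.coeff m' (p.coeff i) ≠ 0 := by
      intro m hm
      rw [← jk_coeff (k*b) hkb, hP'] at hm
      obtain ⟨m', hm'⟩ := jk_coeff_ne _ _ _ _ hm
      refine ⟨m', ?_, ?_⟩
      · rw [← hrat m'] at hm'
        have : ((k * b : ℕ) : ℚ) ≠ 0 := by positivity
        rw [div_left_inj' this] at hm'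
        exact_mod_cast hm'
      · rw [hm', jk_coeff] at hm
        exact hm
    have hdvd : PowerSeries.X ^ (a * (n - i)) ∣ P' := by
      rw [PowerSeries.X_pow_dvd_iff]
      intro m hm
      by_contra hne
      obtain ⟨m', rfl, h'⟩ := hco2 m hne
      have := hle i hi m' h'
      omega
    obtain ⟨r, hr⟩ := hdvd
    refine ⟨r, fun _ => ⟨by rw [← hr, hP'], ?_⟩⟩
    rintro rfl
    have hc : PowerSeries.coeff (a * b) P' ≠ 0 := by
      rw [← jk_coeff (k*b) hkb, hP', hrat, jk_coeff, ← ha]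
      exact PowerSeries.coeff_order hi₀0
    rw [hr, hb, PowerSeries.coeff_X_pow_mul', if_pos le_rfl, Nat.sub_self] at hc
    simpa using hc
  choose r hr using hco
  let q : Polynomial (PowerSeries ℂ) :=
    Polynomial.X ^ n + ∑ i ∈ Finset.range n, Polynomial.C (r i) * Polynomial.X ^ i
  have hqlt : (∑ i ∈ Finset.range n, Polynomial.C (r i) * Polynomial.X ^ i).degree < (n : WithBot ℕ) := by
    refine lt_of_le_of_lt (Polynomial.degree_sum_le _ _) ?_
    refine (Finset.sup_lt_iff (WithBot.bot_lt_coe n)).2 ?_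
    intro i hi
    refine lt_of_le_of_lt (Polynomial.degree_C_mul_X_pow_le i _) ?_
    exact WithBot.coe_lt_coe.2 (Finset.mem_range.1 hi)
  have hqm : q.Monic := Polynomial.monic_X_pow_add hqlt
  have hqd : q.natDegree = n := by
    have : q.degree = n := by
      rw [Polynomial.degree_add_eq_left_of_degree_lt] <;> rw [Polynomial.degree_X_pow]
      exact hqlt
    exact Polynomial.natDegree_eq_of_degree_eq_some this
  have hqc : ∀ i < n, q.coeff i = r i := by
    intro i hi
    simp only [q, Polynomial.coeff_add, Polynomial.coeff_X_pow, Polynomial.finsetSum_coeff,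
      Polynomial.coeff_C_mul]
    rw [if_neg (by omega), zero_add, Finset.sum_eq_single i]
    · simp
    · intro j _ hj; rw [if_neg hj.symm, mul_zero]
    · intro h; exact absurd (Finset.mem_range.2 hi) h
  have hqs : (q.map (jk (k*b) hkb)).Splits := by
    refine puis_B n hn2 (k*b) hkb (fun m hm => IH m hm (k*b) hkb) q hqm hqd ?_ i₀ hi₀n ?_
    · rw [hqc _ (by omega)]
      have := (hr (n-1) (by omega)).1
      rw [hz, map_zero, map_eq_zero_iff _ (jk_inj _ _)] at this
      exact (mul_eq_zero.1 this).resolve_left (pow_ne_zero _ PowerSeries.X_ne_zero)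
    · rw [hqc _ hi₀n]; exact (hr i₀ hi₀n).2 rfl
  have hfin : p.map (jk k hk) = (q.map (jk (k*b) hkb)).scaleRoots (jk (k*b) hkb (PowerSeries.X ^ a)) := by
    ext1 i
    rw [Polynomial.coeff_map, Polynomial.coeff_scaleRoots, Polynomial.coeff_map, hqm.natDegree_map, hqd]
    rcases lt_trichotomy i n with h | h | h
    · rw [hqc i h, ← (hr i h).1, map_mul, mul_comm]
      congr 1
      rw [← map_pow, ← pow_mul]
    · subst h
      rw [Nat.sub_self, pow_zero, mul_one]
      have e1 : p.coeff i = 1 := by rw [← hn]; exact hp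
      have e2 : q.coeff i = 1 := by have := hqm.coeff_natDegree; rwa [hqd] at this
      rw [e1, e2, map_one, map_one]
    · rw [Polynomial.coeff_eq_zero_of_natDegree_lt (p := p) (by omega),
        Polynomial.coeff_eq_zero_of_natDegree_lt (p := q) (by omega)]
      simp
  rw [hfin]
  exact hqs.scaleRoots _

theorem puiseux (n : ℕ) : ∀ k hk, ∀ p : Polynomial (PowerSeries ℂ), p.Monic → p.natDegree = n →
      (p.map (jk k hk)).Splits := by
  induction n using Nat.strong_induction_on with
  | _ n IH =>
  intro k hk p hp hn
  by_cases hn2 : n ≤ 1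
  · apply Polynomial.Splits.of_natDegree_le_one
    rw [hp.natDegree_map]; omega
  push Not at hn2
  set c : PowerSeries ℂ := PowerSeries.C ((n : ℂ)⁻¹) * p.coeff (n-1) with hc
  have hg : (p.comp (Polynomial.X - Polynomial.C c)).Monic := hp.comp_X_sub_C _
  have hgd : (p.comp (Polynomial.X - Polynomial.C c)).natDegree = n := by
    rw [Polynomial.natDegree_comp, Polynomial.natDegree_X_sub_C, hn, mul_one]
  have hs := puis_C n hn2 IH k hk _ hg hgd ?_
  · have : p.map (jk k hk) = ((p.comp (Polynomial.X - Polynomial.C c)).map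
        (jk k hk)).comp (Polynomial.X + Polynomial.C (jk k hk c)) := by
      rw [Polynomial.map_comp, Polynomial.comp_assoc]
      simp
    rw [this]
    exact hs.comp_X_add_C _
  · have h1 : (p.comp (Polynomial.X - Polynomial.C c)).coeff (n-1)
        = p.coeff (n-1) - (n : PowerSeries ℂ) * c := by
      rw [Polynomial.comp_eq_sum_left, Polynomial.sum_over_range _ (by simp), hn,
        Polynomial.finsetSum_coeff, Finset.sum_range_succ, Finset.sum_eq_single (n-1)]
      · have e1 : p.coeff n = 1 := by rw [← hn]; exact hp
        rw [e1, map_one, one_mul, Polynomial.coeff_C_mul]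
        have e2 : ((Polynomial.X - Polynomial.C c) ^ (n-1)).coeff (n-1) = 1 := by
          have := ((Polynomial.monic_X_sub_C c).pow (n-1))
          rw [Polynomial.Monic, Polynomial.leadingCoeff, Polynomial.natDegree_pow,
            Polynomial.natDegree_X_sub_C, mul_one] at this
          exact this
        have e3 : ((Polynomial.X - Polynomial.C c) ^ n).coeff (n-1) = - (n * c) := by
          have h4 := (Polynomial.monic_X_sub_C c).nextCoeff_pow n
          rw [Polynomial.nextCoeff_of_natDegree_pos (by
            rw [Polynomial.natDegree_pow, Polynomial.natDegree_X_sub_C]; omega),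
            Polynomial.natDegree_pow, Polynomial.natDegree_X_sub_C, mul_one,
            Polynomial.nextCoeff_X_sub_C] at h4
          rw [h4]; simp
        rw [e2, e3]; ring
      · intro i hi hi'
        rw [Polynomial.coeff_C_mul, Polynomial.coeff_eq_zero_of_natDegree_lt (p := (_ - _) ^ i), mul_zero]
        rw [Polynomial.natDegree_pow, Polynomial.natDegree_X_sub_C]
        have := Finset.mem_range.1 hi
        omega
      · intro h; exact absurd (Finset.mem_range.2 (by omega)) h
    rw [h1, hc, ← mul_assoc]
    have : (n : PowerSeries ℂ) = PowerSeries.C (n : ℂ) := by simp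
    rw [this, ← map_mul, mul_inv_cancel₀ (by exact_mod_cast (by omega : n ≠ 0)), map_one, one_mul,
      sub_self]

/-! ### Koszul syzygies and the local Cohen-Macaulay property -/

lemma mem_span_img_fin {A σ : Type*} [CommRing A] [DecidableEq σ] {G : σ → A} {S : Finset σ}
    {p : A} : p ∈ Ideal.span (G '' (S : Set σ)) ↔ ∃ c : σ → A, ∑ i ∈ S, c i • G i = p := by
  constructor
  · intro h
    obtain ⟨c, hc⟩ := (Submodule.mem_span_image_finset_iff_exists_fun A).1 h
    refine ⟨fun i => if h : i ∈ S then c ⟨i, h⟩ else 0, ?_⟩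
    rw [← hc, ← Finset.sum_coe_sort]
    exact Finset.sum_congr rfl fun i _ => by simp
  · rintro ⟨c, rfl⟩
    exact sum_mem fun i hi => Ideal.mul_mem_left _ _ (Ideal.subset_span ⟨i, hi, rfl⟩)

section koszul
variable {σ : Type*} [Fintype σ] [DecidableEq σ]

/-- polynomials of total degree `< k` -/
def lowDeg (σ : Type*) (k : ℕ) : Submodule ℂ (MvPolynomial σ ℂ) where
  carrier := {p | ∀ m ∈ p.support, m.degree < k}
  zero_mem' := by simp
  add_mem' {a b} ha hb m hm := by
    classical
    rcases Finset.mem_union.1 (MvPolynomial.support_add hm) with h | h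
    · exact ha m h
    · exact hb m h
  smul_mem' c x hx m hm := hx m (MvPolynomial.support_smul hm)

lemma mem_lowDeg {σ : Type*} {k : ℕ} {p : MvPolynomial σ ℂ} :
    p ∈ lowDeg σ k ↔ ∀ m ∈ p.support, m.degree < k := Iff.rfl

lemma lowDeg_mono {σ : Type*} {k l : ℕ} (h : k ≤ l) : lowDeg σ k ≤ lowDeg σ l :=
  fun _ hp m hm => (hp m hm).trans_le h

lemma mem_lowDeg_totalDegree {σ : Type*} {k : ℕ} {p : MvPolynomial σ ℂ} (h : p.totalDegree < k) :
    p ∈ lowDeg σ k := fun m hm => by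
  have := MvPolynomial.le_totalDegree hm
  exact lt_of_le_of_lt this h

lemma lowDeg_mul {σ : Type*} {k l : ℕ} {p q : MvPolynomial σ ℂ} (hp : p ∈ lowDeg σ (k+1))
    (hq : q ∈ lowDeg σ l) : p * q ∈ lowDeg σ (k + l) := by
  classical
  intro m hm
  obtain ⟨a, ha, b, hb, rfl⟩ := Finset.mem_add.1 (MvPolynomial.support_mul p q hm)
  have := hp a ha
  have := hq b hb
  rw [map_add]; omega

lemma monomial_mem_lowDeg {σ : Type*} (m : σ →₀ ℕ) (c : ℂ) :
    monomial m c ∈ lowDeg σ (m.degree + 1) := by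
  classical
  intro a ha
  have := MvPolynomial.support_monomial_subset ha
  rw [Finset.mem_singleton] at this
  rw [this]; omega

/-- `p = X^m +` lower degree terms -/
lemma mul_lead {σ : Type*} {p q : MvPolynomial σ ℂ} {a b : σ →₀ ℕ}
    (hp : p - monomial a 1 ∈ lowDeg σ a.degree) (hq : q - monomial b 1 ∈ lowDeg σ b.degree) :
    p * q - monomial (a + b) 1 ∈ lowDeg σ (a + b).degree := by
  have e : p * q - monomial (a + b) 1
      = (p - monomial a 1) * (q - monomial b 1) + monomial a 1 * (q - monomial b 1)
        + monomial b 1 * (p - monomial a 1) := by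
    have : monomial (a + b) (1:ℂ) = monomial a 1 * monomial b 1 := by
      rw [monomial_mul, one_mul]
    rw [this]; ring
  rw [e, map_add]
  refine add_mem (add_mem (lowDeg_mul (lowDeg_mono (Nat.le_succ _) hp) hq)
    (lowDeg_mul (monomial_mem_lowDeg a 1) hq)) ?_
  rw [add_comm]
  exact lowDeg_mul (monomial_mem_lowDeg b 1) hp

lemma prod_lead {ι σ : Type*} (s : Finset ι) (p : ι → MvPolynomial σ ℂ) (a : ι → σ →₀ ℕ)
    (h : ∀ i ∈ s, p i - monomial (a i) 1 ∈ lowDeg σ (a i).degree) :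
    ∏ i ∈ s, p i - monomial (∑ i ∈ s, a i) 1 ∈ lowDeg σ (∑ i ∈ s, a i).degree := by
  classical
  induction s using Finset.induction_on with
  | empty => simp
  | insert i s hi ih =>
    rw [Finset.prod_insert hi, Finset.sum_insert hi]
    exact mul_lead (h i (Finset.mem_insert_self _ _))
      (ih fun j hj => h j (Finset.mem_insert_of_mem hj))

lemma pow_lead {σ : Type*} (p : MvPolynomial σ ℂ) (a : σ →₀ ℕ)
    (h : p - monomial a 1 ∈ lowDeg σ a.degree) (n : ℕ) :
    p ^ n - monomial (n • a) 1 ∈ lowDeg σ (n • a).degree := by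
  have := prod_lead (Finset.range n) (fun _ => p) (fun _ => a) (fun _ _ => h)
  simpa using this

variable (M : σ → ℕ) (G : σ → MvPolynomial σ ℂ)

/-- the image of the monomial `X^m` -/
def kozE (m : σ →₀ ℕ) : MvPolynomial σ ℂ :=
  ∏ i, (G i ^ (m i / M i) * X i ^ (m i % M i))

lemma kozE_lead (hG : ∀ i, G i - X i ^ M i ∈ lowDeg σ (M i)) (m : σ →₀ ℕ) :
    kozE M G m - monomial m 1 ∈ lowDeg σ m.degree := by
  have key := prod_lead Finset.univ (fun i => G i ^ (m i / M i) * X i ^ (m i % M i))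
    (fun i => (m i / M i) • Finsupp.single i (M i) + (m i % M i) • Finsupp.single i 1) (by
      intro i _
      refine mul_lead (pow_lead _ _ ?_ _) (pow_lead _ _ ?_ _)
      · rw [← X_pow_eq_monomial, Finsupp.degree_single]; exact hG i
      · rw [X, sub_self]; exact zero_mem _)
  have e : ∑ i, ((m i / M i) • Finsupp.single i (M i) + (m i % M i) • Finsupp.single i 1) = m := by
    conv_rhs => rw [← Finsupp.univ_sum_single m]
    refine Finset.sum_congr rfl fun i _ => ?_
    rw [Finsupp.smul_single, Finsupp.smul_single, ← Finsupp.single_add]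
    congr 1
    simp only [smul_eq_mul, mul_one]
    exact Nat.div_add_mod' _ _
  rw [e] at key
  exact key

/-- the linear map sending `X^m` to `kozE m` -/
def kozPhi : MvPolynomial σ ℂ →ₗ[ℂ] MvPolynomial σ ℂ :=
  (MvPolynomial.basisMonomials σ ℂ).constr ℂ (kozE M G)

lemma kozPhi_monomial (m : σ →₀ ℕ) : kozPhi M G (monomial m 1) = kozE M G m := by
  have := (MvPolynomial.basisMonomials σ ℂ).constr_basis ℂ (kozE M G) m
  rwa [MvPolynomial.coe_basisMonomials] at this

lemma kozPhi_sub (hG : ∀ i, G i - X i ^ M i ∈ lowDeg σ (M i)) (p : MvPolynomial σ ℂ) (k : ℕ)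
    (hp : p ∈ lowDeg σ (k+1)) : kozPhi M G p - p ∈ lowDeg σ k := by
  have e : kozPhi M G p - p = ∑ m ∈ p.support, (coeff m p) • (kozE M G m - monomial m 1) := by
    conv_lhs => rw [MvPolynomial.as_sum p]
    rw [map_sum, ← Finset.sum_sub_distrib]
    refine Finset.sum_congr rfl fun m _ => ?_
    have : monomial m (coeff m p) = coeff m p • monomial m (1:ℂ) := by
      rw [smul_monomial, smul_eq_mul, mul_one]
    rw [this, map_smul, kozPhi_monomial, smul_sub]
  rw [e]
  refine sum_mem fun m hm => Submodule.smul_mem _ _ ?_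
  exact lowDeg_mono (Nat.lt_succ_iff.1 (hp m hm)) (kozE_lead M G hG m)

lemma kozPhi_inj (hG : ∀ i, G i - X i ^ M i ∈ lowDeg σ (M i)) :
    Function.Injective (kozPhi M G) := by
  rw [injective_iff_map_eq_zero]
  intro p hp
  have : ∀ k, p ∈ lowDeg σ (k) → p = 0 := by
    intro k
    induction k with
    | zero =>
      intro h
      rw [← support_eq_empty, Finset.eq_empty_iff_forall_notMem]
      intro m hm
      exact absurd (h m hm) (Nat.not_lt_zero _)
    | succ k ih =>
      intro h
      apply ih
      have := kozPhi_sub M G hG p k h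
      rw [hp, zero_sub] at this
      simpa using this
  exact this _ (mem_lowDeg_totalDegree (Nat.lt_succ_self _))

lemma kozPhi_surj (hG : ∀ i, G i - X i ^ M i ∈ lowDeg σ (M i)) :
    Function.Surjective (kozPhi M G) := by
  intro p
  have : ∀ k, ∀ p ∈ lowDeg σ (k), ∃ q, kozPhi M G q = p := by
    intro k
    induction k with
    | zero =>
      intro p h
      refine ⟨0, ?_⟩
      rw [map_zero, eq_comm, ← support_eq_empty, Finset.eq_empty_iff_forall_notMem]
      intro m hm
      exact absurd (h m hm) (Nat.not_lt_zero _)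
    | succ k ih =>
      intro p h
      obtain ⟨q, hq⟩ := ih _ (kozPhi_sub M G hG p k h)
      exact ⟨p - q, by rw [map_sub, hq]; ring⟩
  exact this _ p (mem_lowDeg_totalDegree (Nat.lt_succ_self _))

lemma kozPhi_mul (hM : ∀ i, 0 < M i) (i : σ) (p : MvPolynomial σ ℂ) :
    kozPhi M G (X i ^ M i * p) = G i * kozPhi M G p := by
  induction p using MvPolynomial.induction_on' with
  | add p q hp hq => rw [mul_add, map_add, map_add, hp, hq, mul_add]
  | monomial m c =>
    have : monomial m c = c • monomial m (1:ℂ) := by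
      rw [smul_monomial, smul_eq_mul, mul_one]
    rw [this, mul_smul_comm, map_smul, map_smul, mul_smul_comm]
    congr 1
    rw [X_pow_eq_monomial, monomial_mul, one_mul, kozPhi_monomial, kozPhi_monomial, kozE, kozE,
      ← Finset.mul_prod_erase _ _ (Finset.mem_univ i),
      ← Finset.mul_prod_erase Finset.univ (fun j => G j ^ (m j / M j) * X j ^ (m j % M j))
        (Finset.mem_univ i), ← mul_assoc]
    congr 1
    · simp only [Finsupp.add_apply, Finsupp.single_eq_same]
      rw [Nat.add_mod_left, Nat.add_div_left _ (hM i), pow_succ]; ring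
    · refine Finset.prod_congr rfl fun j hj => ?_
      have : j ≠ i := Finset.ne_of_mem_erase hj
      simp [Finsupp.single_apply, this.symm]

lemma koz_span (hM : ∀ i, 0 < M i) (hG : ∀ i, G i - X i ^ M i ∈ lowDeg σ (M i)) (S : Finset σ)
    (p : MvPolynomial σ ℂ) :
    kozPhi M G p ∈ Ideal.span (G '' S) ↔ p ∈ Ideal.span ((fun i => X i ^ M i) '' (S : Set σ)) := by
  constructor
  · intro h
    rw [mem_span_img_fin] at h
    obtain ⟨c, hc⟩ := h
    choose c' hc' using fun i => kozPhi_surj M G hG (c i)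
    have : p = ∑ i ∈ S, X i ^ M i * c' i := by
      apply kozPhi_inj M G hG
      rw [map_sum, ← hc]
      refine Finset.sum_congr rfl fun i _ => ?_
      rw [kozPhi_mul M G hM, hc', smul_eq_mul, mul_comm]
    rw [this]
    exact sum_mem fun i hi => Ideal.mul_mem_right _ _ (Ideal.subset_span ⟨i, hi, rfl⟩)
  · intro h
    rw [mem_span_img_fin] at h
    obtain ⟨c, hc⟩ := h
    rw [← hc, map_sum]
    refine sum_mem fun i hi => ?_
    rw [smul_eq_mul, mul_comm, kozPhi_mul M G hM]
    exact Ideal.mul_mem_right _ _ (Ideal.subset_span ⟨i, hi, rfl⟩)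

lemma koz_nzd (hM : ∀ i, 0 < M i) (hG : ∀ i, G i - X i ^ M i ∈ lowDeg σ (M i)) (S : Finset σ)
    (i : σ) (hi : i ∉ S) (p : MvPolynomial σ ℂ) (hp : p * G i ∈ Ideal.span (G '' S)) :
    p ∈ Ideal.span (G '' S) := by
  obtain ⟨q, rfl⟩ := kozPhi_surj M G hG p
  rw [mul_comm, ← kozPhi_mul M G hM, koz_span M G hM hG] at hp
  rw [koz_span M G hM hG]
  have e : ((fun i => X i ^ M i) '' (S : Set σ) : Set (MvPolynomial σ ℂ))
      = (fun m => monomial m (1:ℂ)) '' ((fun i => Finsupp.single i (M i)) '' (S : Set σ)) := by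
    rw [Set.image_image]
    exact Set.image_congr fun j _ => X_pow_eq_monomial
  rw [e, mem_ideal_span_monomial_image] at hp ⊢
  intro m hm
  obtain ⟨_, ⟨j, hj, rfl⟩, hle⟩ := hp (Finsupp.single i (M i) + m) (by
    rw [X_pow_eq_monomial, mem_support_iff, coeff_monomial_mul, one_mul]
    exact mem_support_iff.1 hm)
  refine ⟨_, ⟨j, hj, rfl⟩, ?_⟩
  rw [Finsupp.single_le_iff] at hle ⊢
  have hji : i ≠ j := by rintro rfl; exact hi hj
  rwa [Finsupp.add_apply, Finsupp.single_eq_of_ne' hji, zero_add] at hle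

/-- Koszul syzygies from regularity. -/
lemma koszul_of_nzd {A : Type*} [CommRing A] (G : σ → A)
    (h : ∀ (S : Finset σ) (i : σ), i ∉ S → ∀ p, p * G i ∈ Ideal.span (G '' S) →
      p ∈ Ideal.span (G '' S)) (S : Finset σ) :
    ∀ s : σ → A, (∀ i ∉ S, s i = 0) → ∑ i, s i * G i = 0 →
      ∃ K : Matrix σ σ A, K.transpose = - K ∧ s = K.mulVec G := by
  induction S using Finset.induction_on with
  | empty =>
    intro s hs _
    refine ⟨0, by simp, ?_⟩
    ext i; simp [hs i]
  | insert a S ha ih =>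
    intro s hs hsum
    have h1 : s a * G a ∈ Ideal.span (G '' S) := by
      rw [← Finset.add_sum_erase _ _ (Finset.mem_univ a)] at hsum
      rw [eq_neg_of_add_eq_zero_left hsum]
      refine neg_mem (sum_mem fun i hi => ?_)
      by_cases hiS : i ∈ S
      · exact Ideal.mul_mem_left _ _ (Ideal.subset_span ⟨i, hiS, rfl⟩)
      · rw [hs i (by simp [hiS, Finset.ne_of_mem_erase hi]), zero_mul]; exact zero_mem _
    have h2 := h S a ha _ h1
    rw [mem_span_img_fin] at h2
    obtain ⟨c, hc⟩ := h2
    let k : σ → A := fun i => if i ∈ S then c i else 0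
    have hk : s a = ∑ i, k i * G i := by
      rw [← hc, ← Finset.sum_filter_add_sum_filter_not Finset.univ (· ∈ S)]
      rw [Finset.sum_eq_zero (s := Finset.univ.filter (· ∉ S)), add_zero]
      · rw [Finset.filter_univ_mem]
        exact Finset.sum_congr rfl fun i hi => by simp [k, hi]
      · intro i hi; simp only [Finset.mem_filter] at hi; simp [k, hi.2]
    have hka : k a = 0 := by simp [k, ha]
    obtain ⟨K, hK, hsK⟩ := ih (fun i => if i = a then 0 else s i + k i * G a) (by
        intro i hi
        by_cases hia : i = a
        · simp [hia]
        · have : k i = 0 := by simp [k, hi]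
          simp [hia, this, hs i (by simp [hi, hia])]) (by
        have e : ∀ i, (if i = a then 0 else s i + k i * G a) * G i
          = (s i * G i + k i * G i * G a) - if i = a then s a * G a else 0 := by
          intro i
          split_ifs with h
          · subst h; rw [hka]; ring
          · ring
        rw [Finset.sum_congr rfl fun i _ => e i, Finset.sum_sub_distrib, Finset.sum_add_distrib,
          hsum, ← Finset.sum_mul, ← hk]
        simp)
    refine ⟨K + Matrix.of (fun i j => if i = a then k j else if j = a then - k i else 0), ?_, ?_⟩
    · rw [Matrix.transpose_add, hK, neg_add]
      congr 1
      ext i j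
      simp only [Matrix.transpose_apply, Matrix.of_apply, Matrix.neg_apply]
      by_cases hi : i = a <;> by_cases hj : j = a <;> simp [hi, hj, hka]
    · rw [Matrix.add_mulVec, ← hsK]
      ext i
      simp only [Pi.add_apply, Matrix.mulVec, dotProduct, Matrix.of_apply]
      by_cases hi : i = a
      · simp [hi, hk]
      · simp [hi]

end koszul

/-- localization of an ideal at a point -/
def locI {σ : Type*} (I : Ideal (MvPolynomial σ ℂ)) (v : σ → ℂ) : Ideal (MvPolynomial σ ℂ) where
  carrier := {h | ∃ q, eval v q ≠ 0 ∧ q * h ∈ I}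
  zero_mem' := ⟨1, by simp, by simp⟩
  add_mem' := by
    rintro a b ⟨q, hq, hqa⟩ ⟨r, hr, hrb⟩
    refine ⟨q * r, by simp [hq, hr], ?_⟩
    have : q * r * (a + b) = r * (q * a) + q * (r * b) := by ring
    rw [this]
    exact add_mem (I.mul_mem_left _ hqa) (I.mul_mem_left _ hrb)
  smul_mem' := by
    rintro c a ⟨q, hq, hqa⟩
    refine ⟨q, hq, ?_⟩
    have : q * (c • a) = c * (q * a) := by rw [smul_eq_mul]; ring
    rw [this]
    exact I.mul_mem_left _ hqa

lemma mem_locI {σ : Type*} {I : Ideal (MvPolynomial σ ℂ)} {v : σ → ℂ} {h : MvPolynomial σ ℂ} :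
    h ∈ locI I v ↔ ∃ q, eval v q ≠ 0 ∧ q * h ∈ I := Iff.rfl

lemma le_locI {σ : Type*} (I : Ideal (MvPolynomial σ ℂ)) (v : σ → ℂ) : I ≤ locI I v :=
  fun h hh => ⟨1, by simp, by simpa using hh⟩

lemma locI_mono {σ : Type*} {I J : Ideal (MvPolynomial σ ℂ)} (h : I ≤ J) (v : σ → ℂ) :
    locI I v ≤ locI J v := fun _ ⟨q, hq, hx⟩ => ⟨q, hq, h hx⟩

lemma mem_locI_of_mul {σ : Type*} {I : Ideal (MvPolynomial σ ℂ)} {v : σ → ℂ}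
    {q h : MvPolynomial σ ℂ} (hq : eval v q ≠ 0) (h1 : q * h ∈ locI I v) : h ∈ locI I v := by
  obtain ⟨r, hr, h2⟩ := h1
  exact ⟨r * q, by simp [hr, hq], by rwa [mul_assoc]⟩

lemma locI_locI {σ : Type*} (I : Ideal (MvPolynomial σ ℂ)) (v : σ → ℂ) :
    locI (locI I v) v = locI I v :=
  le_antisymm (fun _ ⟨_, hq, hx⟩ => mem_locI_of_mul hq hx) (le_locI _ _)

lemma locI_le_iff {σ : Type*} {I J : Ideal (MvPolynomial σ ℂ)} {v : σ → ℂ} :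
    locI I v ≤ locI J v ↔ I ≤ locI J v :=
  ⟨fun h => (le_locI I v).trans h, fun h => (locI_mono h v).trans (locI_locI J v).le⟩

lemma locI_sup_locI {σ : Type*} (I J : Ideal (MvPolynomial σ ℂ)) (v : σ → ℂ) :
    locI (locI I v ⊔ J) v = locI (I ⊔ J) v := by
  apply le_antisymm
  · rw [locI_le_iff]
    exact sup_le (locI_mono le_sup_left v) (le_sup_right.trans (le_locI _ _))
  · exact locI_mono (sup_le_sup_right (le_locI _ _) _) v

section C1
variable {σ : Type*} [Fintype σ] [DecidableEq σ]

theorem C1 (θ : σ → MvPolynomial σ ℂ) (v : σ → ℂ)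
    (hfin : ∀ i, ∃ k : ℕ, (X i - C (v i))^k ∈ locI (Ideal.span (Set.range θ)) v) (i0 : σ)
    (h : MvPolynomial σ ℂ) (hh : h * θ i0 ∈ locI (Ideal.span (θ '' {i0}ᶜ)) v) :
    h ∈ locI (Ideal.span (θ '' {i0}ᶜ)) v := by
  choose k q0 hq0 hk using hfin
  let q := ∏ i, q0 i
  have hqv : eval v q ≠ 0 := by
    simp only [q, map_prod]
    exact Finset.prod_ne_zero_iff.2 fun i _ => hq0 i
  have hq : ∀ i, ∃ r : σ → MvPolynomial σ ℂ, ∑ j, r j * θ j = q * (X i - C (v i))^(k i) := by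
    intro i
    rw [← Ideal.mem_span_range_iff_exists_fun]
    have : q * (X i - C (v i))^(k i) =
      (∏ j ∈ Finset.univ.erase i, q0 j) * (q0 i * (X i - C (v i))^(k i)) := by
      simp only [q]
      rw [← Finset.mul_prod_erase Finset.univ q0 (Finset.mem_univ i)]; ring
    rw [this]
    exact Ideal.mul_mem_left _ _ (hk i)
  choose r hr using hq
  let M : ℕ := 1 + ∑ i, ((θ i).totalDegree + k i)
  have hM : ∀ i, (θ i).totalDegree + k i < M := fun i => by
    have := Finset.single_le_sum (f := fun i => (θ i).totalDegree + k i)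
      (fun _ _ => Nat.zero_le _) (Finset.mem_univ i)
    simp only [M]; omega
  let G : σ → MvPolynomial σ ℂ := fun i => θ i + (X i - C (v i))^M
  have hG : ∀ i, G i - X i ^ M ∈ lowDeg σ M := by
    intro i
    have h1 : (X i - C (v i) : MvPolynomial σ ℂ)^M - X i ^ M ∈ lowDeg σ M := by
      have h0 : (X i - C (v i) : MvPolynomial σ ℂ) - monomial (Finsupp.single i 1) 1
          ∈ lowDeg σ (Finsupp.single i 1).degree := by
        have : (X i - C (v i) : MvPolynomial σ ℂ) - monomial (Finsupp.single i 1) 1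
          = C (- v i) := by
          change X i - C (v i) - X i = _
          rw [C_neg]; ring
        rw [this]
        exact mem_lowDeg_totalDegree (by simp)
      have := pow_lead (X i - C (v i)) (Finsupp.single i 1) h0 M
      rw [X_pow_eq_monomial]
      simpa using this
    have h2 : θ i ∈ lowDeg σ M := mem_lowDeg_totalDegree (by have := hM i; omega)
    have : G i - X i ^ M = θ i + ((X i - C (v i) : MvPolynomial σ ℂ)^M - X i ^ M) := by
      simp only [G]; ring
    rw [this]; exact add_mem h2 h1
  let U : Matrix σ σ (MvPolynomial σ ℂ) := q • (1 : Matrix σ σ (MvPolynomial σ ℂ)) +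
    Matrix.of fun i j => (X i - C (v i))^(M - k i) * r i j
  have hU : U.mulVec θ = q • G := by
    simp only [U]
    rw [Matrix.add_mulVec, Matrix.smul_mulVec, Matrix.one_mulVec]
    ext1 i
    simp only [Pi.add_apply, Pi.smul_apply, Matrix.mulVec, dotProduct, Matrix.of_apply, G,
      smul_eq_mul, mul_add]
    congr 1
    simp only [mul_assoc]
    rw [← Finset.mul_sum, hr i, mul_left_comm, ← pow_add]
    congr 2
    have := hM i; omega
  have hdet : eval v U.det ≠ 0 := by
    rw [RingHom.map_det]
    have : (eval v).mapMatrix U = (eval v q) • (1 : Matrix σ σ ℂ) := by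
      ext i j
      have : M - k i ≠ 0 := by have := hM i; omega
      simp only [U, RingHom.mapMatrix_apply, Matrix.map_apply, Matrix.add_apply, Matrix.of_apply,
        Matrix.smul_apply, map_add, map_mul, smul_eq_mul, map_pow, map_sub, eval_X, eval_C, sub_self,
        zero_pow this, zero_mul, add_zero]
      rw [Matrix.one_apply, Matrix.one_apply]; split_ifs <;> simp
    rw [this, Matrix.det_smul, Matrix.det_one, mul_one]
    exact pow_ne_zero _ hqv
  obtain ⟨q', hq', hh'⟩ := hh
  have : ∃ c : σ → MvPolynomial σ ℂ, ∑ i ∈ Finset.univ.erase i0, c i • θ i = q' * (h * θ i0) := by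
    rw [← mem_span_img_fin]
    have : ((Finset.univ.erase i0 : Finset σ) : Set σ) = {i0}ᶜ := by ext; simp
    rw [this]; exact hh'
  obtain ⟨c, hc⟩ := this
  let s : σ → MvPolynomial σ ℂ := fun i => if i = i0 then q' * h else - c i
  have hs : s ⬝ᵥ θ = 0 := by
    rw [dotProduct, ← Finset.add_sum_erase _ _ (Finset.mem_univ i0)]
    have : ∑ i ∈ Finset.univ.erase i0, s i * θ i = - (q' * (h * θ i0)) := by
      rw [← hc, ← Finset.sum_neg_distrib]
      refine Finset.sum_congr rfl fun i hi => ?_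
      simp [s, Finset.ne_of_mem_erase hi]
    rw [this]; simp only [s, if_true]; ring
  let s' := Matrix.vecMul s U.adjugate
  have hq_ne : q ≠ 0 := by rintro h0; rw [h0] at hqv; simp at hqv
  have hs' : ∑ i, s' i * G i = 0 := by
    have : q * (s' ⬝ᵥ G) = 0 := by
      rw [← smul_eq_mul, ← dotProduct_smul, ← hU, Matrix.dotProduct_mulVec]
      simp only [s']
      rw [Matrix.vecMul_vecMul, Matrix.adjugate_mul, Matrix.vecMul_smul, Matrix.vecMul_one,
        smul_dotProduct, hs, smul_zero]
    exact (mul_eq_zero.1 this).resolve_left hq_ne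
  obtain ⟨K, hK, hsK⟩ := koszul_of_nzd G
    (fun S i hi p hp => koz_nzd (fun _ => M) G (fun i => by have := hM i; omega) hG S i hi p hp)
    Finset.univ s' (by simp) hs'
  let L := U.transpose * K * U
  have hL : L.transpose = - L := by
    simp [L, Matrix.transpose_mul, hK, Matrix.mul_assoc]
  have hLs : (q * U.det) • s = L.mulVec θ := by
    simp only [L]
    rw [← Matrix.mulVec_mulVec, hU, Matrix.mulVec_smul, ← Matrix.mulVec_mulVec, ← hsK,
      Matrix.mulVec_transpose]
    simp only [s']
    rw [Matrix.vecMul_vecMul, Matrix.adjugate_mul, Matrix.vecMul_smul, Matrix.vecMul_one, smul_smul]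
  have hLi : L i0 i0 = 0 := by
    have := congrFun (congrFun hL i0) i0
    simp only [Matrix.transpose_apply, Matrix.neg_apply] at this
    exact self_eq_neg.1 this
  have h3 := congrFun hLs i0
  refine ⟨q * U.det * q', ?_, ?_⟩
  · simp only [map_mul]; exact mul_ne_zero (mul_ne_zero hqv hdet) hq'
  · have e : q * U.det * q' * h = ∑ i, L i0 i * θ i := by
      have : (L.mulVec θ) i0 = ∑ i, L i0 i * θ i := rfl
      rw [← this, ← h3]; simp [s]; ring
    rw [e]
    refine sum_mem fun i _ => ?_
    by_cases hi : i = i0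
    · rw [hi, hLi, zero_mul]; exact zero_mem _
    · exact Ideal.mul_mem_left _ _ (Ideal.subset_span ⟨i, hi, rfl⟩)
end C1

/-- finite local multiplicity -/
def FinAt {σ : Type*} (I : Ideal (MvPolynomial σ ℂ)) (v : σ → ℂ) : Prop :=
  Module.Finite ℂ (MvPolynomial σ ℂ ⧸ locI I v)

/-- local multiplicity -/
def imu {σ : Type*} (I : Ideal (MvPolynomial σ ℂ)) (v : σ → ℂ) : ℕ :=
  Module.finrank ℂ (MvPolynomial σ ℂ ⧸ locI I v)

section B1
variable {σ : Type*}

lemma finite_quot_mono {A : Type*} [CommRing A] [Algebra ℂ A] {I J : Ideal A} (h : I ≤ J)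
    (hI : Module.Finite ℂ (A ⧸ I)) : Module.Finite ℂ (A ⧸ J) := by
  refine Module.Finite.of_surjective (Ideal.Quotient.factorₐ ℂ h).toLinearMap ?_
  exact Ideal.Quotient.factor_surjective h

lemma finrank_quot_mono {A : Type*} [CommRing A] [Algebra ℂ A] {I J : Ideal A} (h : I ≤ J)
    (hI : Module.Finite ℂ (A ⧸ I)) : Module.finrank ℂ (A ⧸ J) ≤ Module.finrank ℂ (A ⧸ I) := by
  refine LinearMap.finrank_le_finrank_of_surjective (f := (Ideal.Quotient.factorₐ ℂ h).toLinearMap) ?_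
  exact Ideal.Quotient.factor_surjective h

lemma finite_quot_of_nilp [Finite σ] {I : Ideal (MvPolynomial σ ℂ)}
    (h : ∀ i, ∃ p : Polynomial ℂ, p ≠ 0 ∧ Polynomial.aeval (X i) p ∈ I) :
    Module.Finite ℂ (MvPolynomial σ ℂ ⧸ I) := by
  have hX : ∀ i, IsIntegral ℂ (Ideal.Quotient.mk I (X i)) := by
    intro i
    obtain ⟨p, hp, hpi⟩ := h i
    rw [← isAlgebraic_iff_isIntegral]
    refine ⟨p, hp, ?_⟩
    have := Polynomial.aeval_algHom_apply (Ideal.Quotient.mkₐ ℂ I) (X i : MvPolynomial σ ℂ) p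
    rw [Ideal.Quotient.mkₐ_eq_mk] at this
    rw [this]
    exact Ideal.Quotient.eq_zero_iff_mem.2 hpi
  have : Algebra.IsIntegral ℂ (MvPolynomial σ ℂ ⧸ I) := by
    constructor
    intro x
    obtain ⟨x, rfl⟩ := Ideal.Quotient.mk_surjective x
    induction x using MvPolynomial.induction_on with
    | C a => exact isIntegral_algebraMap (R := ℂ) (A := MvPolynomial σ ℂ ⧸ I) (x := a)
    | add p q hp hq => rw [map_add]; exact hp.add hq
    | mul_X p i hp => rw [map_mul]; exact hp.mul (hX i)
  exact Algebra.IsIntegral.finite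

lemma poly_mem_of_finite {A : Type*} [CommRing A] [Algebra ℂ A] {I : Ideal A}
    (h : Module.Finite ℂ (A ⧸ I)) (x : A) :
    ∃ p : Polynomial ℂ, p ≠ 0 ∧ Polynomial.aeval x p ∈ I := by
  obtain ⟨p, hp, hpx⟩ := (isAlgebraic_iff_isIntegral.2
    (Algebra.IsIntegral.isIntegral (R := ℂ) (Ideal.Quotient.mk I x)))
  refine ⟨p, hp, ?_⟩
  have := Polynomial.aeval_algHom_apply (Ideal.Quotient.mkₐ ℂ I) x p
  rw [Ideal.Quotient.mkₐ_eq_mk] at this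
  rw [this] at hpx
  exact Ideal.Quotient.eq_zero_iff_mem.1 hpx

lemma FinAt.nilp {I : Ideal (MvPolynomial σ ℂ)} {v : σ → ℂ} (h : FinAt I v)
    (x : MvPolynomial σ ℂ) : ∃ k : ℕ, (x - C (eval v x))^k ∈ locI I v := by
  obtain ⟨p, hp, hpx⟩ := poly_mem_of_finite h x
  obtain ⟨r, hr, hr2⟩ := Polynomial.exists_eq_pow_rootMultiplicity_mul_and_not_dvd p hp (eval v x)
  refine ⟨p.rootMultiplicity (eval v x), ?_⟩
  apply mem_locI_of_mul (q := Polynomial.aeval x r)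
  · intro h0
    apply hr2
    rw [Polynomial.dvd_iff_isRoot, Polynomial.IsRoot, ← h0]
    have := Polynomial.aeval_algHom_apply (MvPolynomial.aeval (R := ℂ) v) x r
    simpa [MvPolynomial.aeval_eq_eval, Polynomial.aeval_def] using this
  · rw [hr] at hpx
    simpa [mul_comm, MvPolynomial.algebraMap_eq] using hpx

lemma finAt_iff [Finite σ] {I : Ideal (MvPolynomial σ ℂ)} {v : σ → ℂ} :
    FinAt I v ↔ ∀ i, ∃ k : ℕ, (X i - C (v i))^k ∈ locI I v := by
  constructor
  · intro h i
    simpa using h.nilp (X i)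
  · intro h
    refine finite_quot_of_nilp fun i => ?_
    obtain ⟨k, hk⟩ := h i
    refine ⟨(Polynomial.X - Polynomial.C (v i))^k, pow_ne_zero _ (Polynomial.X_sub_C_ne_zero _), ?_⟩
    simpa [MvPolynomial.algebraMap_eq] using hk

lemma FinAt.mono {I J : Ideal (MvPolynomial σ ℂ)} {v : σ → ℂ} (h : FinAt I v)
    (hIJ : I ≤ locI J v) : FinAt J v := finite_quot_mono (locI_le_iff.2 hIJ) h

lemma FinAt.imu_le {I J : Ideal (MvPolynomial σ ℂ)} {v : σ → ℂ} (h : FinAt I v)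
    (hIJ : I ≤ locI J v) : imu J v ≤ imu I v := finrank_quot_mono (locI_le_iff.2 hIJ) h

lemma imu_congr {I J : Ideal (MvPolynomial σ ℂ)} {v : σ → ℂ} (h : I ≤ locI J v)
    (h' : J ≤ locI I v) : imu I v = imu J v := by
  have : locI I v = locI J v := le_antisymm (locI_le_iff.2 h) (locI_le_iff.2 h')
  rw [imu, imu, this]

/-- transfer along a surjection -/
lemma quot_comap_equiv {A B : Type*} [CommRing A] [CommRing B] [Algebra ℂ A] [Algebra ℂ B]
    (π : A →ₐ[ℂ] B) (hπ : Function.Surjective π) (J : Ideal B) :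
    Nonempty ((A ⧸ J.comap π) ≃ₐ[ℂ] (B ⧸ J)) := by
  have h1 : Function.Surjective ((Ideal.Quotient.mkₐ ℂ J).comp π) :=
    (Ideal.Quotient.mkₐ_surjective ℂ J).comp hπ
  have h2 : RingHom.ker ((Ideal.Quotient.mkₐ ℂ J).comp π) = J.comap π := by
    ext x; simp [RingHom.mem_ker, Ideal.Quotient.eq_zero_iff_mem]
  exact ⟨(Ideal.quotientEquivAlgOfEq ℂ h2.symm).trans
    (Ideal.quotientKerAlgEquivOfSurjective h1)⟩

lemma comap_locI {τ : Type*} (π : MvPolynomial σ ℂ →ₐ[ℂ] MvPolynomial τ ℂ)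
    (hπ : Function.Surjective π) {v : σ → ℂ} {w : τ → ℂ} (hv : ∀ x, eval w (π x) = eval v x)
    (J : Ideal (MvPolynomial τ ℂ)) : (locI J w).comap π = locI (J.comap π) v := by
  ext x
  simp only [Ideal.mem_comap, mem_locI, map_mul]
  constructor
  · rintro ⟨q, hq, hx⟩
    obtain ⟨q, rfl⟩ := hπ q
    exact ⟨q, by rwa [← hv], hx⟩
  · rintro ⟨q, hq, hx⟩
    exact ⟨π q, by rwa [hv], hx⟩

lemma TR_imu {τ : Type*} (π : MvPolynomial σ ℂ →ₐ[ℂ] MvPolynomial τ ℂ)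
    (hπ : Function.Surjective π) {v : σ → ℂ} {w : τ → ℂ} (hv : ∀ x, eval w (π x) = eval v x)
    (J : Ideal (MvPolynomial τ ℂ)) : imu (J.comap π) v = imu J w := by
  obtain ⟨e⟩ := quot_comap_equiv π hπ (locI J w)
  rw [imu, imu, ← comap_locI π hπ hv]
  exact e.toLinearEquiv.finrank_eq

lemma TR_fin {τ : Type*} (π : MvPolynomial σ ℂ →ₐ[ℂ] MvPolynomial τ ℂ)
    (hπ : Function.Surjective π) {v : σ → ℂ} {w : τ → ℂ} (hv : ∀ x, eval w (π x) = eval v x)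
    (J : Ideal (MvPolynomial τ ℂ)) : FinAt (J.comap π) v ↔ FinAt J w := by
  obtain ⟨e⟩ := quot_comap_equiv π hπ (locI J w)
  rw [FinAt, FinAt, ← comap_locI π hπ hv]
  exact ⟨fun h => Module.Finite.equiv e.toLinearEquiv, fun h => Module.Finite.equiv e.toLinearEquiv.symm⟩

/-- weak Nullstellensatz -/
lemma NS [Finite σ] {J : Ideal (MvPolynomial σ ℂ)} (h : ∀ v : σ → ℂ, ∃ g ∈ J, eval v g ≠ 0) :
    J = ⊤ := by
  rw [← Ideal.radical_eq_top, ← MvPolynomial.vanishingIdeal_zeroLocus_eq_radical (K := ℂ)]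
  have : zeroLocus ℂ J = ∅ := by
    ext v
    simp only [mem_zeroLocus_iff, Set.mem_empty_iff_false, iff_false, not_forall]
    obtain ⟨g, hg, hgv⟩ := h v
    exact ⟨g, hg, by simpa [aeval_eq_eval] using hgv⟩
  rw [this, Ideal.eq_top_iff_one, mem_vanishingIdeal_iff]; simp

/-- strong Nullstellensatz -/
lemma NSS [Finite σ] {J : Ideal (MvPolynomial σ ℂ)} {p : MvPolynomial σ ℂ}
    (h : ∀ v : σ → ℂ, (∀ g ∈ J, eval v g = 0) → eval v p = 0) : ∃ k : ℕ, p ^ k ∈ J := by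
  have : p ∈ J.radical := by
    rw [← MvPolynomial.vanishingIdeal_zeroLocus_eq_radical (K := ℂ), mem_vanishingIdeal_iff]
    intro v hv
    have := h v fun g hg => by simpa [aeval_eq_eval] using mem_zeroLocus_iff.1 hv g hg
    simpa [aeval_eq_eval] using this
  exact this

lemma mem_of_forall_locI [Finite σ] {I : Ideal (MvPolynomial σ ℂ)} {h : MvPolynomial σ ℂ}
    (H : ∀ v : σ → ℂ, h ∈ locI I v) : h ∈ I := by
  have : (I.colon {h} : Ideal (MvPolynomial σ ℂ)) = ⊤ := by
    apply NS
    intro v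
    obtain ⟨q, hq, hqh⟩ := H v
    exact ⟨q, by rw [Submodule.mem_colon_singleton]; exact hqh, hq⟩
  have := (Ideal.eq_top_iff_one _).1 this
  rw [Submodule.mem_colon_singleton] at this
  simpa using this

lemma locI_eq_top {I : Ideal (MvPolynomial σ ℂ)} {v : σ → ℂ} {g : MvPolynomial σ ℂ} (hg : g ∈ I)
    (hgv : eval v g ≠ 0) : locI I v = ⊤ :=
  (Ideal.eq_top_iff_one _).2 ⟨g, hgv, by simpa using hg⟩

lemma imu_eq_zero {I : Ideal (MvPolynomial σ ℂ)} {v : σ → ℂ} {g : MvPolynomial σ ℂ} (hg : g ∈ I)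
    (hgv : eval v g ≠ 0) : imu I v = 0 := by
  rw [imu, locI_eq_top hg hgv]
  have : Subsingleton (MvPolynomial σ ℂ ⧸ (⊤ : Ideal (MvPolynomial σ ℂ))) :=
    Ideal.Quotient.subsingleton_iff.2 rfl
  exact Module.finrank_zero_of_subsingleton

lemma finAt_of_finite {I : Ideal (MvPolynomial σ ℂ)} (h : Module.Finite ℂ (MvPolynomial σ ℂ ⧸ I))
    (v : σ → ℂ) : FinAt I v := finite_quot_mono (le_locI I v) h

theorem SUM [Finite σ] {I : Ideal (MvPolynomial σ ℂ)}
    (hI : Module.Finite ℂ (MvPolynomial σ ℂ ⧸ I)) (Z : Finset (σ → ℂ))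
    (hZ : ∀ v, (∀ g ∈ I, eval v g = 0) → v ∈ Z) :
    Module.finrank ℂ (MvPolynomial σ ℂ ⧸ I) = ∑ v ∈ Z, imu I v := by
  have hinf : ⨅ v : Z, locI I v.1 = I := by
    apply le_antisymm
    · intro h hh
      rw [Ideal.mem_iInf] at hh
      apply mem_of_forall_locI
      intro v
      by_cases hv : v ∈ Z
      · exact hh ⟨v, hv⟩
      · have := mt (hZ v) hv
        push Not at this
        obtain ⟨g, hg, hgv⟩ := this
        rw [locI_eq_top hg hgv]; trivial
    · exact le_iInf fun v => le_locI I v.1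
  have hcop : Pairwise fun (v w : Z) => IsCoprime (locI I v.1) (locI I w.1) := by
    intro v w hvw
    have : v.1 ≠ w.1 := fun h => hvw (Subtype.ext h)
    obtain ⟨i, hi⟩ := Function.ne_iff.1 this
    obtain ⟨k, hk⟩ := (finAt_iff.1 (finAt_of_finite hI v.1)) i
    obtain ⟨l, hl⟩ := (finAt_iff.1 (finAt_of_finite hI w.1)) i
    have h1 : IsCoprime (X i - C (v.1 i)) (X i - C (w.1 i) : MvPolynomial σ ℂ) := by
      refine ⟨- C (v.1 i - w.1 i)⁻¹, C (v.1 i - w.1 i)⁻¹, ?_⟩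
      have : C (v.1 i - w.1 i)⁻¹ * (C (v.1 i) - C (w.1 i) : MvPolynomial σ ℂ) = 1 := by
        rw [← C_sub, ← C_mul, inv_mul_cancel₀ (sub_ne_zero.2 hi), C_1]
      linear_combination this
    obtain ⟨a, b, hab⟩ := h1.pow (m := k) (n := l)
    rw [Ideal.isCoprime_iff_add, Ideal.add_eq_sup, Ideal.one_eq_top, Ideal.eq_top_iff_one, ← hab]
    exact add_mem (Ideal.mem_sup_left (Ideal.mul_mem_left _ _ hk))
      (Ideal.mem_sup_right (Ideal.mul_mem_left _ _ hl))
  let f : MvPolynomial σ ℂ →ₗ[ℂ] (∀ v : Z, MvPolynomial σ ℂ ⧸ locI I v.1) :=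
    LinearMap.pi fun v => (Ideal.Quotient.mkₐ ℂ (locI I v.1)).toLinearMap
  have hf : Function.Surjective f := by
    intro y
    obtain ⟨x, hx⟩ := (Ideal.quotientInfRingEquivPiQuotient _ hcop).surjective y
    obtain ⟨x, rfl⟩ := Ideal.Quotient.mk_surjective x
    exact ⟨x, by rw [← hx]; rfl⟩
  have hk : LinearMap.ker f = I.restrictScalars ℂ := by
    ext x
    rw [LinearMap.mem_ker, funext_iff, Submodule.restrictScalars_mem]
    conv_rhs => rw [← hinf, Ideal.mem_iInf]
    exact forall_congr' fun v => Ideal.Quotient.eq_zero_iff_mem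
  have e1 := (LinearMap.quotKerEquivOfSurjective f hf).finrank_eq
  rw [hk] at e1
  have e2 : Module.finrank ℂ (MvPolynomial σ ℂ ⧸ I)
    = Module.finrank ℂ (MvPolynomial σ ℂ ⧸ I.restrictScalars ℂ) :=
    (Submodule.Quotient.restrictScalarsEquiv ℂ I).symm.finrank_eq
  have : ∀ v : Z, Module.Finite ℂ (MvPolynomial σ ℂ ⧸ locI I v.1) := fun v => finAt_of_finite hI v.1
  rw [e2, e1, Module.finrank_pi_fintype]
  exact Finset.sum_coe_sort Z (fun v => imu I v)

lemma zeros_finite [Finite σ] {I : Ideal (MvPolynomial σ ℂ)}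
    (hI : Module.Finite ℂ (MvPolynomial σ ℂ ⧸ I)) : {v : σ → ℂ | ∀ g ∈ I, eval v g = 0}.Finite := by
  choose p hp hpi using fun i => poly_mem_of_finite hI (X i : MvPolynomial σ ℂ)
  refine Set.Finite.subset (Set.Finite.pi (t := fun i => {z | z ∈ (p i).roots})
    (fun i => Multiset.finite_toSet _)) ?_
  intro v hv i _
  rw [Set.mem_setOf_eq, Polynomial.mem_roots (hp i), Polynomial.IsRoot, ← hv _ (hpi i)]
  have := Polynomial.aeval_algHom_apply (MvPolynomial.aeval (R := ℂ) v) (X i) (p i)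
  simpa [MvPolynomial.aeval_eq_eval, Polynomial.aeval_def] using this

lemma finite_of_zeros [Finite σ] {I : Ideal (MvPolynomial σ ℂ)}
    (hI : {v : σ → ℂ | ∀ g ∈ I, eval v g = 0}.Finite) : Module.Finite ℂ (MvPolynomial σ ℂ ⧸ I) := by
  refine finite_quot_of_nilp fun i => ?_
  let p : Polynomial ℂ := ∏ v ∈ hI.toFinset, (Polynomial.X - Polynomial.C (v i))
  have hp : p ≠ 0 := Finset.prod_ne_zero_iff.2 fun v _ => Polynomial.X_sub_C_ne_zero _
  obtain ⟨k, hk⟩ := NSS (J := I) (p := Polynomial.aeval (X i) p) (by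
    intro v hv
    simp only [p, map_prod]
    refine Finset.prod_eq_zero (i := v) (hI.mem_toFinset.2 hv) ?_
    simp [MvPolynomial.algebraMap_eq])
  exact ⟨p ^ k, pow_ne_zero _ hp, by rwa [map_pow]⟩

end B1

section B2
variable {m : ℕ}

/-- power series whose low coefficients vanish -/
lemma ps_mem_span (k : ℕ) (f : MvPowerSeries (Fin m) ℂ)
    (hf : ∀ a : Fin m →₀ ℕ, (∀ i, a i < k) → MvPowerSeries.coeff a f = 0) :
    f ∈ Ideal.span (Set.range fun i : Fin m => (MvPowerSeries.X i : MvPowerSeries (Fin m) ℂ)^k) := by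
  classical
  let P : (Fin m →₀ ℕ) → Fin m → Prop := fun a i => k ≤ a i ∧ ∀ j < i, a j < k
  let g : Fin m → MvPowerSeries (Fin m) ℂ := fun i a =>
    if P (a + Finsupp.single i k) i then MvPowerSeries.coeff (a + Finsupp.single i k) f else 0
  have : f = ∑ i, MvPowerSeries.X i ^ k * g i := by
    ext a
    rw [map_sum]
    have hterm : ∀ i, MvPowerSeries.coeff a (MvPowerSeries.X i ^ k * g i) =
        if P a i then MvPowerSeries.coeff a f else 0 := by
      intro i
      rw [MvPowerSeries.X_pow_eq, MvPowerSeries.coeff_monomial_mul]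
      by_cases h : Finsupp.single i k ≤ a
      · rw [if_pos h, one_mul]
        change (if P (a - Finsupp.single i k + Finsupp.single i k) i then
          MvPowerSeries.coeff (a - Finsupp.single i k + Finsupp.single i k) f else 0) = _
        rw [tsub_add_cancel_of_le h]
      · rw [if_neg h, if_neg]
        rintro ⟨h1, -⟩
        exact h (Finsupp.single_le_iff.2 h1)
    rw [Finset.sum_congr rfl fun i _ => hterm i]
    by_cases h : ∀ i, a i < k
    · rw [hf a h]; simp
    · push Not at h
      let S : Finset (Fin m) := Finset.univ.filter fun i => k ≤ a i
      have hS : S.Nonempty := by obtain ⟨i, hi⟩ := h; exact ⟨i, by simp [S, hi]⟩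
      have hmin := Finset.mem_filter.1 (S.min'_mem hS)
      rw [Finset.sum_eq_single (S.min' hS)]
      · rw [if_pos]
        refine ⟨hmin.2, fun j hj => ?_⟩
        by_contra hc
        exact absurd (S.min'_le j (by simp [S]; omega)) (not_le.2 hj)
      · intro i _ hi
        rw [if_neg]
        rintro ⟨h1, h2⟩
        have h3 : S.min' hS ≤ i := S.min'_le i (by simp [S, h1])
        have := h2 _ (lt_of_le_of_ne h3 (Ne.symm hi))
        omega
      · simp
  rw [this]
  exact sum_mem fun i _ => Ideal.mul_mem_right _ _ (Ideal.subset_span ⟨i, rfl⟩)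

lemma ps_span_coeff (k : ℕ) (f : MvPowerSeries (Fin m) ℂ)
    (hf : f ∈ Ideal.span (Set.range fun i : Fin m => (MvPowerSeries.X i : MvPowerSeries (Fin m) ℂ)^k))
    (a : Fin m →₀ ℕ) (ha : ∀ i, a i < k) : MvPowerSeries.coeff a f = 0 := by
  classical
  rw [Ideal.mem_span_range_iff_exists_fun] at hf
  obtain ⟨c, rfl⟩ := hf
  rw [map_sum]
  refine Finset.sum_eq_zero fun i _ => ?_
  rw [mul_comm, MvPowerSeries.X_pow_eq, MvPowerSeries.coeff_monomial_mul, if_neg]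
  rw [Finsupp.single_le_iff]
  have := ha i; omega

lemma ps_approx (k : ℕ) (f : MvPowerSeries (Fin m) ℂ) : ∃ p : MvPolynomial (Fin m) ℂ,
    f - p ∈ Ideal.span (Set.range fun i : Fin m => (MvPowerSeries.X i : MvPowerSeries (Fin m) ℂ)^k) := by
  classical
  refine ⟨MvPowerSeries.trunc' ℂ (Finsupp.equivFunOnFinite.symm fun _ => k) f, ?_⟩
  apply ps_mem_span
  intro a ha
  rw [map_sub, MvPolynomial.coeff_coe, MvPowerSeries.coeff_trunc', if_pos, sub_self]
  intro i; simpa using (ha i).le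

lemma poly_mem_span (k : ℕ) (p : MvPolynomial (Fin m) ℂ)
    (hp : (p : MvPowerSeries (Fin m) ℂ) ∈ Ideal.span (Set.range fun i : Fin m => (MvPowerSeries.X i : MvPowerSeries (Fin m) ℂ)^k)) :
    p ∈ Ideal.span (Set.range fun i : Fin m => (X i : MvPolynomial (Fin m) ℂ)^k) := by
  have e : (Set.range fun i : Fin m => (X i : MvPolynomial (Fin m) ℂ)^k)
      = (fun m => monomial m (1:ℂ)) '' (Set.range fun i : Fin m => Finsupp.single i k) := by
    rw [← Set.range_comp]
    congr 1
    ext1 i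
    exact X_pow_eq_monomial
  rw [e, mem_ideal_span_monomial_image]
  intro a ha
  by_contra hc
  push Not at hc
  have := ps_span_coeff k _ hp a fun i => by
    have := hc _ ⟨i, rfl⟩
    rw [Finsupp.single_le_iff] at this; omega
  rw [MvPolynomial.coeff_coe] at this
  exact mem_support_iff.1 ha this

theorem C4 (gs : Set (MvPolynomial (Fin m) ℂ)) (a : Fin m → ℂ) (h : FinAt (Ideal.span gs) a) :
    germDim gs a = imu (Ideal.span gs) a := by
  let sh : MvPolynomial (Fin m) ℂ →ₐ[ℂ] MvPolynomial (Fin m) ℂ := aeval (fun i => X i + C (a i))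
  let sh' : MvPolynomial (Fin m) ℂ →ₐ[ℂ] MvPolynomial (Fin m) ℂ := aeval (fun i => X i - C (a i))
  have hsh : ∀ p, sh' (sh p) = p := by
    intro p
    have : sh'.comp sh = AlgHom.id ℂ _ := by
      ext i; simp [sh, sh', MvPolynomial.algebraMap_eq, aeval_C, ← MvPolynomial.algebraMap_eq, -MvPolynomial.algebraMap_eq]
    exact congrArg (fun f : MvPolynomial (Fin m) ℂ →ₐ[ℂ] MvPolynomial (Fin m) ℂ => f p) this
  have hsh' : ∀ p, sh (sh' p) = p := by
    intro p
    have : sh.comp sh' = AlgHom.id ℂ _ := by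
      ext i; simp [sh, sh', MvPolynomial.algebraMap_eq, aeval_C, ← MvPolynomial.algebraMap_eq, -MvPolynomial.algebraMap_eq]
    exact congrArg (fun f : MvPolynomial (Fin m) ℂ →ₐ[ℂ] MvPolynomial (Fin m) ℂ => f p) this
  let ι : MvPolynomial (Fin m) ℂ →ₐ[ℂ] MvPowerSeries (Fin m) ℂ :=
    (MvPolynomial.coeToMvPowerSeries.algHom (R := ℂ) ℂ).comp sh
  have hι : ∀ p, ι p = ((sh p : MvPolynomial (Fin m) ℂ) : MvPowerSeries (Fin m) ℂ) := by
    intro p; simp [ι]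
  let J : Ideal (MvPowerSeries (Fin m) ℂ) := Ideal.span (ι '' gs)
  have hJ : germDim gs a = Module.finrank ℂ (MvPowerSeries (Fin m) ℂ ⧸ J) := by
    have : (fun g => (MvPolynomial.coeToMvPowerSeries.ringHom
        (aeval (fun i => X i + C (a i)) g) : MvPowerSeries (Fin m) ℂ)) = ι := by
      ext1 g; rw [hι]; rfl
    rw [germDim, this]
  have hIJ : ∀ p ∈ Ideal.span gs, ι p ∈ J := by
    intro p hp
    have : J = (Ideal.span gs).map ι := by rw [Ideal.map_span]
    rw [this]; exact Ideal.mem_map_of_mem _ hp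
  have hunit : ∀ q, eval a q ≠ 0 → IsUnit (ι q) := by
    intro q hq
    rw [MvPowerSeries.isUnit_iff_constantCoeff, isUnit_iff_ne_zero]
    convert hq
    rw [hι, ← MvPowerSeries.coeff_zero_eq_constantCoeff_apply, MvPolynomial.coeff_coe,
      ← constantCoeff_eq, ← eval_zero]
    have := MvPolynomial.comp_aeval (fun i => X i + C (a i)) (MvPolynomial.aeval (R := ℂ) (0 : Fin m → ℂ))
    have := congrArg (fun f : MvPolynomial (Fin m) ℂ →ₐ[ℂ] ℂ => f q) this
    simpa [sh, aeval_eq_eval] using this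
  have hloc : ∀ p ∈ locI (Ideal.span gs) a, ι p ∈ J := by
    rintro p ⟨q, hq, hqp⟩
    have := hIJ _ hqp
    rw [map_mul] at this
    exact ((hunit q hq).mul_left_dvd.2 dvd_rfl : ι q * ι p ∣ ι p).elim fun c hc => by
      rw [hc]; exact Ideal.mul_mem_right _ _ this
  choose k hk using finAt_iff.1 h
  let K := ∑ i, k i
  have hK : ∀ i, (X i - C (a i))^K ∈ locI (Ideal.span gs) a := fun i =>
    Ideal.pow_mem_of_pow_mem _ (hk i) (Finset.single_le_sum (fun _ _ => Nat.zero_le _) (Finset.mem_univ i))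
  have hXK : Ideal.span (Set.range fun i : Fin m => (MvPowerSeries.X i : MvPowerSeries (Fin m) ℂ)^K) ≤ J := by
    rw [Ideal.span_le]
    rintro _ ⟨i, rfl⟩
    have := hloc _ (hK i)
    rw [hι] at this
    simpa [sh] using this
  have hker : ∀ p, ι p ∈ J → p ∈ locI (Ideal.span gs) a := by
    intro p hp
    have h1 : ∀ y ∈ J, ∃ g ∈ Ideal.span gs, y - ι g ∈
      Ideal.span (Set.range fun i : Fin m => (MvPowerSeries.X i : MvPowerSeries (Fin m) ℂ)^K) := by
      intro y hy
      induction hy using Submodule.span_induction with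
      | mem x hx => obtain ⟨g, hg, rfl⟩ := hx; exact ⟨g, Ideal.subset_span hg, by simp⟩
      | zero => exact ⟨0, zero_mem _, by simp⟩
      | add x y _ _ hx hy =>
        obtain ⟨g, hg, h1⟩ := hx
        obtain ⟨g', hg', h2⟩ := hy
        refine ⟨g + g', add_mem hg hg', ?_⟩
        have : x + y - ι (g + g') = (x - ι g) + (y - ι g') := by rw [map_add]; ring
        rw [this]; exact add_mem h1 h2
      | smul c x _ hx =>
        obtain ⟨g, hg, h1⟩ := hx
        obtain ⟨p, hp⟩ := ps_approx K c
        refine ⟨sh' p * g, Ideal.mul_mem_left _ _ hg, ?_⟩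
        have : c • x - ι (sh' p * g) = c * (x - ι g) + ι g * (c - p) := by
          rw [map_mul, hι (sh' p), hsh', smul_eq_mul]; ring
        rw [this]
        exact add_mem (Ideal.mul_mem_left _ _ h1) (Ideal.mul_mem_left _ _ hp)
    obtain ⟨g, hg, h2⟩ := h1 _ hp
    rw [← map_sub, hι] at h2
    have h3 := poly_mem_span _ _ h2
    have h4 := Ideal.mem_map_of_mem sh' h3
    rw [hsh, Ideal.map_span, ← Set.range_comp] at h4
    have h5 : p - g ∈ locI (Ideal.span gs) a := by
      refine (Ideal.span_le.2 ?_) h4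
      rintro _ ⟨i, rfl⟩
      simpa [sh'] using hK i
    have := add_mem h5 (le_locI _ a hg)
    simpa using this
  let f : MvPolynomial (Fin m) ℂ →ₐ[ℂ] (MvPowerSeries (Fin m) ℂ ⧸ J) := (Ideal.Quotient.mkₐ ℂ J).comp ι
  have hf : Function.Surjective f := by
    intro y
    obtain ⟨y, rfl⟩ := Ideal.Quotient.mk_surjective y
    obtain ⟨p, hp⟩ := ps_approx K y
    refine ⟨sh' p, ?_⟩
    change Ideal.Quotient.mk J (ι (sh' p)) = _
    rw [hι, hsh', eq_comm, Ideal.Quotient.eq]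
    exact hXK hp
  have hkf : RingHom.ker f = locI (Ideal.span gs) a := by
    ext p
    rw [RingHom.mem_ker]
    change Ideal.Quotient.mk J (ι p) = 0 ↔ _
    rw [Ideal.Quotient.eq_zero_iff_mem]
    exact ⟨hker p, hloc p⟩
  rw [hJ, imu]
  exact (((Ideal.quotientEquivAlgOfEq ℂ hkf.symm).trans
    (Ideal.quotientKerAlgEquivOfSurjective hf)).toLinearEquiv.finrank_eq).symm
end B2

section D1
variable {σ K : Type*} [Finite σ] [Field K]

lemma joint_eigenvector {V : Type*} [AddCommGroup V] [Module K V] [Nontrivial V]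
    (ρ : MvPolynomial σ K →ₐ[K] Module.End K V)
    (hs : ∀ i, ∃ p : Polynomial K, p.Monic ∧ p.Splits ∧ Polynomial.aeval (ρ (X i)) p = 0) :
    ∃ (a : σ → K) (x : V), x ≠ 0 ∧ ∀ W, ρ W x = (eval a W) • x := by
  letI : Module (MvPolynomial σ K) V := Module.compHom V ρ.toRingHom
  obtain ⟨P, hP⟩ := associatedPrimes.nonempty (MvPolynomial σ K) V
  rw [AssociatedPrimes.mem_iff, isAssociatedPrime_iff] at hP
  obtain ⟨hprime, x, hx⟩ := hP
  have hmem : ∀ W, W ∈ P ↔ ρ W x = 0 := by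
    intro W
    rw [hx, Submodule.mem_colon_singleton, Submodule.mem_bot]; rfl
  have hx0 : x ≠ 0 := by
    rintro rfl
    exact hprime.ne_top ((Ideal.eq_top_iff_one _).2 ((hmem 1).2 (by simp)))
  have h1 : ∀ i, ∃ c : K, X i - C c ∈ P := by
    intro i
    obtain ⟨p, hm, hsp, hp⟩ := hs i
    have h2 : Polynomial.aeval (X i) p ∈ P := by
      rw [hmem, ← Polynomial.aeval_algHom_apply, hp]; rfl
    have h3 := hsp.eq_prod_roots_of_monic hm
    rw [h3, map_multiset_prod, Ideal.IsPrime.multiset_prod_mem_iff_exists_mem hprime] at h2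
    obtain ⟨q, hq, hqP⟩ := h2
    simp only [Multiset.map_map, Multiset.mem_map, Function.comp] at hq
    obtain ⟨c, -, rfl⟩ := hq
    refine ⟨c, ?_⟩
    simpa [MvPolynomial.algebraMap_eq] using hqP
  choose a ha using h1
  refine ⟨a, x, hx0, fun W => ?_⟩
  have h4 : W - C (eval a W) ∈ P := by
    induction W using MvPolynomial.induction_on with
    | C c => simp
    | add p q hp hq =>
      have : p + q - C (eval a (p + q)) = (p - C (eval a p)) + (q - C (eval a q)) := by
        rw [map_add, C_add]; ring
      rw [this]; exact add_mem hp hq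
    | mul_X p i hp =>
      have : p * X i - C (eval a (p * X i)) = X i * (p - C (eval a p)) + C (eval a p) * (X i - C (a i)) := by
        rw [map_mul, C_mul, eval_X]; ring
      rw [this]; exact add_mem (Ideal.mul_mem_left _ _ hp) (Ideal.mul_mem_left _ _ (ha i))
  rw [hmem, map_sub, LinearMap.sub_apply, sub_eq_zero] at h4
  rw [h4, ← MvPolynomial.algebraMap_eq, AlgHom.commutes]; rfl

theorem joint_det (n : ℕ) : ∀ {V : Type*} [AddCommGroup V] [Module K V] [FiniteDimensional K V]
    (ρ : MvPolynomial σ K →ₐ[K] Module.End K V)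
    (_ : ∀ i, ∃ p : Polynomial K, p.Monic ∧ p.Splits ∧ Polynomial.aeval (ρ (X i)) p = 0),
    Module.finrank K V = n →
    ∃ a : Fin n → σ → K, ∀ W, LinearMap.det (ρ W) = ∏ φ, eval (a φ) W := by
  induction n with
  | zero =>
    intro V _ _ _ ρ hs hn
    refine ⟨fun i => i.elim0, fun W => ?_⟩
    have := Module.finrank_zero_iff.1 hn
    simp [LinearMap.det_eq_one_of_subsingleton]
  | succ n ih =>
    intro V _ _ _ ρ hs hn
    have : Nontrivial V := Module.nontrivial_of_finrank_pos (R := K) (by omega)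
    obtain ⟨a, x, hx, hax⟩ := joint_eigenvector ρ hs
    let U : Submodule K V := K ∙ x
    have hU : ∀ W, U ≤ U.comap (ρ W) := by
      intro W
      rw [Submodule.span_singleton_le_iff_mem, Submodule.mem_comap, hax]
      exact Submodule.smul_mem _ _ (Submodule.mem_span_singleton_self x)
    let ρ' : MvPolynomial σ K →ₐ[K] Module.End K (V ⧸ U) :=
      { toFun := fun W => U.mapQ U (ρ W) (hU W)
        map_one' := by ext; simp
        map_zero' := by ext; simp
        map_add' := fun W W' => by ext; simp
        map_mul' := fun W W' => by ext; simp
        commutes' := fun c => by ext; simp [MvPolynomial.algebraMap_eq] }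
    have hfr : Module.finrank K (V ⧸ U) = n := by
      have := U.finrank_quotient_add_finrank
      rw [finrank_span_singleton hx] at this; omega
    have hmap : ∀ (p : Polynomial K) i, Polynomial.aeval (ρ' (X i)) p =
        ρ' (Polynomial.aeval (X i) p) := fun p i => Polynomial.aeval_algHom_apply ρ' (X i) p
    obtain ⟨b, hb⟩ := ih ρ' (fun i => by
      obtain ⟨p, h1, h2, h3⟩ := hs i
      refine ⟨p, h1, h2, ?_⟩
      rw [hmap]
      rw [Polynomial.aeval_algHom_apply ρ (X i) p] at h3
      ext y
      simp [ρ', h3]) hfr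
    refine ⟨Fin.cons a b, fun W => ?_⟩
    rw [Fin.prod_univ_succ, LinearMap.det_eq_det_mul_det U (ρ W) (hU W)]
    simp only [Fin.cons_zero, Fin.cons_succ]
    congr 1
    · have : (ρ W).restrict (p := U) (q := U) (fun x hx => hU W hx) = (eval a W) • LinearMap.id := by
        ext ⟨y, hy⟩
        obtain ⟨c, rfl⟩ := Submodule.mem_span_singleton.1 hy
        simp [hax, smul_comm c]
      rw [this, LinearMap.det_smul, LinearMap.det_id, finrank_span_singleton hx, pow_one, mul_one]
    · exact hb W
end D1

section D2

lemma ps_quot (k : ℕ) : Nonempty ((PowerSeries ℂ ⧸ Ideal.span {(PowerSeries.X : PowerSeries ℂ)^k}) ≃ₗ[ℂ] (Fin k → ℂ)) := by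
  let f : PowerSeries ℂ →ₗ[ℂ] (Fin k → ℂ) := LinearMap.pi fun i => PowerSeries.coeff (i : ℕ)
  have hf : Function.Surjective f := by
    intro y
    refine ⟨PowerSeries.mk fun l => if h : l < k then y ⟨l, h⟩ else 0, ?_⟩
    ext i
    simp [f]
  have hk : LinearMap.ker f = (Ideal.span {(PowerSeries.X : PowerSeries ℂ)^k}).restrictScalars ℂ := by
    ext x
    rw [LinearMap.mem_ker, Submodule.restrictScalars_mem, Ideal.mem_span_singleton,
      PowerSeries.X_pow_dvd_iff, funext_iff]
    exact ⟨fun h l hl => h ⟨l, hl⟩, fun h i => h i i.2⟩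
  have e1 := LinearMap.quotKerEquivOfSurjective f hf
  rw [hk] at e1
  exact ⟨(Submodule.Quotient.restrictScalarsEquiv ℂ _).symm.trans e1⟩

lemma ps_assoc {a : PowerSeries ℂ} (ha : a ≠ 0) : ∃ k : ℕ, Associated a (PowerSeries.X ^ k) :=
  IsDiscreteValuationRing.associated_pow_irreducible ha PowerSeries.X_irreducible

lemma coker_dim {m : ℕ} (M : Matrix (Fin m) (Fin m) (PowerSeries ℂ)) (D : ℕ)
    (hD : Associated M.det (PowerSeries.X ^ D)) :
    Module.Finite ℂ ((Fin m → PowerSeries ℂ) ⧸ LinearMap.range M.mulVecLin) ∧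
    Module.finrank ℂ ((Fin m → PowerSeries ℂ) ⧸ LinearMap.range M.mulVecLin) = D := by
  have hdet : M.det ≠ 0 := by
    intro h; rw [h] at hD
    exact pow_ne_zero D PowerSeries.X_ne_zero ((associated_zero_iff_eq_zero _).1 hD.symm)
  have hinj : Function.Injective M.mulVecLin := by
    rw [← LinearMap.ker_eq_bot, LinearMap.ker_eq_bot']
    intro x hx
    exact Matrix.eq_zero_of_mulVec_eq_zero hdet hx
  let N := LinearMap.range M.mulVecLin
  let e : (Fin m → PowerSeries ℂ) ≃ₗ[PowerSeries ℂ] N := LinearEquiv.ofInjective _ hinj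
  have hfr : Module.finrank (PowerSeries ℂ) N = Module.finrank (PowerSeries ℂ) (Fin m → PowerSeries ℂ) :=
    e.symm.finrank_eq
  let b := Pi.basisFun (PowerSeries ℂ) (Fin m)
  let c := Submodule.smithNormalFormCoeffs b hfr
  have hc : ∀ i, c i ≠ 0 := Submodule.smithNormalFormCoeffs_ne_zero b hfr
  choose k hk using fun i => ps_assoc (hc i)
  have hspan : ∀ i, Ideal.span {c i} = Ideal.span {(PowerSeries.X : PowerSeries ℂ)^(k i)} :=
    fun i => Ideal.span_singleton_eq_span_singleton.2 (hk i)
  have heq : ∀ i, Nonempty ((PowerSeries ℂ ⧸ Ideal.span {c i}) ≃ₗ[ℂ] (Fin (k i) → ℂ)) := by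
    intro i; rw [hspan i]; exact ps_quot (k i)
  haveI hfin : ∀ i, Module.Finite ℂ (PowerSeries ℂ ⧸ Ideal.span ({Submodule.smithNormalFormCoeffs b hfr i} : Set (PowerSeries ℂ))) :=
    fun i => Module.Finite.equiv (heq i).some.symm
  have hsum := Submodule.finrank_quotient_eq_sum (F := ℂ) b hfr
  have h2 : Associated M.det (∏ i, c i) := by
    let b' := Submodule.smithNormalFormTopBasis b hfr
    rw [← Matrix.det_diagonal, ← LinearMap.det_toLin b' (Matrix.diagonal c)]
    have : M.det = LinearMap.det M.mulVecLin := (LinearMap.det_toLin' M).symm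
    rw [this]
    let e' := (b'.equiv (Submodule.smithNormalFormBotBasis b hfr) (Equiv.refl _)).trans e.symm
    refine (LinearMap.associated_det_of_eq_comp e' _ _ ?_).symm
    intro x
    rw [← LinearEquiv.coe_toLinearMap e', ← LinearMap.comp_apply]
    congr 1
    refine b'.ext fun i => ?_
    have h3 : M.mulVecLin (e' (b' i)) = (Submodule.smithNormalFormBotBasis b hfr i : Fin m → PowerSeries ℂ) := by
      have : e (e' (b' i)) = Submodule.smithNormalFormBotBasis b hfr i := by
        simp [e']
      rw [← this]; rfl
    rw [LinearMap.comp_apply, LinearEquiv.coe_toLinearMap, h3, Submodule.smithNormalFormBotBasis_def]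
    rw [Matrix.toLin_self]
    rw [Finset.sum_eq_single i]
    · simp [c, b']
    · intro j _ hj; simp [Matrix.diagonal_apply_ne _ hj]
    · simp
  have h4 : Associated (∏ i, c i) (PowerSeries.X ^ (∑ i, k i)) := by
    rw [← Finset.prod_pow_eq_pow_sum]
    exact Associated.prod Finset.univ _ _ fun i _ => hk i
  have h5 : D = ∑ i, k i := by
    have h6 := hD.symm.trans (h2.trans h4)
    have hX : ¬ IsUnit (PowerSeries.X : PowerSeries ℂ) := PowerSeries.X_irreducible.not_isUnit
    have h7 := (pow_dvd_pow_iff PowerSeries.X_ne_zero hX).1 h6.dvd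
    have h8 := (pow_dvd_pow_iff PowerSeries.X_ne_zero hX).1 h6.symm.dvd
    omega
  refine ⟨?_, ?_⟩
  · exact Module.Finite.equiv (Submodule.quotientEquivDirectSum ℂ b hfr).symm
  · rw [hsum, h5]
    refine Finset.sum_congr rfl fun i _ => ?_
    rw [(heq i).some.finrank_eq]; simp
end D2

section D3
variable {A : Type*} [CommRing A] [Algebra ℂ A] {m : ℕ}

/-- partial digit sums -/
def dS (u : A) (b : Fin m → A) (N : ℕ) : (Fin m → PowerSeries ℂ) →ₗ[ℂ] A :=
  ∑ j, ∑ k ∈ Finset.range N,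
    ((LinearMap.toSpanSingleton ℂ A (u^k * b j)).comp ((PowerSeries.coeff k).comp (LinearMap.proj j)))

lemma dS_apply (u : A) (b : Fin m → A) (N : ℕ) (φ : Fin m → PowerSeries ℂ) :
    dS u b N φ = ∑ j, ∑ k ∈ Finset.range N, PowerSeries.coeff k (φ j) • (u^k * b j) := by
  simp [dS]

lemma dS_succ (u : A) (b : Fin m → A) (N : ℕ) (φ ψ : Fin m → PowerSeries ℂ)
    (h : ∀ j k, PowerSeries.coeff k (ψ j) = PowerSeries.coeff (k+1) (φ j)) :
    dS u b (N+1) φ = (∑ j, PowerSeries.coeff 0 (φ j) • b j) + u * dS u b N ψ := by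
  rw [dS_apply, dS_apply, Finset.mul_sum, ← Finset.sum_add_distrib]
  refine Finset.sum_congr rfl fun j _ => ?_
  rw [Finset.sum_range_succ', add_comm, Finset.mul_sum]
  congr 1
  · simp
  · refine Finset.sum_congr rfl fun k _ => ?_
    rw [h, mul_smul_comm, pow_succ']; simp only [mul_assoc]

lemma dS_mono (u : A) (b : Fin m → A) (L : ℕ → Ideal A) (hL0 : L 0 = ⊤)
    (hmul : ∀ N h, h ∈ L N → u * h ∈ L (N+1)) (N M : ℕ) (hNM : N ≤ M) (φ : Fin m → PowerSeries ℂ) :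
    dS u b M φ - dS u b N φ ∈ L N := by
  have hpow : ∀ k x, u^k * x ∈ L k := by
    intro k
    induction k with
    | zero => intro x; rw [hL0]; trivial
    | succ k ih => intro x; rw [pow_succ', mul_assoc]; exact hmul _ _ (ih x)
  obtain ⟨r, rfl⟩ := Nat.exists_eq_add_of_le hNM
  rw [dS_apply, dS_apply, ← Finset.sum_sub_distrib]
  refine sum_mem fun j _ => ?_
  rw [Finset.sum_range_add, add_sub_cancel_left]
  refine sum_mem fun k _ => ?_
  rw [pow_add, mul_assoc]
  exact Submodule.smul_of_tower_mem _ _ (hpow N _)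

theorem digits (u : A) (b : Fin m → A) (L : ℕ → Ideal A) (hL0 : L 0 = ⊤)
    (hanti : Antitone L)
    (hcancel : ∀ N h, u * h ∈ L (N+1) → h ∈ L N)
    (hmul : ∀ N h, h ∈ L N → u * h ∈ L (N+1))
    (hdiv : ∀ h, h ∈ L 1 → ∀ N, ∃ g, h - u * g ∈ L N)
    (c : A →ₗ[ℂ] (Fin m → ℂ)) (hc : ∀ h, h ∈ L 1 ↔ c h = 0) (hcb : ∀ j, c (b j) = Pi.single j 1) :
    ∃ (ρ : A →ₐ[ℂ] Matrix (Fin m) (Fin m) (PowerSeries ℂ)) (Φ : A →ₗ[ℂ] (Fin m → PowerSeries ℂ)),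
      (∀ h g, Φ (h * g) = (ρ h).mulVec (Φ g)) ∧
      (ρ u = Matrix.scalar (Fin m) PowerSeries.X) ∧
      (∀ N h, h ∈ L N ↔ ∀ j, PowerSeries.X ^ N ∣ Φ h j) ∧
      (∀ N (φ : Fin m → PowerSeries ℂ), ∃ h, ∀ j, PowerSeries.X ^ N ∣ φ j - Φ h j) ∧
      (∀ N h, h ∈ L N → ∀ i j, PowerSeries.X ^ N ∣ ρ h i j) := by
  have hcS : ∀ z : Fin m → ℂ, c (∑ j, z j • b j) = z := by
    intro z
    rw [map_sum]
    ext i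
    simp [hcb, Pi.single_apply]
  have hu1 : ∀ x, u * x ∈ L 1 := fun x => hmul 0 x (by rw [hL0]; trivial)
  -- uniqueness
  have huniq : ∀ N (φ : Fin m → PowerSeries ℂ), dS u b N φ ∈ L N ↔ ∀ j, PowerSeries.X ^ N ∣ φ j := by
    intro N
    induction N with
    | zero => intro φ; simp [hL0]
    | succ N ih =>
      intro φ
      let ψ : Fin m → PowerSeries ℂ := fun j => PowerSeries.mk fun k => PowerSeries.coeff (k+1) (φ j)
      have hψ : ∀ j k, PowerSeries.coeff k (ψ j) = PowerSeries.coeff (k+1) (φ j) := by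
        intro j k; simp [ψ]
      rw [dS_succ u b N φ ψ hψ]
      have key : (∀ j, PowerSeries.X ^ (N+1) ∣ φ j) ↔ (∀ j, PowerSeries.coeff 0 (φ j) = 0) ∧
          ∀ j, PowerSeries.X ^ N ∣ ψ j := by
        rw [← forall_and]
        refine forall_congr' fun j => ?_
        rw [PowerSeries.X_pow_dvd_iff, PowerSeries.X_pow_dvd_iff]
        constructor
        · intro h
          exact ⟨h 0 (by omega), fun k hk => by rw [hψ]; exact h _ (by omega)⟩
        · rintro ⟨h0, h⟩ k hk
          cases k with
          | zero => exact h0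
          | succ k => rw [← hψ]; exact h k (by omega)
      rw [key, ← ih]
      constructor
      · intro h
        have h1 : (∑ j, PowerSeries.coeff 0 (φ j) • b j) ∈ L 1 := by
          have := sub_mem (hanti (by omega : 1 ≤ N+1) h) (hu1 (dS u b N ψ))
          simpa using this
        have h2 : ∀ j, PowerSeries.coeff 0 (φ j) = 0 := by
          rw [hc, hcS (fun j => PowerSeries.coeff 0 (φ j))] at h1
          exact fun j => congrFun h1 j
        refine ⟨h2, ?_⟩
        apply hcancel
        simpa [h2] using h
      · rintro ⟨h0, h⟩
        simp only [h0, zero_smul, Finset.sum_const_zero, zero_add]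
        exact hmul _ _ h
  have hex : ∀ N h, ∃ φ : Fin m → PowerSeries ℂ, h - dS u b N φ ∈ L N := by
    intro N
    induction N with
    | zero => intro h; exact ⟨0, by rw [hL0]; trivial⟩
    | succ N ih =>
      intro h
      have h1 : h - ∑ j, c h j • b j ∈ L 1 := by
        rw [hc, map_sub, hcS, sub_self]
      obtain ⟨g, hg⟩ := hdiv _ h1 (N+1)
      obtain ⟨ψ, hψ⟩ := ih g
      refine ⟨fun j => PowerSeries.C (c h j) + PowerSeries.X * ψ j, ?_⟩
      rw [dS_succ u b N _ ψ (by intro j k; simp [PowerSeries.coeff_succ_X_mul, PowerSeries.coeff_C])]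
      have := add_mem hg (hmul _ _ hψ)
      convert this using 1
      simp
      ring
  choose F hF using hex
  let Φ0 : A → (Fin m → PowerSeries ℂ) := fun h j => PowerSeries.mk fun k => PowerSeries.coeff k (F (k+1) h j)
  have hdiff : ∀ N M h, N ≤ M → ∀ j, PowerSeries.X^N ∣ F M h j - F N h j := by
    intro N M h hNM
    have : dS u b N (F M h - F N h) ∈ L N := by
      rw [map_sub]
      have h1 := hF N h
      have h2 := hanti hNM (hF M h)
      have h3 := dS_mono u b L hL0 hmul N M hNM (F M h)
      have := sub_mem (sub_mem h1 h2) h3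
      convert this using 1; ring
    exact (huniq _ _).1 this
  have hΦF : ∀ N h j, PowerSeries.X^N ∣ Φ0 h j - F N h j := by
    intro N h j
    rw [PowerSeries.X_pow_dvd_iff]
    intro k hk
    have := (PowerSeries.X_pow_dvd_iff.1 (hdiff (k+1) N h (by omega) j)) k (by omega)
    simp only [map_sub, Φ0, PowerSeries.coeff_mk] at this ⊢
    rw [← neg_eq_zero, neg_sub]; exact this
  -- key
  have K : ∀ N h φ, h - dS u b N φ ∈ L N ↔ ∀ j, PowerSeries.X^N ∣ φ j - Φ0 h j := by
    intro N h φ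
    have e1 : h - dS u b N φ ∈ L N ↔ dS u b N (F N h - φ) ∈ L N := by
      rw [map_sub]
      have : h - dS u b N φ = (h - dS u b N (F N h)) + (dS u b N (F N h) - dS u b N φ) := by ring
      rw [this]
      exact Submodule.add_mem_iff_right _ (hF N h)
    rw [e1, huniq]
    refine forall_congr' fun j => ?_
    have h1 := hΦF N h j
    have : (F N h - φ) j = -((Φ0 h j - F N h j) + (φ j - Φ0 h j)) := by simp
    rw [this, dvd_neg]
    exact (dvd_add_right h1)
  have hzero : ∀ x : PowerSeries ℂ, (∀ N, PowerSeries.X^N ∣ x) → x = 0 := by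
    intro x hx
    ext k
    exact PowerSeries.X_pow_dvd_iff.1 (hx (k+1)) k (by omega)
  have hU : ∀ h (φ : Fin m → PowerSeries ℂ), (∀ N, h - dS u b N φ ∈ L N) → Φ0 h = φ := by
    intro h φ hh
    ext1 j
    refine (sub_eq_zero.1 (hzero _ fun N => (K N h φ).1 (hh N) j)).symm
  have hself : ∀ N h, h - dS u b N (Φ0 h) ∈ L N := by
    intro N h; rw [K]; simp
  let Φ : A →ₗ[ℂ] (Fin m → PowerSeries ℂ) :=
    { toFun := Φ0
      map_add' := fun x y => hU _ _ fun N => by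
        rw [map_add]
        have := add_mem (hself N x) (hself N y)
        convert this using 1; ring
      map_smul' := fun r x => hU _ _ fun N => by
        rw [map_smul, RingHom.id_apply, ← smul_sub]
        exact Submodule.smul_of_tower_mem _ _ (hself N x) }
  have hΦu : ∀ h, Φ (u * h) = fun j => PowerSeries.X * Φ h j := by
    intro h
    refine hU _ _ fun N => ?_
    cases N with
    | zero => rw [hL0]; trivial
    | succ N =>
      rw [dS_succ u b N _ (Φ0 h) (by intro j k; rw [PowerSeries.coeff_succ_X_mul]; rfl)]
      have := hmul _ _ (hself N h)
      convert this using 1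
      simp; ring
  have hΦup : ∀ k h, Φ (u^k * h) = fun j => PowerSeries.X^k * Φ h j := by
    intro k h
    induction k with
    | zero => simp
    | succ k ih => rw [pow_succ', mul_assoc, hΦu, ih]; ext1 j; rw [pow_succ', mul_assoc]
  have hΦb : ∀ j, Φ (b j) = Pi.single j 1 := by
    intro j
    refine hU _ _ fun N => ?_
    cases N with
    | zero => rw [hL0]; trivial
    | succ N =>
      rw [dS_succ u b N _ 0 (by
        intro i k
        rcases eq_or_ne i j with rfl | h
        · simp [PowerSeries.coeff_one]
        · simp [Pi.single_eq_of_ne h])]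
      have : (∑ i, PowerSeries.coeff 0 ((Pi.single j 1 : Fin m → PowerSeries ℂ) i) • b i) = b j := by
        rw [Finset.sum_eq_single j]
        · simp
        · intro i _ h; simp [Pi.single_eq_of_ne h]
        · simp
      rw [this]; simp
  have hmem : ∀ N h, h ∈ L N ↔ ∀ j, PowerSeries.X ^ N ∣ Φ h j := by
    intro N h
    have := K N h 0
    rw [map_zero, sub_zero] at this
    rw [this]
    refine forall_congr' fun j => ?_
    rw [Pi.zero_apply, zero_sub, dvd_neg]; rfl
  have hdens : ∀ N (φ : Fin m → PowerSeries ℂ), ∀ j, PowerSeries.X ^ N ∣ φ j - Φ (dS u b N φ) j := by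
    intro N φ
    exact (K N _ φ).1 (by simp)
  let ρ0 : A → Matrix (Fin m) (Fin m) (PowerSeries ℂ) := fun h i j => Φ (h * b j) i
  have hρΦ : ∀ h g, Φ (h * g) = (ρ0 h).mulVec (Φ g) := by
    intro h g
    ext1 i
    refine sub_eq_zero.1 (hzero _ fun N => ?_)
    have h1 : PowerSeries.X^N ∣ Φ (h * (g - dS u b N (Φ g))) i :=
      (hmem N _).1 (Ideal.mul_mem_left _ _ (hself N g)) i
    have h2 : Φ (h * dS u b N (Φ g)) i = ∑ j, (∑ k ∈ Finset.range N, PowerSeries.C (PowerSeries.coeff k (Φ g j)) * PowerSeries.X^k) * ρ0 h i j := by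
      rw [dS_apply, Finset.mul_sum, map_sum, Finset.sum_apply]
      refine Finset.sum_congr rfl fun j _ => ?_
      rw [Finset.mul_sum, map_sum, Finset.sum_apply, Finset.sum_mul]
      refine Finset.sum_congr rfl fun k _ => ?_
      rw [mul_smul_comm, map_smul, ← mul_assoc, mul_comm h, mul_assoc, hΦup, Pi.smul_apply,
        PowerSeries.smul_eq_C_mul, mul_assoc]
    have h3 : ∀ x : PowerSeries ℂ, PowerSeries.X^N ∣ (∑ k ∈ Finset.range N, PowerSeries.C (PowerSeries.coeff k x) * PowerSeries.X^k) - x := by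
      intro x
      rw [PowerSeries.X_pow_dvd_iff]
      intro k hk
      simp [PowerSeries.coeff_C_mul, PowerSeries.coeff_X_pow, hk]
    have h4 : PowerSeries.X^N ∣ Φ (h * dS u b N (Φ g)) i - (ρ0 h).mulVec (Φ g) i := by
      rw [h2, Matrix.mulVec, dotProduct, ← Finset.sum_sub_distrib]
      refine Finset.dvd_sum fun j _ => ?_
      have := dvd_mul_of_dvd_left (h3 (Φ g j)) (ρ0 h i j)
      convert this using 1; ring
    have := dvd_add h1 h4
    convert this using 1
    rw [mul_sub, map_sub, Pi.sub_apply]; ring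
  let ρ : A →ₐ[ℂ] Matrix (Fin m) (Fin m) (PowerSeries ℂ) := AlgHom.ofLinearMap
    { toFun := ρ0
      map_add' := fun x y => by
        ext1 i j; simp only [ρ0, add_mul, map_add, Pi.add_apply, Matrix.add_apply]; rfl
      map_smul' := fun r x => by
        ext1 i j; simp only [ρ0, smul_mul_assoc, map_smul, Pi.smul_apply, Matrix.smul_apply, RingHom.id_apply]; rfl }
    (by
      ext1 i j
      change Φ (1 * b j) i = _
      rw [one_mul, hΦb, Matrix.one_apply, Pi.single_apply])
    (by
      intro x y
      ext1 i j
      change Φ (x * y * b j) i = _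
      rw [mul_assoc, hρΦ]; rfl)
  refine ⟨ρ, Φ, hρΦ, ?_, hmem, fun N φ => ⟨_, hdens N φ⟩, ?_⟩
  · ext1 i j
    change Φ (u * b j) i = _
    rw [hΦu, hΦb, Matrix.scalar_apply, Matrix.diagonal_apply]
    simp [Pi.single_apply]
  · intro N h hh i j
    exact (hmem N _).1 (Ideal.mul_mem_right _ _ hh) i
end D3

section D4
variable {σ K k : Type*} [Finite σ] [Field K] [CommRing k]

lemma comm_ext {B : Type*} [Ring B] [Algebra K B] (M : σ → B) (hM : ∀ i j, M i * M j = M j * M i) :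
    ∃ ρ : MvPolynomial σ K →ₐ[K] B, ∀ i, ρ (X i) = M i := by
  letI : CommRing (Algebra.adjoin K (Set.range M)) := Algebra.adjoinCommRingOfComm K (by
    rintro _ ⟨i, rfl⟩ _ ⟨j, rfl⟩; exact hM i j)
  let f : MvPolynomial σ K →ₐ[K] Algebra.adjoin K (Set.range M) :=
    aeval fun i => ⟨M i, Algebra.subset_adjoin ⟨i, rfl⟩⟩
  refine ⟨(Algebra.adjoin K (Set.range M)).val.comp f, fun i => ?_⟩
  simp [f]

theorem joint_mat {m : ℕ} (f : k →+* K) (ρ0 : MvPolynomial σ k →+* Matrix (Fin m) (Fin m) K)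
    (hC : ∀ c, ρ0 (C c) = Matrix.scalar (Fin m) (f c))
    (hs : ∀ i, (ρ0 (X i)).charpoly.Splits) :
    ∃ a : Fin m → σ → K, (∀ W, (ρ0 W).det = ∏ φ, eval₂ f (a φ) W) ∧
      (∀ W c, ρ0 W = Matrix.scalar (Fin m) c → ∀ φ, eval₂ f (a φ) W = c) ∧
      (∀ φ W, (Matrix.scalar (Fin m) (eval₂ f (a φ) W) - ρ0 W).det = 0) := by
  obtain ⟨ρ, hρ⟩ := comm_ext (K := K) (fun i => Matrix.toLinAlgEquiv' (ρ0 (X i))) (by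
    intro i j; rw [← map_mul, ← map_mul, ← map_mul, ← map_mul, mul_comm])
  have hρ0 : ∀ W, ρ (map f W) = Matrix.toLinAlgEquiv' (ρ0 W) := by
    intro W
    induction W using MvPolynomial.induction_on with
    | C c =>
      rw [map_C, hC, ← MvPolynomial.algebraMap_eq, AlgHom.commutes,
        ← AlgEquiv.commutes (Matrix.toLinAlgEquiv' (R := K) (n := Fin m))]
      congr 1
    | add p q hp hq => rw [map_add, map_add, hp, hq, map_add, map_add]
    | mul_X p i hp => rw [map_mul, map_mul, hp, map_X, hρ, map_mul, map_mul]
  obtain ⟨a, ha⟩ := joint_det m ρ (fun i => ⟨(ρ0 (X i)).charpoly, Matrix.charpoly_monic _, hs i, by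
    have h1 := Polynomial.aeval_algHom_apply (Matrix.toLinAlgEquiv' (R := K) (n := Fin m)).toAlgHom
      (ρ0 (X i)) (ρ0 (X i)).charpoly
    rw [Matrix.aeval_self_charpoly, map_zero] at h1
    rw [hρ]; exact h1⟩) (by simp)
  have hdet : ∀ M : Matrix (Fin m) (Fin m) K, LinearMap.det (Matrix.toLinAlgEquiv' M) = M.det := fun M => LinearMap.det_toLin' M
  have hsc : ∀ z : K, ρ (C z) = Matrix.toLinAlgEquiv' (Matrix.scalar (Fin m) z) := by
    intro z
    rw [← MvPolynomial.algebraMap_eq, AlgHom.commutes,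
        ← AlgEquiv.commutes (Matrix.toLinAlgEquiv' (R := K) (n := Fin m))]
    congr 1
  have hev : ∀ φ W, eval (a φ) (map f W) = eval₂ f (a φ) W := fun φ W => by rw [MvPolynomial.eval_map]
  have hz : ∀ W φ, (Matrix.scalar (Fin m) (eval₂ f (a φ) W) - ρ0 W).det = 0 := by
    intro W φ
    have := ha (C (eval₂ f (a φ) W) - map f W)
    rw [map_sub, hsc, hρ0, ← map_sub, hdet] at this
    rw [this]
    refine Finset.prod_eq_zero (Finset.mem_univ φ) ?_
    rw [map_sub, eval_C, hev, sub_self]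
  refine ⟨a, fun W => ?_, fun W c hW φ => ?_, fun φ i => ?_⟩
  · have := ha (map f W)
    rw [hρ0, hdet] at this
    rw [this]
    exact Finset.prod_congr rfl fun φ _ => hev φ W
  · have := hz W φ
    rw [hW, ← map_sub, Matrix.scalar_apply, Matrix.det_diagonal, Finset.prod_const] at this
    exact sub_eq_zero.1 (eq_zero_of_pow_eq_zero this)
  · exact hz i φ
end D4

section M1
variable {σ : Type*}

lemma mem_sup_single {A : Type*} [CommRing A] {E : Ideal A} {w x : A} :
    x ∈ E ⊔ Ideal.span {w} ↔ ∃ e ∈ E, ∃ g, x = e + w * g := by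
  rw [Submodule.mem_sup]
  constructor
  · rintro ⟨e, he, y, hy, rfl⟩
    obtain ⟨g, rfl⟩ := Ideal.mem_span_singleton.1 hy
    exact ⟨e, he, g, rfl⟩
  · rintro ⟨e, he, g, rfl⟩
    exact ⟨e, he, w * g, Ideal.mem_span_singleton.2 ⟨g, rfl⟩, rfl⟩

lemma invq {I : Ideal (MvPolynomial σ ℂ)} {v : σ → ℂ} (h : FinAt I v) {q : MvPolynomial σ ℂ}
    (hq : eval v q ≠ 0) : ∃ q', q * q' - 1 ∈ locI I v := by
  obtain ⟨k, hk⟩ := h.nilp q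
  set c := eval v q with hc
  obtain ⟨r, hr⟩ := sub_dvd_pow_sub_pow (C c : MvPolynomial σ ℂ) (C c - q) k
  refine ⟨C ((c^k)⁻¹) * r, ?_⟩
  have h1 : q * r = C (c^k) - (C c - q)^k := by
    rw [C_pow, hr]; ring
  have h2 : q * (C ((c^k)⁻¹) * r) - 1 = -(C ((c^k)⁻¹) * (C c - q)^k) := by
    have h3 : (C ((c^k)⁻¹) : MvPolynomial σ ℂ) * C (c^k) = 1 := by
      rw [← C_mul, inv_mul_cancel₀ (pow_ne_zero _ hq), C_1]
    calc q * (C ((c^k)⁻¹) * r) - 1 = C ((c^k)⁻¹) * (q * r) - 1 := by ring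
      _ = _ := by rw [h1, mul_sub, h3]; ring
  rw [h2, neg_mem_iff]
  refine Ideal.mul_mem_left _ _ ?_
  have : (C c - q)^k = (-1)^k * (q - C c)^k := by rw [← mul_pow]; ring
  rw [this]
  exact Ideal.mul_mem_left _ _ hk

lemma finAt_pow [Finite σ] {E : Ideal (MvPolynomial σ ℂ)} {u : MvPolynomial σ ℂ} {v : σ → ℂ}
    (h : FinAt (E ⊔ Ideal.span {u}) v) (N : ℕ) : FinAt (E ⊔ Ideal.span {u^N}) v := by
  rw [finAt_iff] at h ⊢
  intro i
  obtain ⟨k, q, hq, hk⟩ := h i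
  rw [mem_sup_single] at hk
  obtain ⟨e, he, g, hg⟩ := hk
  refine ⟨k * N, q^N, by rw [map_pow]; exact pow_ne_zero _ hq, ?_⟩
  rw [pow_mul, ← mul_pow, mem_sup_single]
  obtain ⟨r, hr⟩ := sub_dvd_pow_sub_pow (q * (X i - C (v i))^k) (u * g) N
  refine ⟨e * r, Ideal.mul_mem_right _ _ he, g^N, ?_⟩
  have : q * (X i - C (v i))^k - u * g = e := by rw [hg]; ring
  rw [this] at hr
  rw [← hr]; ring

lemma range_eq_sup (θ : σ → MvPolynomial σ ℂ) (i0 : σ) :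
    Ideal.span (Set.range θ) = Ideal.span (θ '' {i0}ᶜ) ⊔ Ideal.span {θ i0} := by
  rw [← Ideal.span_union]
  congr 1
  ext x
  constructor
  · rintro ⟨i, rfl⟩
    by_cases h : i = i0
    · right; rw [h]; rfl
    · left; exact ⟨i, h, rfl⟩
  · rintro (⟨i, -, rfl⟩ | rfl) <;> exact ⟨_, rfl⟩

theorem M1 [Fintype σ] [DecidableEq σ] (θ : σ → MvPolynomial σ ℂ) (v : σ → ℂ) (i0 : σ)
    (E : Ideal (MvPolynomial σ ℂ)) (hE : E = Ideal.span (θ '' {i0}ᶜ))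
    (hfin : FinAt (E ⊔ Ideal.span {θ i0}) v) :
    ∃ (m : ℕ) (ρ : MvPolynomial σ ℂ →ₐ[ℂ] Matrix (Fin m) (Fin m) (PowerSeries ℂ))
      (Φ : MvPolynomial σ ℂ →ₗ[ℂ] (Fin m → PowerSeries ℂ)),
      (∀ h g, Φ (h * g) = (ρ h).mulVec (Φ g)) ∧
      (ρ (θ i0) = Matrix.scalar (Fin m) PowerSeries.X) ∧
      (∀ N h, h ∈ locI (E ⊔ Ideal.span {θ i0 ^ N}) v ↔ ∀ j, PowerSeries.X ^ N ∣ Φ h j) ∧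
      (∀ N (φ : Fin m → PowerSeries ℂ), ∃ h, ∀ j, PowerSeries.X ^ N ∣ φ j - Φ h j) ∧
      (∀ N h, h ∈ locI (E ⊔ Ideal.span {θ i0 ^ N}) v → ∀ i j, PowerSeries.X ^ N ∣ ρ h i j) := by
  set u := θ i0
  let L : ℕ → Ideal (MvPolynomial σ ℂ) := fun N => locI (E ⊔ Ideal.span {u^N}) v
  have hC1 : ∀ h, h * u ∈ locI E v → h ∈ locI E v := by
    subst hE
    intro h hh
    refine C1 θ v (fun i => ?_) i0 h hh
    rw [range_eq_sup θ i0]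
    simpa using hfin.nilp (X i)
  have hEL : ∀ N, E ≤ L N := fun N => le_sup_left.trans (le_locI _ _)
  have hfinN := finAt_pow hfin
  have hfin1 : Module.Finite ℂ (MvPolynomial σ ℂ ⧸ L 1) := hfinN 1
  let bas := Module.finBasis ℂ (MvPolynomial σ ℂ ⧸ L 1)
  choose b hb using fun j => Ideal.Quotient.mk_surjective (bas j)
  refine ⟨_, digits u b L ?_ ?_ ?_ ?_ ?_
    (bas.equivFun.toLinearMap.comp (Ideal.Quotient.mkₐ ℂ (L 1)).toLinearMap) ?_ ?_⟩
  · exact locI_eq_top (g := 1) (by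
      rw [pow_zero, Ideal.span_singleton_one, sup_top_eq]; trivial) (by simp)
  · intro N M hNM
    refine locI_mono (sup_le_sup_left ?_ _) v
    rw [Ideal.span_singleton_le_span_singleton]
    exact pow_dvd_pow u hNM
  · rintro N h ⟨q, hq, hh⟩
    obtain ⟨e, he, r, hr⟩ := mem_sup_single.1 hh
    have h1 : (q * h - r * u^N) * u ∈ E := by
      have : (q * h - r * u^N) * u = e := by linear_combination hr
      rw [this]; exact he
    obtain ⟨q', hq', h2⟩ := hC1 _ (le_locI E v h1)
    refine ⟨q' * q, by simp [hq, hq'], mem_sup_single.2 ⟨_, h2, q' * r, by ring⟩⟩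
  · rintro N h ⟨q, hq, hh⟩
    obtain ⟨e, he, r, hr⟩ := mem_sup_single.1 hh
    exact ⟨q, hq, mem_sup_single.2 ⟨u * e, Ideal.mul_mem_left _ _ he, r, by linear_combination u * hr⟩⟩
  · rintro h ⟨q, hq, hh⟩ N
    obtain ⟨e, he, g, hg⟩ := mem_sup_single.1 hh
    obtain ⟨q', hq'⟩ := invq (hfinN N) hq
    refine ⟨q' * g, ?_⟩
    have : h - u * (q' * g) = -(h * (q * q' - 1)) + q' * e := by linear_combination q' * hg
    rw [this]
    exact add_mem (neg_mem (Ideal.mul_mem_left _ _ hq')) (Ideal.mul_mem_left _ _ (hEL N he))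
  · intro h
    rw [LinearMap.comp_apply]
    change _ ↔ bas.equivFun _ = 0
    rw [LinearEquiv.map_eq_zero_iff]
    exact (Ideal.Quotient.eq_zero_iff_mem).symm
  · intro j
    rw [LinearMap.comp_apply]
    change bas.equivFun (Ideal.Quotient.mk (L 1) (b j)) = _
    rw [hb]
    ext i
    simp [Finsupp.single_apply, Pi.single_apply, eq_comm]
end M1

section M2
variable {σ : Type*} [Fintype σ]

theorem M2 (E : Ideal (MvPolynomial σ ℂ)) (u : MvPolynomial σ ℂ) (v : σ → ℂ)
    (hfin : FinAt (E ⊔ Ideal.span {u}) v) (huv : eval v u = 0)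
    (m : ℕ) (ρ : MvPolynomial σ ℂ →ₐ[ℂ] Matrix (Fin m) (Fin m) (PowerSeries ℂ))
      (Φ : MvPolynomial σ ℂ →ₗ[ℂ] (Fin m → PowerSeries ℂ))
      (hΦ : ∀ h g, Φ (h * g) = (ρ h).mulVec (Φ g))
      (hu : ρ u = Matrix.scalar (Fin m) PowerSeries.X)
      (hmem : ∀ N h, h ∈ locI (E ⊔ Ideal.span {u ^ N}) v ↔ ∀ j, PowerSeries.X ^ N ∣ Φ h j)
      (hdens : ∀ N (φ : Fin m → PowerSeries ℂ), ∃ h, ∀ j, PowerSeries.X ^ N ∣ φ j - Φ h j)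
      (hρL : ∀ N h, h ∈ locI (E ⊔ Ideal.span {u ^ N}) v → ∀ i j, PowerSeries.X ^ N ∣ ρ h i j)
      (w : MvPolynomial σ ℂ) :
    (∀ e ∈ E, ρ e = 0) ∧
    ((ρ w).det ≠ 0 → FinAt (E ⊔ Ideal.span {w}) v ∧
      Associated (ρ w).det (PowerSeries.X ^ (imu (E ⊔ Ideal.span {w}) v))) ∧
    (FinAt (E ⊔ Ideal.span {w}) v → (ρ w).det ≠ 0) := by
  have hzero : ∀ x : PowerSeries ℂ, (∀ N, PowerSeries.X^N ∣ x) → x = 0 := by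
    intro x hx
    ext k
    exact PowerSeries.X_pow_dvd_iff.1 (hx (k+1)) k (by omega)
  have hEL : ∀ N, E ≤ locI (E ⊔ Ideal.span {u ^ N}) v := fun N => le_sup_left.trans (le_locI _ _)
  have hρE : ∀ e ∈ E, ρ e = 0 := by
    intro e he
    ext1 i j
    exact hzero _ fun N => hρL N e (hEL N he) i j
  have hΦE : ∀ e ∈ E, Φ e = 0 := by
    intro e he
    ext1 j
    exact hzero _ fun N => (hmem N e).1 (hEL N he) j
  refine ⟨hρE, ?_, ?_⟩
  · intro hdet
    obtain ⟨D, hD⟩ := ps_assoc hdet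
    obtain ⟨hcf, hcr⟩ := coker_dim (ρ w) D hD
    set Nn := LinearMap.range (ρ w).mulVecLin with hNn
    -- X^D R^m in range
    have hXD : ∀ x : Fin m → PowerSeries ℂ, (∀ j, PowerSeries.X ^ D ∣ x j) → x ∈ Nn := by
      intro x hx
      have : ∀ j, (ρ w).det ∣ x j := fun j => hD.dvd.trans (hx j)
      choose y hy using this
      refine ⟨(ρ w).adjugate.mulVec y, ?_⟩
      rw [Matrix.mulVecLin_apply, Matrix.mulVec_mulVec, Matrix.mul_adjugate, Matrix.smul_mulVec,
        Matrix.one_mulVec]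
      ext1 j
      rw [hy j]; rfl
    -- elements with Φ h in range
    have hker0 : ∀ N h, Φ h ∈ Nn → ∃ g, h - w * g ∈ locI (E ⊔ Ideal.span {u^N}) v := by
      rintro N h ⟨φ, hφ⟩
      obtain ⟨g, hg⟩ := hdens N φ
      refine ⟨g, (hmem N _).2 fun j => ?_⟩
      rw [map_sub, hΦ, ← hφ, Matrix.mulVecLin_apply, ← Matrix.mulVec_sub]
      rw [Matrix.mulVec, dotProduct]
      exact Finset.dvd_sum fun i _ => dvd_mul_of_dvd_right (hg i) _
    have huD : u^D ∈ locI (E ⊔ Ideal.span {w}) v := by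
      have h1 : Φ (u^D) ∈ Nn := by
        refine hXD _ ((hmem D _).1 (le_locI _ _ (Ideal.mem_sup_right (Ideal.mem_span_singleton_self _))))
      obtain ⟨g, q, hq, hg⟩ := hker0 (D+1) _ h1
      obtain ⟨e, he, r, hr⟩ := mem_sup_single.1 hg
      refine ⟨q - u * r, by simp [huv, hq], mem_sup_single.2 ⟨e, he, q * g, ?_⟩⟩
      linear_combination hr
    have hker : ∀ h, h ∈ locI (E ⊔ Ideal.span {w}) v ↔ Φ h ∈ Nn := by
      intro h
      constructor
      · rintro ⟨q, hq, hh⟩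
        obtain ⟨e, he, g, hg⟩ := mem_sup_single.1 hh
        obtain ⟨q', hq'⟩ := invq (finAt_pow hfin D) hq
        have h1 : h = -((q * q' - 1) * h) + (q' * e + w * (q' * g)) := by linear_combination q' * hg
        rw [h1, map_add, map_add, hΦE _ (Ideal.mul_mem_left _ _ he), zero_add]
        refine add_mem (hXD _ ?_) ?_
        · exact (hmem D _).1 (neg_mem (Ideal.mul_mem_right _ _ hq'))
        · rw [hΦ]; exact ⟨_, rfl⟩
      · intro hh
        obtain ⟨g, hg⟩ := hker0 D h hh
        have h1 : locI (E ⊔ Ideal.span {u^D}) v ≤ locI (E ⊔ Ideal.span {w}) v := by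
          rw [locI_le_iff]
          refine sup_le (le_sup_left.trans (le_locI _ _)) ?_
          rw [Ideal.span_singleton_le_iff_mem]; exact huD
        have h2 : w * g ∈ locI (E ⊔ Ideal.span {w}) v :=
          le_locI _ _ (Ideal.mem_sup_right (Ideal.mem_span_singleton.2 ⟨g, rfl⟩))
        have := add_mem (h1 hg) h2
        simpa using this
    let Ψ : MvPolynomial σ ℂ →ₗ[ℂ] ((Fin m → PowerSeries ℂ) ⧸ Nn) :=
      (Nn.mkQ.restrictScalars ℂ).comp Φ
    have hΨs : Function.Surjective Ψ := by
      intro y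
      obtain ⟨φ, rfl⟩ := Nn.mkQ_surjective y
      obtain ⟨h, hh⟩ := hdens D φ
      refine ⟨h, ?_⟩
      change Nn.mkQ (Φ h) = Nn.mkQ φ
      symm
      rw [← sub_eq_zero, ← map_sub, Submodule.mkQ_apply, Submodule.Quotient.mk_eq_zero]
      exact hXD _ hh
    have hΨk : LinearMap.ker Ψ = (locI (E ⊔ Ideal.span {w}) v).restrictScalars ℂ := by
      ext h
      rw [LinearMap.mem_ker, Submodule.restrictScalars_mem, hker]
      change Nn.mkQ (Φ h) = 0 ↔ _
      rw [Submodule.mkQ_apply, Submodule.Quotient.mk_eq_zero]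
    have e1 := LinearMap.quotKerEquivOfSurjective Ψ hΨs
    rw [hΨk] at e1
    have e2 := (Submodule.Quotient.restrictScalarsEquiv ℂ _).symm.trans e1
    refine ⟨Module.Finite.equiv e2.symm, ?_⟩
    have : imu (E ⊔ Ideal.span {w}) v = D := by rw [imu, ← hcr]; exact e2.finrank_eq
    rw [this]; exact hD
  · intro hw hdet
    obtain ⟨k, q, hq, hk⟩ := hw.nilp u
    rw [huv, C_0, sub_zero] at hk
    obtain ⟨e, he, g, hg⟩ := mem_sup_single.1 hk
    have h1 := congrArg (fun x => (ρ x).det) hg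
    simp only [map_mul, map_add, hρE e he, zero_add, map_pow, hu, Matrix.det_mul, hdet, zero_mul] at h1
    obtain ⟨q', hq'⟩ := invq (finAt_pow hfin 1) hq
    have h2 : (ρ q).det ≠ 0 := by
      intro h0
      have h3 := hρL 1 _ hq'
      rw [map_sub, map_mul, map_one] at h3
      have h4 : (ρ q * ρ q').map (PowerSeries.constantCoeff (R := ℂ)) = 1 := by
        ext1 i j
        have := h3 i j
        rw [pow_one, PowerSeries.X_dvd_iff, Matrix.sub_apply, map_sub, sub_eq_zero] at this
        rw [Matrix.map_apply, this, Matrix.one_apply, Matrix.one_apply]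
        split_ifs <;> simp
      have h5 := congrArg Matrix.det h4
      rw [← RingHom.mapMatrix_apply, ← RingHom.map_det, Matrix.det_mul, h0, zero_mul, map_zero, Matrix.det_one] at h5
      exact zero_ne_one h5
    rcases mul_eq_zero.1 h1 with h | h
    · exact h2 h
    · rw [Matrix.det_pow, Matrix.scalar_apply, Matrix.det_diagonal] at h
      refine pow_ne_zero _ ?_ h
      exact Finset.prod_ne_zero_iff.2 fun _ _ => PowerSeries.X_ne_zero
end M2

section M3

lemma jk_ot_nonneg (k : ℕ) (hk : 0 < k) (p : PowerSeries ℂ) : 0 ≤ (jk k hk p).orderTop := by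
  by_cases h : jk k hk p = 0
  · rw [h]; simp
  · rw [← HahnSeries.order_eq_orderTop_of_ne_zero h]
    have h1 : (jk k hk p).coeff (jk k hk p).order ≠ 0 := fun h0 => h (HahnSeries.coeff_order_eq_zero.1 h0)
    obtain ⟨n, hn⟩ := jk_coeff_ne k hk p _ h1
    rw [hn]
    exact WithTop.coe_le_coe.2 (by positivity)

lemma ot_pos_add {x y : KK} (hx : 0 < x.orderTop) (hy : 0 < y.orderTop) : 0 < (x + y).orderTop :=
  lt_of_lt_of_le (lt_min hx hy) HahnSeries.min_orderTop_le_orderTop_add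

lemma ot_pos_sum {ι : Type*} (s : Finset ι) (f : ι → KK) (h : ∀ i ∈ s, 0 < (f i).orderTop) :
    0 < (∑ i ∈ s, f i).orderTop := by
  classical
  induction s using Finset.induction_on with
  | empty => simp
  | insert i s hi ih =>
    rw [Finset.sum_insert hi]
    exact ot_pos_add (h i (by simp)) (ih fun j hj => h j (by simp [hj]))

lemma ot_pos_mul_left {x y : KK} (hx : 0 ≤ x.orderTop) (hy : 0 < y.orderTop) : 0 < (x * y).orderTop := by
  rw [HahnSeries.orderTop_mul]
  exact lt_of_lt_of_le hy (le_add_of_nonneg_left hx)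

lemma ot_pos_pow {x : KK} (hx : 0 < x.orderTop) (k : ℕ) (hk : 0 < k) : 0 < (x^k).orderTop := by
  obtain ⟨k, rfl⟩ := Nat.exists_eq_succ_of_ne_zero hk.ne'
  induction k with
  | zero => simpa using hx
  | succ k ih =>
    rw [pow_succ]
    exact ot_pos_mul_left (ih (by omega)).le hx

lemma root_ot (p : Polynomial (PowerSeries ℂ)) (hp : p.Monic) (k : ℕ) (hk : 0 < k) (x : KK)
    (hx : Polynomial.eval₂ (jk k hk) x p = 0) : 0 ≤ x.orderTop := by
  by_contra hneg
  rw [not_le] at hneg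
  have hx0 : x ≠ 0 := by rintro rfl; simp at hneg
  have hy : 0 < (x⁻¹).orderTop := by
    have h1 : (x * x⁻¹).order = 0 := by rw [mul_inv_cancel₀ hx0, HahnSeries.order_one]
    rw [HahnSeries.order_mul hx0 (inv_ne_zero hx0)] at h1
    rw [← HahnSeries.order_eq_orderTop_of_ne_zero hx0] at hneg
    rw [← HahnSeries.order_eq_orderTop_of_ne_zero (inv_ne_zero hx0)]
    have h2 : x.order < 0 := by exact_mod_cast hneg
    have h3 : 0 < x⁻¹.order := by linarith
    exact_mod_cast h3
  rw [Polynomial.eval₂_eq_sum_range, Finset.sum_range_succ, hp.coeff_natDegree, map_one, one_mul] at hx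
  set n := p.natDegree
  have h2 : (∑ i ∈ Finset.range n, jk k hk (p.coeff i) * (x⁻¹)^(n - i)) = -1 := by
    have h3 := congrArg (fun z => z * (x⁻¹)^n) hx
    simp only [add_mul, zero_mul, ← mul_pow, mul_inv_cancel₀ hx0, one_pow] at h3
    rw [Finset.sum_mul] at h3
    rw [← eq_neg_iff_add_eq_zero] at h3
    rw [← h3]
    refine Finset.sum_congr rfl fun i hi => ?_
    have hin : i < n := Finset.mem_range.1 hi
    obtain ⟨r, hr⟩ := Nat.exists_eq_add_of_le hin.le
    have h5 : x^i * (x⁻¹)^n = (x⁻¹)^(n-i) := by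
      rw [hr, Nat.add_sub_cancel_left, pow_add, ← mul_assoc, ← mul_pow, mul_inv_cancel₀ hx0, one_pow, one_mul]
    rw [mul_assoc, h5]
  have h4 := ot_pos_sum (Finset.range n) (fun i => jk k hk (p.coeff i) * (x⁻¹)^(n - i)) (by
    intro i hi
    have hin : i < n := Finset.mem_range.1 hi
    exact ot_pos_mul_left (jk_ot_nonneg k hk _) (ot_pos_pow hy _ (by omega)))
  rw [h2, HahnSeries.orderTop_neg, HahnSeries.orderTop_one] at h4
  exact lt_irrefl _ h4

lemma order_prod {ι : Type*} (s : Finset ι) (f : ι → KK) (h : ∀ i ∈ s, f i ≠ 0) :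
    (∏ i ∈ s, f i).order = ∑ i ∈ s, (f i).order := by
  classical
  induction s using Finset.induction_on with
  | empty => simp
  | insert i s hi ih =>
    rw [Finset.prod_insert hi, Finset.sum_insert hi, HahnSeries.order_mul (h i (by simp))
      (Finset.prod_ne_zero_iff.2 fun j hj => h j (by simp [hj])), ih fun j hj => h j (by simp [hj])]

lemma jk_order_assoc {x : PowerSeries ℂ} {D : ℕ} (h : Associated x (PowerSeries.X^D)) :
    (jk 1 one_pos x).order = D := by
  obtain ⟨y, hy⟩ := h.symm
  rw [← hy]
  have hu : ∀ y : (PowerSeries ℂ)ˣ, jk 1 one_pos (y : PowerSeries ℂ) ≠ 0 := fun y =>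
    (y.isUnit.map (jk 1 one_pos)).ne_zero
  have hX : jk 1 one_pos PowerSeries.X = HahnSeries.single (1:ℚ) (1:ℂ) := by rw [jk_X]; simp
  have hge : ∀ y : (PowerSeries ℂ)ˣ, 0 ≤ (jk 1 one_pos (y : PowerSeries ℂ)).order := by
    intro y
    have := jk_ot_nonneg 1 one_pos y
    rw [← HahnSeries.order_eq_orderTop_of_ne_zero (hu y)] at this
    exact_mod_cast this
  have h0 : (jk 1 one_pos (y : PowerSeries ℂ)).order = 0 := by
    have h1 : (jk 1 one_pos (y : PowerSeries ℂ) * jk 1 one_pos ((y⁻¹ : (PowerSeries ℂ)ˣ) : PowerSeries ℂ)).order = 0 := by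
      rw [← map_mul, Units.mul_inv, map_one, HahnSeries.order_one]
    rw [HahnSeries.order_mul (hu y) (hu _)] at h1
    linarith [hge y, hge y⁻¹]
  rw [map_mul, map_pow, hX, HahnSeries.order_mul (pow_ne_zero _ (HahnSeries.single_ne_zero one_ne_zero)) (hu y),
    HahnSeries.order_pow, HahnSeries.order_single one_ne_zero, h0]
  simp

lemma det_scale {K : Type*} [Field K] {m : ℕ} (t z : K) (ht : t ≠ 0) (B M : Matrix (Fin m) (Fin m) K)
    (hM : M = t • B) (h : (Matrix.scalar (Fin m) z - M).det = 0) :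
    B.charpoly.eval (z / t) = 0 := by
  rw [Matrix.eval_charpoly]
  have : Matrix.scalar (Fin m) z - M = t • (Matrix.scalar (Fin m) (z / t) - B) := by
    rw [hM, smul_sub]
    congr 1
    ext1 i j
    simp only [Matrix.scalar_apply, Matrix.smul_apply, Matrix.diagonal_apply]
    split_ifs
    · simp; field_simp
    · simp
  rw [this, Matrix.det_smul] at h
  exact (mul_eq_zero.1 h).resolve_left (pow_ne_zero _ ht)

variable {σ : Type*} [Fintype σ] [DecidableEq σ]

theorem Mstar (θ : σ → MvPolynomial σ ℂ) (v : σ → ℂ) (i0 : σ)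
    (hfin : FinAt (Ideal.span (Set.range θ)) v) (huv : eval v (θ i0) = 0) :
    ∃ (m : ℕ) (a : Fin m → σ → KK), (∀ φ i, 0 < (a φ i - HahnSeries.C (v i)).orderTop) ∧
      (∀ φ i, i ≠ i0 → aeval (a φ) (θ i) = 0) ∧
      (∀ φ, aeval (a φ) (θ i0) = HahnSeries.single (1:ℚ) (1:ℂ)) ∧
      ∀ w, (FinAt (Ideal.span (θ '' {i0}ᶜ) ⊔ Ideal.span {w}) v ↔ ∀ φ, aeval (a φ) w ≠ 0) ∧
        ((∀ φ, aeval (a φ) w ≠ 0) →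
          (imu (Ideal.span (θ '' {i0}ᶜ) ⊔ Ideal.span {w}) v : ℚ) = ∑ φ, (aeval (a φ) w).order) := by
  set E := Ideal.span (θ '' {i0}ᶜ) with hE
  rw [range_eq_sup θ i0] at hfin
  obtain ⟨m, ρ, Φ, h1, h2, h3, h4, h5⟩ := M1 θ v i0 E hE hfin
  have hM2 := M2 E (θ i0) v hfin huv m ρ Φ h1 h2 h3 h4 h5
  let f : ℂ →+* KK := HahnSeries.C
  let ρ0 : MvPolynomial σ ℂ →+* Matrix (Fin m) (Fin m) KK := (jk 1 one_pos).mapMatrix.comp ρ.toRingHom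
  have hρ0 : ∀ W, ρ0 W = (ρ W).map (jk 1 one_pos) := fun W => rfl
  have hX : jk 1 one_pos PowerSeries.X = HahnSeries.single (1:ℚ) (1:ℂ) := by rw [jk_X]; simp
  have hscal : ∀ x, (Matrix.scalar (Fin m) x).map (jk 1 one_pos) = Matrix.scalar (Fin m) (jk 1 one_pos x) := by
    intro x
    ext1 i j
    simp only [Matrix.scalar_apply, Matrix.map_apply, Matrix.diagonal_apply]
    split_ifs <;> simp
  obtain ⟨a, ha1, ha2, ha3⟩ := joint_mat f ρ0 (by
    intro c
    have : ρ (C c) = Matrix.scalar (Fin m) (PowerSeries.C c) := by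
      rw [← MvPolynomial.algebraMap_eq, AlgHom.commutes, Matrix.algebraMap_eq_diagonal]
      rfl
    rw [hρ0, this, hscal, jk_C]) (by
    intro i
    rw [hρ0, Matrix.charpoly_map]
    exact puiseux _ 1 one_pos _ (Matrix.charpoly_monic _) rfl)
  have hae : ∀ φ W, aeval (a φ) W = eval₂ f (a φ) W := fun φ W => by
    rw [aeval_def]; rfl
  have hdet : ∀ W, jk 1 one_pos (ρ W).det = ∏ φ, aeval (a φ) W := by
    intro W
    rw [RingHom.map_det, RingHom.mapMatrix_apply, ← hρ0, ha1]
    exact Finset.prod_congr rfl fun φ _ => (hae φ W).symm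
  have hdet0 : ∀ W, (ρ W).det ≠ 0 ↔ ∀ φ, aeval (a φ) W ≠ 0 := by
    intro W
    rw [← (map_ne_zero_iff _ (jk_inj 1 one_pos)), hdet, Finset.prod_ne_zero_iff]
    simp
  refine ⟨m, a, ?_, ?_, ?_, ?_⟩
  · intro φ i
    obtain ⟨k, hk⟩ := hfin.nilp (X i)
    rw [eval_X] at hk
    have hk1 : (X i - C (v i))^k ∈ locI (E ⊔ Ideal.span {θ i0 ^ 1}) v := by rwa [pow_one]
    have hB := h5 1 _ hk1
    simp only [pow_one] at hB
    choose B hB using hB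
    have hmat : ρ0 ((X i - C (v i))^k) = (HahnSeries.single (1:ℚ) (1:ℂ) : KK) • (Matrix.of B).map (jk 1 one_pos) := by
      rw [hρ0]
      ext1 p q
      rw [Matrix.map_apply, hB, map_mul, hX]; rfl
    have h6 := det_scale _ _ (HahnSeries.single_ne_zero one_ne_zero) _ _ hmat (ha3 φ ((X i - C (v i))^k))
    rw [Matrix.charpoly_map, Polynomial.eval_map] at h6
    have h7 := root_ot _ (Matrix.charpoly_monic _) 1 one_pos _ h6
    rw [← hae] at h7
    have h8 : aeval (a φ) ((X i - C (v i))^k) = (a φ i - HahnSeries.C (v i))^k := by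
      rw [map_pow, map_sub, aeval_X, aeval_C]; rfl
    rw [h8] at h7
    set y := a φ i - HahnSeries.C (v i)
    have h9 : 0 < (y^k).orderTop := by
      have : y^k = (y^k / HahnSeries.single (1:ℚ) (1:ℂ)) * HahnSeries.single (1:ℚ) (1:ℂ) :=
        (div_mul_cancel₀ _ (HahnSeries.single_ne_zero one_ne_zero)).symm
      rw [this]
      refine ot_pos_mul_left h7 ?_
      rw [HahnSeries.orderTop_single one_ne_zero]
      exact_mod_cast one_pos
    by_cases hy : y = 0
    · rw [hy]; simp
    · rw [← HahnSeries.order_eq_orderTop_of_ne_zero hy]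
      rw [← HahnSeries.order_eq_orderTop_of_ne_zero (pow_ne_zero _ hy), HahnSeries.order_pow] at h9
      have h10 : 0 < k • y.order := by exact_mod_cast h9
      have : 0 < y.order := by
        by_contra hle
        rw [not_lt] at hle
        exact absurd (nsmul_nonpos hle k) (not_le.2 h10)
      exact_mod_cast this
  · intro φ i hi
    rw [hae]
    refine ha2 _ _ ?_ φ
    have : ρ (θ i) = 0 := (hM2 0).1 _ (Ideal.subset_span ⟨i, hi, rfl⟩)
    rw [hρ0, this, map_zero]
    ext1 p q
    simp
  · intro φ
    rw [hae]
    refine ha2 _ _ ?_ φ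
    rw [hρ0, h2, hscal, hX]
  · intro w
    obtain ⟨-, hw1, hw2⟩ := hM2 w
    rw [hdet0] at hw1
    refine ⟨⟨fun h => (hdet0 w).1 (hw2 h), fun h => (hw1 h).1⟩, fun h => ?_⟩
    have := jk_order_assoc (hw1 h).2
    rw [hdet, order_prod _ _ fun φ _ => h φ] at this
    exact this.symm
end M3

section FA1
variable {σ : Type*} [Fintype σ] {ι : Type*} [Fintype ι]

lemma hc_mul {G h : MvPolynomial σ ℂ} {δ m : ℕ} (hG : G.IsHomogeneous δ) :
    homogeneousComponent (m + δ) (G * h) = G * homogeneousComponent m h := by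
  conv_lhs => rw [← sum_homogeneousComponent h, Finset.mul_sum, map_sum]
  have : ∀ i, homogeneousComponent (m + δ) (G * homogeneousComponent i h)
      = if i = m then G * homogeneousComponent i h else 0 := by
    intro i
    rw [homogeneousComponent_of_mem (n := δ + i) (hG.mul (homogeneousComponent_isHomogeneous i h))]
    congr 1
    simp only [eq_iff_iff]; omega
  simp only [this, Finset.sum_ite_eq', Finset.mem_range]
  split_ifs with hh
  · rfl
  · rw [homogeneousComponent_eq_zero _ _ (by omega), mul_zero]

lemma td_le_of_hc {h : MvPolynomial σ ℂ} {K : ℕ} (h1 : h.totalDegree ≤ K + 1)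
    (h2 : homogeneousComponent (K + 1) h = 0) : h.totalDegree ≤ K := by
  rw [← sum_homogeneousComponent h]
  refine (totalDegree_finsetSum_le (d := K) ?_)
  intro i hi
  rw [Finset.mem_range] at hi
  rcases Nat.lt_or_ge i (K+1) with h3 | h3
  · exact (homogeneousComponent_isHomogeneous i h).totalDegree_le.trans (by omega)
  · have : i = K + 1 := by omega
    rw [this, h2]; simp

lemma lead_step (f : ι → MvPolynomial σ ℂ) (δ : ι → ℕ) (hδ : ∀ j, (f j).totalDegree ≤ δ j)
    (hlead : ∀ x : σ → ℂ, (∀ j, eval x (homogeneousComponent (δ j) (f j)) = 0) → x = 0) :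
    ∃ q1, (∀ j, δ j ≤ q1) ∧ ∀ K, q1 ≤ K → ∀ h : MvPolynomial σ ℂ, h.totalDegree ≤ K →
      ∃ c : ι → MvPolynomial σ ℂ, (∀ j, (c j).totalDegree + δ j ≤ K) ∧
        (h - ∑ j, f j * c j).totalDegree ≤ q1 := by
  set G : ι → MvPolynomial σ ℂ := fun j => homogeneousComponent (δ j) (f j) with hG
  have hrad : idealOfVars σ ℂ ≤ (Ideal.span (Set.range G)).radical := by
    rw [idealOfVars, Ideal.span_le]
    rintro _ ⟨i, rfl⟩
    obtain ⟨k, hk⟩ := NSS (J := Ideal.span (Set.range G)) (p := X i) (by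
      intro v hv
      have := hlead v (fun j => hv _ (Ideal.subset_span ⟨j, rfl⟩))
      simp [this])
    exact ⟨k, hk⟩
  obtain ⟨q0, hq0⟩ := Ideal.exists_pow_le_of_le_radical_of_fg hrad (idealOfVars_fg σ ℂ)
  obtain ⟨Δ, hΔ⟩ : ∃ Δ, ∀ j, δ j ≤ Δ := ⟨∑ j, δ j, fun j => Finset.single_le_sum (f := δ) (fun _ _ => Nat.zero_le _) (Finset.mem_univ j)⟩
  refine ⟨max q0 Δ, fun j => (hΔ j).trans (le_max_right _ _), ?_⟩
  intro K hK
  induction K, hK using Nat.le_induction with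
  | base =>
    intro h hh
    exact ⟨0, fun j => by simpa using Or.inr (hΔ j), by simpa using hh⟩
  | succ K hK ih =>
    intro h hh
    have hmem : homogeneousComponent (K+1) h ∈ Ideal.span (Set.range G) := by
      apply hq0
      rw [mem_pow_idealOfVars_iff']
      intro x hx
      rw [coeff_homogeneousComponent, if_neg]
      have := le_max_left q0 Δ
      omega
    obtain ⟨c, hc⟩ := (Ideal.mem_span_range_iff_exists_fun).1 hmem
    set c' : ι → MvPolynomial σ ℂ := fun j => homogeneousComponent (K+1-δ j) (c j) with hc'
    have hle : ∀ j, δ j ≤ K + 1 := fun j => by have h1 := hΔ j; have h2 := le_max_right q0 Δ; omega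
    have key : homogeneousComponent (K+1) h = ∑ j, G j * c' j := by
      have := congrArg (homogeneousComponent (K+1)) hc
      rw [homogeneousComponent_eq_self (homogeneousComponent_isHomogeneous _ _)] at this
      rw [← this, map_sum]
      refine Finset.sum_congr rfl fun j _ => ?_
      have h3 : K + 1 = (K + 1 - δ j) + δ j := by have := hle j; omega
      rw [mul_comm]
      conv_lhs => rw [h3]
      exact hc_mul (homogeneousComponent_isHomogeneous _ _)
    have hcd : ∀ j, (c' j).totalDegree + δ j ≤ K + 1 := fun j => by
      have := (homogeneousComponent_isHomogeneous (K+1-δ j) (c j)).totalDegree_le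
      have := hle j
      simp only [hc']; omega
    have hdeg1 : (h - ∑ j, f j * c' j).totalDegree ≤ K + 1 := by
      refine (totalDegree_sub _ _).trans (max_le hh (totalDegree_finsetSum_le fun j _ => ?_))
      refine (totalDegree_mul _ _).trans ?_
      have := hcd j; have := hδ j; omega
    have hdeg : (h - ∑ j, f j * c' j).totalDegree ≤ K := by
      apply td_le_of_hc hdeg1
      rw [map_sub, key, map_sum, sub_eq_zero]
      refine Finset.sum_congr rfl fun j _ => ?_
      have h3 : K + 1 = δ j + (K + 1 - δ j) := by have := hle j; omega
      have hf : f j * c' j = G j * c' j + (f j - G j) * c' j := by ring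
      rw [hf, map_add, homogeneousComponent_of_mem (n := K+1) , if_pos rfl]
      · rw [left_eq_add]
        by_cases h0 : c' j = 0
        · simp [h0]
        by_cases h0' : f j - G j = 0
        · simp [h0']
        apply homogeneousComponent_eq_zero
        refine (totalDegree_mul _ _).trans_lt ?_
        have h5 : (f j - G j).totalDegree < δ j := by
          rcases Nat.eq_zero_or_pos (δ j) with h6 | h6
          · exfalso; apply h0'
            have := hδ j
            rw [h6, Nat.le_zero] at this
            rw [hG]; simp only [h6, homogeneousComponent_zero]
            rw [sub_eq_zero]; exact totalDegree_eq_zero_iff_eq_C.1 this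
          · have h7 : δ j = (δ j - 1) + 1 := by omega
            have : (f j - G j).totalDegree ≤ δ j - 1 := by
              apply td_le_of_hc
              · refine (totalDegree_sub _ _).trans (max_le ((hδ j).trans h7.le) ?_)
                exact (homogeneousComponent_isHomogeneous _ _).totalDegree_le.trans h7.le
              · rw [← h7, map_sub, homogeneousComponent_eq_self (p := G j) (homogeneousComponent_isHomogeneous _ _), sub_self]
            omega
        have := hcd j; omega
      · rw [h3]
        exact (homogeneousComponent_isHomogeneous _ _).mul (homogeneousComponent_isHomogeneous _ _)
    obtain ⟨c2, hc2, hc3⟩ := ih _ hdeg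
    refine ⟨c' + c2, fun j => ?_, ?_⟩
    · have h1 := totalDegree_add (c' j) (c2 j)
      have := hcd j; have := hc2 j
      rw [Pi.add_apply]
      rcases le_max_iff.1 h1 with h | h <;> omega
    · have : h - ∑ j, f j * (c' + c2) j = h - ∑ j, f j * c' j - ∑ j, f j * c2 j := by
        rw [sub_sub, ← Finset.sum_add_distrib]
        simp [mul_add]
      rw [this]; exact hc3

end FA1

section FA2
variable {σ : Type*} [Fintype σ] {ι : Type*} [Fintype ι]

lemma lead_fin (f : ι → MvPolynomial σ ℂ) (δ : ι → ℕ) (hδ : ∀ j, (f j).totalDegree ≤ δ j)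
    (hlead : ∀ x : σ → ℂ, (∀ j, eval x (homogeneousComponent (δ j) (f j)) = 0) → x = 0) :
    Module.Finite ℂ (MvPolynomial σ ℂ ⧸ Ideal.span (Set.range f)) ∧
    ∃ (K D : ℕ) (b : Fin D → MvPolynomial σ ℂ),
      D = Module.finrank ℂ (MvPolynomial σ ℂ ⧸ Ideal.span (Set.range f)) ∧
      (∀ lam : Fin D → ℂ, ∑ m, C (lam m) * b m ∈ Ideal.span (Set.range f) → lam = 0) ∧
      (∀ i m, (X i * b m).totalDegree ≤ K) ∧
      ∀ h : MvPolynomial σ ℂ, h.totalDegree ≤ K → ∃ (lam : Fin D → ℂ) (c : ι → MvPolynomial σ ℂ),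
        (∀ j, (c j).totalDegree + δ j ≤ K) ∧ h = ∑ m, C (lam m) * b m + ∑ j, f j * c j := by
  obtain ⟨q1, hq1, hst⟩ := lead_step f δ hδ hlead
  set J := Ideal.span (Set.range f) with hJ
  have hfin : Module.Finite ℂ (MvPolynomial σ ℂ ⧸ J) := by
    have : Function.Surjective ((Ideal.Quotient.mkₐ ℂ J).toLinearMap.comp (restrictTotalDegree σ ℂ q1).subtype) := by
      intro y
      obtain ⟨h, rfl⟩ := Ideal.Quotient.mk_surjective y
      obtain ⟨c, hc, hc2⟩ := hst (max q1 h.totalDegree) (le_max_left _ _) h (le_max_right _ _)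
      refine ⟨⟨_, (mem_restrictTotalDegree _ _ _).2 hc2⟩, ?_⟩
      simp only [LinearMap.comp_apply, Submodule.subtype_apply, AlgHom.toLinearMap_apply]
      rw [Ideal.Quotient.mkₐ_eq_mk, Ideal.Quotient.eq]
      have : h - ∑ j, f j * c j - h = - ∑ j, f j * c j := by ring
      rw [this]
      exact neg_mem (sum_mem fun j _ => Ideal.mul_mem_right _ _ (Ideal.subset_span ⟨j, rfl⟩))
    exact Module.Finite.of_surjective _ this
  refine ⟨hfin, ?_⟩
  let B := Module.finBasis ℂ (MvPolynomial σ ℂ ⧸ J)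
  choose b hb using fun m => Ideal.Quotient.mk_surjective (B m)
  have hmk : ∀ lam : Fin (Module.finrank ℂ (MvPolynomial σ ℂ ⧸ J)) → ℂ,
      Ideal.Quotient.mk J (∑ m, C (lam m) * b m) = ∑ m, lam m • B m := by
    intro lam
    rw [map_sum]
    refine Finset.sum_congr rfl fun m _ => ?_
    rw [← MvPolynomial.smul_eq_C_mul, ← hb]; rfl
  obtain ⟨S, hS⟩ := (Module.Finite.iff_fg.1 (inferInstance : Module.Finite ℂ (restrictTotalDegree σ ℂ q1)))
  have hex : ∀ h : MvPolynomial σ ℂ, ∃ (lam : Fin (Module.finrank ℂ (MvPolynomial σ ℂ ⧸ J)) → ℂ) (c : ι → MvPolynomial σ ℂ),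
      h = ∑ m, C (lam m) * b m + ∑ j, f j * c j := by
    intro h
    have h1 : h - ∑ m, C (B.repr (Ideal.Quotient.mk J h) m) * b m ∈ J := by
      rw [← Ideal.Quotient.eq, hmk, B.sum_repr]
    obtain ⟨c, hc⟩ := (Ideal.mem_span_range_iff_exists_fun).1 h1
    refine ⟨fun m => B.repr (Ideal.Quotient.mk J h) m, c, ?_⟩
    rw [← sub_eq_iff_eq_add', ← hc]
    exact Finset.sum_congr rfl fun j _ => mul_comm _ _
  choose lam c hlc using hex
  set K : ℕ := q1 + (∑ h ∈ S, ∑ j, ((c h j).totalDegree + δ j)) + ∑ i, ∑ m, (X i * b m).totalDegree with hK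
  have hKS : ∀ h ∈ S, ∀ j, (c h j).totalDegree + δ j ≤ K := by
    intro h hh j
    have h1 := Finset.single_le_sum (f := fun h => ∑ j, ((c h j).totalDegree + δ j)) (fun _ _ => Nat.zero_le _) hh
    have h2 := Finset.single_le_sum (f := fun j => ((c h j).totalDegree + δ j)) (fun _ _ => Nat.zero_le _) (Finset.mem_univ j)
    omega
  refine ⟨K, _, b, rfl, ?_, ?_, ?_⟩
  · intro l hl
    rw [← Ideal.Quotient.eq_zero_iff_mem, hmk] at hl
    exact funext fun m => Fintype.linearIndependent_iff.1 B.linearIndependent l hl m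
  · intro i m
    have h1 := Finset.single_le_sum (f := fun i => ∑ m, (X i * b m).totalDegree) (fun _ _ => Nat.zero_le _) (Finset.mem_univ i)
    have h2 := Finset.single_le_sum (f := fun m => (X i * b m).totalDegree) (fun _ _ => Nat.zero_le _) (Finset.mem_univ m)
    omega
  · intro h hh
    obtain ⟨c1, hc1, hc2⟩ := hst K (by omega) h hh
    have h2 : ∀ p ∈ restrictTotalDegree σ ℂ q1, ∃ (lam : Fin (Module.finrank ℂ (MvPolynomial σ ℂ ⧸ J)) → ℂ) (c : ι → MvPolynomial σ ℂ),
        (∀ j, (c j).totalDegree + δ j ≤ K) ∧ p = ∑ m, C (lam m) * b m + ∑ j, f j * c j := by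
      intro p hp
      rw [← hS] at hp
      induction hp using Submodule.span_induction with
      | mem p hp => exact ⟨lam p, c p, hKS p hp, hlc p⟩
      | zero => exact ⟨0, 0, fun j => by simpa using (hq1 j).trans (by omega), by simp⟩
      | add p p' _ _ h1 h2 =>
        obtain ⟨l1, c1, h1, h1'⟩ := h1
        obtain ⟨l2, c2, h2, h2'⟩ := h2
        refine ⟨l1 + l2, c1 + c2, fun j => ?_, ?_⟩
        · have h3 := totalDegree_add (c1 j) (c2 j)
          have := h1 j; have := h2 j
          rw [Pi.add_apply]
          rcases le_max_iff.1 h3 with h | h <;> omega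
        · rw [h1', h2']
          simp only [Pi.add_apply, map_add, add_mul, mul_add, Finset.sum_add_distrib]
          ring
      | smul a p _ h1 =>
        obtain ⟨l1, c1, h1, h1'⟩ := h1
        refine ⟨a • l1, a • c1, fun j => ?_, ?_⟩
        · have h3 := totalDegree_smul_le a (c1 j)
          have := h1 j
          rw [Pi.smul_apply]
          omega
        · rw [h1']
          simp only [Pi.smul_apply, smul_add, Finset.smul_sum, smul_eq_mul, C_mul, MvPolynomial.smul_eq_C_mul]
          congr 1
          · exact Finset.sum_congr rfl fun j _ => by ring
          · exact Finset.sum_congr rfl fun j _ => by ring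
    obtain ⟨l2, c2, h3, h4⟩ := h2 _ ((mem_restrictTotalDegree _ _ _).2 hc2)
    refine ⟨l2, c1 + c2, fun j => ?_, ?_⟩
    · have h3' := totalDegree_add (c1 j) (c2 j)
      have := hc1 j; have := h3 j
      rw [Pi.add_apply]
      rcases le_max_iff.1 h3' with h | h <;> omega
    · rw [sub_eq_iff_eq_add] at h4
      rw [h4]
      simp only [Pi.add_apply, mul_add, Finset.sum_add_distrib]
      ring

end FA2

/-- specialization of the parameter -/
def spec {σ : Type*} (c : ℂ) : MvPolynomial σ (Polynomial ℂ) →+* MvPolynomial σ ℂ :=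
  MvPolynomial.map (Polynomial.evalRingHom c)

/-- constant families -/
def incP {σ : Type*} : MvPolynomial σ ℂ →+* MvPolynomial σ (Polynomial ℂ) :=
  MvPolynomial.map Polynomial.C

section FA3
variable {σ : Type*} [Fintype σ] {ι : Type*} [Fintype ι]

lemma td_mono {R S : Type*} [CommSemiring R] [CommSemiring S] {p : MvPolynomial σ R} {q : MvPolynomial σ S}
    (h : p.support ⊆ q.support) : p.totalDegree ≤ q.totalDegree := Finset.sup_mono h

lemma spec_incP (c : ℂ) (p : MvPolynomial σ ℂ) : spec c (incP p) = p := by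
  rw [spec, incP, MvPolynomial.map_map]
  have : (Polynomial.evalRingHom c).comp Polynomial.C = RingHom.id ℂ := by ext; simp
  rw [this, MvPolynomial.map_id]

lemma spec_C (c : ℂ) (r : Polynomial ℂ) : spec c (C r : MvPolynomial σ (Polynomial ℂ)) = C (r.eval c) := by
  simp [spec]

lemma spec_decomp (p : MvPolynomial σ (Polynomial ℂ)) :
    ∃ p' : MvPolynomial σ (Polynomial ℂ), p'.totalDegree ≤ p.totalDegree ∧
      p = incP (spec 0 p) + C Polynomial.X * p' := by
  let p' : MvPolynomial σ (Polynomial ℂ) := ∑ m ∈ p.support, monomial m (Polynomial.divX (coeff m p))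
  have hc : ∀ m, coeff m p' = Polynomial.divX (coeff m p) := by
    classical
    intro m
    simp only [p', coeff_sum, coeff_monomial, Finset.sum_ite_eq']
    split_ifs with h
    · rfl
    · rw [notMem_support_iff.1 h, Polynomial.divX_zero]
  refine ⟨p', ?_, ?_⟩
  · apply td_mono
    intro m hm
    rw [mem_support_iff, hc] at hm
    rw [mem_support_iff]
    intro h; apply hm; rw [h, Polynomial.divX_zero]
  · ext1 m
    rw [coeff_add, coeff_C_mul, hc, incP, spec, coeff_map, coeff_map]
    conv_lhs => rw [← Polynomial.X_mul_divX_add (coeff m p)]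
    rw [add_comm, Polynomial.coe_evalRingHom, Polynomial.coeff_zero_eq_eval_zero]

lemma spec_decomp_zero {p : MvPolynomial σ (Polynomial ℂ)} (h : spec 0 p = 0) :
    ∃ p', p = C Polynomial.X * p' := by
  obtain ⟨p', _, hp⟩ := spec_decomp p
  exact ⟨p', by rw [hp, h, map_zero, zero_add] ⟩

lemma FAM_core (g : ι → MvPolynomial σ (Polynomial ℂ)) (δ : ι → ℕ) (hδ : ∀ j, (g j).totalDegree ≤ δ j)
    (hlead : ∀ x : σ → ℂ, (∀ j, eval x (homogeneousComponent (δ j) (spec 0 (g j))) = 0) → x = 0) :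
    Module.Finite ℂ (MvPolynomial σ ℂ ⧸ Ideal.span (Set.range fun j => spec 0 (g j))) ∧
    ∃ (D : ℕ) (b : Fin D → MvPolynomial σ ℂ) (r : Polynomial ℂ), r.eval 0 ≠ 0 ∧
      D = Module.finrank ℂ (MvPolynomial σ ℂ ⧸ Ideal.span (Set.range fun j => spec 0 (g j))) ∧
      (∀ lam : Fin D → ℂ, ∑ m, C (lam m) * b m ∈ Ideal.span (Set.range fun j => spec 0 (g j)) → lam = 0) ∧
      ∀ h : MvPolynomial σ (Polynomial ℂ), ∃ (k : ℕ) (q : Fin D → Polynomial ℂ),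
        C r ^ k * h - ∑ m, C (q m) * incP (b m) ∈ Ideal.span (Set.range g) := by
  obtain ⟨hfin, K, D, b, hD, hind, hX, hK⟩ := lead_fin (fun j => spec 0 (g j)) δ
    (fun j => (td_mono (support_map_subset _ _)).trans (hδ j)) hlead
  refine ⟨hfin, D, b, ?_⟩
  set J := Ideal.span (Set.range g) with hJ
  let N := restrictTotalDegree σ (Polynomial ℂ) K
  let SB : Submodule (Polynomial ℂ) (MvPolynomial σ (Polynomial ℂ)) := Submodule.span _ (Set.range fun m => incP (b m))
  let U : Submodule (Polynomial ℂ) (MvPolynomial σ (Polynomial ℂ)) := J.restrictScalars _ ⊔ SB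
  have hNg : N ≤ U ⊔ (Ideal.span {Polynomial.X} : Ideal (Polynomial ℂ)) • N := by
    intro h hh
    rw [mem_restrictTotalDegree] at hh
    obtain ⟨h', hh', hdec⟩ := spec_decomp h
    obtain ⟨lam, c, hc, hlc⟩ := hK (spec 0 h) ((td_mono (support_map_subset _ _)).trans hh)
    choose g' hg' hgd using fun j => spec_decomp (g j)
    have : h = (∑ j, g j * incP (c j) + ∑ m, Polynomial.C (lam m) • incP (b m))
        + (Polynomial.X : Polynomial ℂ) • (h' - ∑ j, g' j * incP (c j)) := by
      have e1 : ∀ j, incP (spec 0 (g j)) = g j - C Polynomial.X * g' j := fun j => by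
        rw [eq_sub_iff_add_eq]; exact (hgd j).symm
      have e2 : ∀ a : ℂ, incP (C a : MvPolynomial σ ℂ) = C (Polynomial.C a) := fun a => by simp [incP]
      conv_lhs => rw [hdec, hlc]
      simp only [map_add, map_sum, map_mul, e1, e2, MvPolynomial.smul_eq_C_mul, sub_mul, Finset.sum_sub_distrib, mul_sub, Finset.mul_sum, mul_assoc]
      ring
    rw [this]
    refine add_mem (Submodule.mem_sup_left (add_mem (Submodule.mem_sup_left ?_) (Submodule.mem_sup_right ?_))) (Submodule.mem_sup_right ?_)
    · exact sum_mem fun j _ => Ideal.mul_mem_right _ J (Ideal.subset_span ⟨j, rfl⟩)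
    · exact sum_mem fun m _ => Submodule.smul_mem _ _ (Submodule.subset_span ⟨m, rfl⟩)
    · refine Submodule.smul_mem_smul (Ideal.mem_span_singleton_self _) ?_
      rw [mem_restrictTotalDegree]
      refine (totalDegree_sub _ _).trans (max_le (hh'.trans hh) (totalDegree_finsetSum_le fun j _ => ?_))
      refine (totalDegree_mul _ _).trans ?_
      have h1 : (incP (c j)).totalDegree ≤ (c j).totalDegree := td_mono (support_map_subset _ _)
      have := hc j; have := hg' j; have := hδ j
      omega
  obtain ⟨r, hr, hrN⟩ := Submodule.exists_sub_one_mem_and_smul_le_of_fg_of_le_sup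
    (N' := N) (P := N) (N := U) (Module.Finite.iff_fg.1 inferInstance) le_rfl hNg
  have hrN' : ∀ h ∈ N, C r * h ∈ U := fun h hh => by
    rw [← MvPolynomial.smul_eq_C_mul]
    exact hrN (Submodule.smul_mem_pointwise_smul _ _ _ hh)
  refine ⟨r, ?_, hD, hind, ?_⟩
  · obtain ⟨a, ha⟩ := Ideal.mem_span_singleton.1 hr
    have := congrArg (Polynomial.eval 0) ha
    simp only [Polynomial.eval_sub, Polynomial.eval_one, Polynomial.eval_mul, Polynomial.eval_X, zero_mul, sub_eq_zero] at this
    rw [this]; exact one_ne_zero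
  · have hUX : ∀ h ∈ U, ∀ i, C r * (h * X i) ∈ U := by
      intro h hh i
      obtain ⟨x, hx, y, hy, rfl⟩ := Submodule.mem_sup.1 hh
      rw [add_mul, mul_add]
      refine add_mem (Submodule.mem_sup_left ?_) ?_
      · exact Ideal.mul_mem_left J _ (Ideal.mul_mem_right _ J hx)
      · clear hh
        induction hy using Submodule.span_induction with
        | mem p hp =>
          obtain ⟨m, rfl⟩ := hp
          apply hrN'
          rw [mem_restrictTotalDegree]
          have : incP (b m) * X i = incP (X i * b m) := by simp [incP, mul_comm]
          simp only [this]
          exact (td_mono (support_map_subset _ _)).trans (hX i m)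
        | zero => simp
        | add p p' hp hp' h1 h2 =>
          rw [add_mul, mul_add]
          exact add_mem h1 h2
        | smul a p hp h1 =>
          rw [smul_mul_assoc, mul_smul_comm]
          exact Submodule.smul_mem _ _ h1
    have hmono : ∀ (h : MvPolynomial σ (Polynomial ℂ)) (k l : ℕ), k ≤ l → C r ^ k * h ∈ U → C r ^ l * h ∈ U := by
      intro h k l hkl hh
      obtain ⟨e, rfl⟩ := Nat.exists_eq_add_of_le' hkl
      rw [pow_add, mul_assoc, ← C_pow, ← MvPolynomial.smul_eq_C_mul]
      exact Submodule.smul_mem _ _ hh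
    have main : ∀ h : MvPolynomial σ (Polynomial ℂ), ∃ k, C r ^ k * h ∈ U := by
      intro h
      induction h using MvPolynomial.induction_on with
      | C a =>
        refine ⟨1, ?_⟩
        rw [pow_one, mul_comm, ← MvPolynomial.smul_eq_C_mul]
        refine Submodule.smul_mem _ _ ?_
        rw [← mul_one (C r)]
        apply hrN'
        rw [mem_restrictTotalDegree, totalDegree_one]; exact Nat.zero_le _
      | add p q hp hq =>
        obtain ⟨k, hk⟩ := hp
        obtain ⟨l, hl⟩ := hq
        refine ⟨max k l, ?_⟩
        rw [mul_add]
        exact add_mem (hmono _ _ _ (le_max_left _ _) hk) (hmono _ _ _ (le_max_right _ _) hl)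
      | mul_X p i hp =>
        obtain ⟨k, hk⟩ := hp
        refine ⟨k+1, ?_⟩
        have := hUX _ hk i
        rwa [show C r ^ (k+1) * (p * X i) = C r * (C r ^ k * p * X i) by ring]
    intro h
    obtain ⟨k, hk⟩ := main h
    obtain ⟨x, hx, y, hy, hxy⟩ := Submodule.mem_sup.1 hk
    obtain ⟨q, hq⟩ := (Submodule.mem_span_range_iff_exists_fun _).1 hy
    refine ⟨k, q, ?_⟩
    rw [← hxy, ← hq]
    simpa [MvPolynomial.smul_eq_C_mul] using hx

end FA3

section FA4
variable {σ : Type*} [Fintype σ] {ι : Type*} [Fintype ι]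

lemma poly_ev {r : Polynomial ℂ} (h : r.eval 0 ≠ 0) : ∀ᶠ c in 𝓝 (0:ℂ), r.eval c ≠ 0 :=
  (r.continuous.continuousAt).eventually_ne h

lemma spec_span {g : ι → MvPolynomial σ (Polynomial ℂ)} {h : MvPolynomial σ (Polynomial ℂ)}
    (hh : h ∈ Ideal.span (Set.range g)) (c : ℂ) : spec c h ∈ Ideal.span (Set.range fun j => spec c (g j)) := by
  have := Ideal.mem_map_of_mem (spec c) hh
  rwa [Ideal.map_span, ← Set.range_comp] at this

lemma fin_of_span {J : Ideal (MvPolynomial σ ℂ)} {D : ℕ} (b : Fin D → MvPolynomial σ ℂ)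
    (h : ∀ x, ∃ q : Fin D → ℂ, x - ∑ m, C (q m) * b m ∈ J) :
    Module.Finite ℂ (MvPolynomial σ ℂ ⧸ J) ∧ Module.finrank ℂ (MvPolynomial σ ℂ ⧸ J) ≤ D := by
  let φ : (Fin D → ℂ) →ₗ[ℂ] (MvPolynomial σ ℂ ⧸ J) :=
    Fintype.linearCombination ℂ (fun m => Ideal.Quotient.mk J (b m))
  have hφ : Function.Surjective φ := by
    intro y
    obtain ⟨x, rfl⟩ := Ideal.Quotient.mk_surjective y
    obtain ⟨q, hq⟩ := h x
    refine ⟨q, ?_⟩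
    rw [← Ideal.Quotient.eq] at hq
    rw [hq, map_sum, Fintype.linearCombination_apply]
    refine Finset.sum_congr rfl fun m _ => ?_
    rw [← MvPolynomial.smul_eq_C_mul]; rfl
  have hf := Module.Finite.of_surjective φ hφ
  refine ⟨hf, ?_⟩
  have := LinearMap.finrank_le_finrank_of_surjective hφ
  simpa using this

lemma ge_of_indep {J : Ideal (MvPolynomial σ ℂ)} {D : ℕ} (b : Fin D → MvPolynomial σ ℂ)
    (hf : Module.Finite ℂ (MvPolynomial σ ℂ ⧸ J))
    (h : ∀ q : Fin D → ℂ, ∑ m, C (q m) * b m ∈ J → q = 0) :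
    D ≤ Module.finrank ℂ (MvPolynomial σ ℂ ⧸ J) := by
  let φ : (Fin D → ℂ) →ₗ[ℂ] (MvPolynomial σ ℂ ⧸ J) :=
    Fintype.linearCombination ℂ (fun m => Ideal.Quotient.mk J (b m))
  have hφ : Function.Injective φ := by
    rw [← LinearMap.ker_eq_bot, LinearMap.ker_eq_bot']
    intro q hq
    apply h
    rw [← Ideal.Quotient.eq_zero_iff_mem, ← hq, map_sum, Fintype.linearCombination_apply]
    refine Finset.sum_congr rfl fun m _ => ?_
    rw [← MvPolynomial.smul_eq_C_mul]; rfl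
  have := LinearMap.finrank_le_finrank_of_injective hφ
  simpa using this

lemma core_span {g : ι → MvPolynomial σ (Polynomial ℂ)} {D : ℕ} {b : Fin D → MvPolynomial σ ℂ} {r : Polynomial ℂ}
    (hc : ∀ h : MvPolynomial σ (Polynomial ℂ), ∃ (k : ℕ) (q : Fin D → Polynomial ℂ),
        C r ^ k * h - ∑ m, C (q m) * incP (b m) ∈ Ideal.span (Set.range g)) (c : ℂ) (hr : r.eval c ≠ 0) :
    ∀ x, ∃ q : Fin D → ℂ, x - ∑ m, C (q m) * b m ∈ Ideal.span (Set.range fun j => spec c (g j)) := by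
  intro x
  obtain ⟨k, q, hq⟩ := hc (incP x)
  have h1 := Ideal.mul_mem_left _ (C ((r.eval c ^ k)⁻¹)) (spec_span hq c)
  refine ⟨fun m => (r.eval c ^ k)⁻¹ * (q m).eval c, ?_⟩
  convert h1 using 1
  simp only [map_sub, map_mul, map_sum, map_pow, spec_C, spec_incP]
  rw [mul_sub, Finset.mul_sum, ← mul_assoc, ← C_pow, ← C_mul, inv_mul_cancel₀ (pow_ne_zero _ hr), C_1, one_mul]
  congr 1
  refine Finset.sum_congr rfl fun m _ => by rw [mul_assoc]

theorem FAM_a (g : ι → MvPolynomial σ (Polynomial ℂ)) (δ : ι → ℕ) (hδ : ∀ j, (g j).totalDegree ≤ δ j)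
    (hlead : ∀ x : σ → ℂ, (∀ j, eval x (homogeneousComponent (δ j) (spec 0 (g j))) = 0) → x = 0) :
    ∀ᶠ c in 𝓝 (0:ℂ), Module.Finite ℂ (MvPolynomial σ ℂ ⧸ Ideal.span (Set.range fun j => spec c (g j))) ∧
      Module.finrank ℂ (MvPolynomial σ ℂ ⧸ Ideal.span (Set.range fun j => spec c (g j))) ≤
      Module.finrank ℂ (MvPolynomial σ ℂ ⧸ Ideal.span (Set.range fun j => spec 0 (g j))) := by
  obtain ⟨_, D, b, r, hr, hD, _, hc⟩ := FAM_core g δ hδ hlead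
  filter_upwards [poly_ev hr] with c hrc
  rw [← hD]
  exact fin_of_span b (core_span hc c hrc)

lemma eval_opt (v : Option σ → ℂ) (p : MvPolynomial (Option σ) ℂ) :
    eval v p = eval (fun i => v (some i)) (spec (v none) (optionEquivRight ℂ σ p)) := by
  induction p using MvPolynomial.induction_on with
  | C a => simp [optionEquivRight_C, spec]
  | add p q hp hq => simp only [map_add, hp, hq]
  | mul_X p i hp =>
    rw [map_mul, map_mul, map_mul, map_mul, hp]
    congr 1
    cases i with
    | none => simp [optionEquivRight_X_none, spec]
    | some i => simp [optionEquivRight_X_some, spec]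

lemma mem_span_equiv {A B κ : Type*} [CommRing A] [CommRing B] (e : A ≃+* B) (g : κ → A) (x : A) :
    x ∈ Ideal.span (Set.range g) ↔ e x ∈ Ideal.span (Set.range fun i => e (g i)) := by
  have : Ideal.span (Set.range fun i => e (g i)) = (Ideal.span (Set.range g)).map (e : A →+* B) := by
    rw [Ideal.map_span, ← Set.range_comp]; rfl
  rw [this]
  constructor
  · intro hx; exact Ideal.mem_map_of_mem (e : A →+* B) hx
  · intro hx
    obtain ⟨y, hy, hyx⟩ := (Ideal.mem_map_iff_of_surjective (e : A →+* B) e.surjective).1 hx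
    rwa [← e.injective hyx]

/-- the parameter is a non-zero-divisor -/
lemma s_nzd (g : σ → MvPolynomial σ (Polynomial ℂ))
    (hfin : Module.Finite ℂ (MvPolynomial σ ℂ ⧸ Ideal.span (Set.range fun j => spec 0 (g j))))
    (h : MvPolynomial σ (Polynomial ℂ)) (hh : C Polynomial.X * h ∈ Ideal.span (Set.range g)) :
    h ∈ Ideal.span (Set.range g) := by
  classical
  let e := optionEquivRight ℂ σ
  let θ : Option σ → MvPolynomial (Option σ) ℂ := fun o => o.elim (X none) (fun i => e.symm (g i))
  have hθ : θ '' {none}ᶜ = Set.range fun i => e.symm (g i) := by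
    ext y; constructor
    · rintro ⟨o, ho, rfl⟩
      cases o with
      | none => simp at ho
      | some i => exact ⟨i, rfl⟩
    · rintro ⟨i, rfl⟩; exact ⟨some i, by simp, rfl⟩
  set I := Ideal.span (Set.range fun i => e.symm (g i)) with hI
  have hmapI : ∀ x, x ∈ Ideal.span (Set.range g) ↔ e.symm x ∈ I := by
    exact fun x => mem_span_equiv e.symm.toRingEquiv g x
  rw [hmapI] at hh ⊢
  have hX : e.symm (C Polynomial.X) = X none := by
    rw [AlgEquiv.symm_apply_eq, optionEquivRight_X_none]
  rw [map_mul, hX] at hh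
  apply mem_of_forall_locI
  intro v
  by_cases hv : v none = 0
  · have hF : FinAt (Ideal.span (Set.range θ)) v := by
      apply finAt_of_finite
      apply finite_of_zeros
      have h0 := zeros_finite hfin
      refine Set.Finite.subset (h0.image fun w (o : Option σ) => o.elim 0 w) ?_
      intro w hw
      have hw0 : w none = 0 := by
        simpa [θ] using hw (θ none) (Ideal.subset_span ⟨none, rfl⟩)
      refine ⟨fun i => w (some i), ?_, ?_⟩
      · intro p hp
        have : Ideal.span (Set.range fun j => spec 0 (g j)) ≤ RingHom.ker (eval fun i => w (some i)) := by
          rw [Ideal.span_le]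
          rintro _ ⟨j, rfl⟩
          have := hw (θ (some j)) (Ideal.subset_span ⟨some j, rfl⟩)
          have h7 : optionEquivRight ℂ σ (θ (some j)) = g j := e.apply_symm_apply (g j)
          rw [eval_opt, hw0, h7] at this
          exact this
        exact this hp
      · funext o; cases o <;> simp [hw0]
    have := C1 θ v (finAt_iff.1 hF) none (e.symm h) (by
      rw [hθ]; apply le_locI; rw [mul_comm]; exact hh)
    rwa [hθ] at this
  · exact ⟨X none, by simpa using hv, hh⟩

theorem FAM_b (g : σ → MvPolynomial σ (Polynomial ℂ)) (δ : σ → ℕ) (hδ : ∀ j, (g j).totalDegree ≤ δ j)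
    (hlead : ∀ x : σ → ℂ, (∀ j, eval x (homogeneousComponent (δ j) (spec 0 (g j))) = 0) → x = 0) :
    ∀ᶠ c in 𝓝 (0:ℂ), Module.Finite ℂ (MvPolynomial σ ℂ ⧸ Ideal.span (Set.range fun j => spec c (g j))) ∧
      Module.finrank ℂ (MvPolynomial σ ℂ ⧸ Ideal.span (Set.range fun j => spec c (g j))) =
      Module.finrank ℂ (MvPolynomial σ ℂ ⧸ Ideal.span (Set.range fun j => spec 0 (g j))) := by
  obtain ⟨hfin, D, b, r, hr, hD, hind, hc⟩ := FAM_core g δ hδ hlead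
  have hindR : ∀ (N : ℕ) (lam : Fin D → Polynomial ℂ), (∑ m, (lam m).natDegree ≤ N) →
      ∑ m, C (lam m) * incP (b m) ∈ Ideal.span (Set.range g) → lam = 0 := by
    intro N
    induction N with
    | zero =>
      intro lam hlam h
      have h2 := spec_span h 0
      simp only [map_sum, map_mul, spec_C, spec_incP] at h2
      have h3 := hind _ h2
      funext m
      have h4 : (lam m).natDegree = 0 := by
        have := Finset.single_le_sum (f := fun m => (lam m).natDegree) (fun _ _ => Nat.zero_le _) (Finset.mem_univ m)
        omega
      have h5 := congrFun h3 m
      simp only [Pi.zero_apply, ← Polynomial.coeff_zero_eq_eval_zero] at h5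
      rw [Polynomial.eq_C_of_natDegree_eq_zero h4, h5]; simp
    | succ N ih =>
      intro lam hlam h
      have h2 := spec_span h 0
      simp only [map_sum, map_mul, spec_C, spec_incP] at h2
      have h3 := hind _ h2
      have h5 : ∀ m, lam m = Polynomial.X * (lam m).divX := fun m => by
        have := congrFun h3 m
        simp only [Pi.zero_apply, ← Polynomial.coeff_zero_eq_eval_zero] at this
        conv_lhs => rw [← Polynomial.X_mul_divX_add (lam m), this]
        simp
      by_cases hz : ∑ m, (lam m).natDegree = 0
      · have : ∀ m, lam m = 0 := fun m => by
          have h6 := (Finset.sum_eq_zero_iff.1 hz) m (Finset.mem_univ m)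
          have := congrFun h3 m
          simp only [Pi.zero_apply, ← Polynomial.coeff_zero_eq_eval_zero] at this
          rw [Polynomial.eq_C_of_natDegree_eq_zero h6, this]; simp
        exact funext this
      have h6 : (fun m => (lam m).divX) = 0 := by
        apply ih
        · have : ∑ m, ((lam m).divX).natDegree < ∑ m, (lam m).natDegree := by
            obtain ⟨m, hm⟩ : ∃ m, (lam m).natDegree ≠ 0 := by
              by_contra hcon; push_neg at hcon; exact hz (Finset.sum_eq_zero fun m _ => hcon m)
            apply Finset.sum_lt_sum
            · intro i _; rw [Polynomial.natDegree_divX_eq_natDegree_tsub_one]; omega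
            · exact ⟨m, Finset.mem_univ _, by rw [Polynomial.natDegree_divX_eq_natDegree_tsub_one]; omega⟩
          omega
        · apply s_nzd g hfin
          convert h using 1
          rw [Finset.mul_sum]
          refine Finset.sum_congr rfl fun m _ => ?_
          conv_rhs => rw [h5 m]
          rw [C_mul, mul_assoc]
      funext m
      rw [h5 m, show (lam m).divX = 0 from congrFun h6 m]; simp
  filter_upwards [poly_ev hr] with c hrc
  obtain ⟨hf, hle⟩ := fin_of_span b (core_span hc c hrc)
  refine ⟨hf, le_antisymm (hD ▸ hle) ?_⟩
  rw [← hD]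
  refine ge_of_indep b hf ?_
  intro q hq
  have hlift : ∃ y ∈ Ideal.span (Set.range g), spec c y = ∑ m, C (q m) * b m := by
    have hs : Function.Surjective (spec (σ := σ) c) := fun x => ⟨incP x, spec_incP c x⟩
    have : Ideal.span (Set.range fun j => spec c (g j)) = (Ideal.span (Set.range g)).map (spec c) := by
      rw [Ideal.map_span, ← Set.range_comp]; rfl
    rw [this] at hq
    exact (Ideal.mem_map_iff_of_surjective _ hs).1 hq
  obtain ⟨y, hy, hyq⟩ := hlift
  obtain ⟨w, hw⟩ : ∃ w, ∑ m, C (Polynomial.C (q m)) * incP (b m) - y = C (Polynomial.X - Polynomial.C c) * w := by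
    have h0 : spec c (∑ m, C (Polynomial.C (q m)) * incP (b m) - y) = 0 := by
      simp [map_sum, spec_C, spec_incP, hyq]
    rw [← dvd_def, C_dvd_iff_dvd_coeff]
    intro m
    rw [Polynomial.dvd_iff_isRoot]
    have := congrArg (coeff m) h0
    rw [spec, coeff_map] at this
    simpa using this
  obtain ⟨k, p, hp⟩ := hc w
  have h1 : ∑ m, C (r ^ k * Polynomial.C (q m) - (Polynomial.X - Polynomial.C c) * p m) * incP (b m) ∈ Ideal.span (Set.range g) := by
    have : ∑ m, C (r ^ k * Polynomial.C (q m) - (Polynomial.X - Polynomial.C c) * p m) * incP (b m)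
        = C r ^ k * y + C (Polynomial.X - Polynomial.C c) * (C r ^ k * w - ∑ m, C (p m) * incP (b m)) := by
      have e1 : C (Polynomial.X - Polynomial.C c) * (C r ^ k * w - ∑ m, C (p m) * incP (b m))
        = C r ^ k * (∑ m, C (Polynomial.C (q m)) * incP (b m) - y) - C (Polynomial.X - Polynomial.C c) * ∑ m, C (p m) * incP (b m) := by
        rw [hw]; ring
      rw [e1]
      simp only [C_sub, C_mul, C_pow, sub_mul, Finset.sum_sub_distrib, mul_sub, Finset.mul_sum, mul_assoc]
      ring
    rw [this]
    exact add_mem (Ideal.mul_mem_left _ _ hy) (Ideal.mul_mem_left _ _ hp)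
  have h2 := hindR _ _ le_rfl h1
  funext m
  have h3 := congrArg (Polynomial.eval c) (congrFun h2 m)
  simpa [hrc] using h3

end FA4

section BT

lemma alg_dep {n : ℕ} (Q : MvPolynomial (Fin n) ℂ) (hQ : Q ≠ 0) (y : Fin n → MvPolynomial (Fin n) ℂ) :
    ∃ G : MvPolynomial (Fin n) ℂ, G ≠ 0 ∧ Q ∣ aeval y G := by
  let z : Option (Fin n) → MvPolynomial (Fin n) ℂ := fun o => o.elim Q y
  have hdep : ¬ AlgebraicIndependent ℂ z := by
    intro h
    have h1 := h.cardinalMk_le_trdeg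
    rw [MvPolynomial.trdeg_of_isDomain] at h1
    simp only [Cardinal.mk_fintype, Fintype.card_option, Fintype.card_fin, Cardinal.lift_natCast, Nat.cast_le] at h1
    omega
  rw [algebraicIndependent_iff] at hdep
  push_neg at hdep
  obtain ⟨p, hp, hp0⟩ := hdep
  let e := optionEquivLeft ℂ (Fin n)
  have hev : ∀ P : MvPolynomial (Option (Fin n)) ℂ, aeval z P =
      Polynomial.eval₂ (aeval y : MvPolynomial (Fin n) ℂ →ₐ[ℂ] _).toRingHom Q (e P) := by
    intro P
    induction P using MvPolynomial.induction_on with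
    | C a => simp [e, optionEquivLeft_C]
    | add p q hp hq => rw [map_add, map_add, Polynomial.eval₂_add, hp, hq]
    | mul_X p i hp =>
      rw [map_mul, map_mul, Polynomial.eval₂_mul, hp]
      congr 1
      cases i with
      | none => simp [e, optionEquivLeft_X_none, z, -optionEquivLeft_apply]
      | some i => simp [e, optionEquivLeft_X_some, z, -optionEquivLeft_apply]
  have he : e p ≠ 0 := fun h => hp0 (by simpa using congrArg e.symm h)
  obtain ⟨r, hr, hr2⟩ := Polynomial.exists_eq_pow_rootMultiplicity_mul_and_not_dvd (e p) he 0
  rw [map_zero, sub_zero] at hr hr2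
  rw [Polynomial.X_dvd_iff] at hr2
  refine ⟨r.coeff 0, hr2, ?_⟩
  have h1 := hev p
  rw [hp, hr, Polynomial.eval₂_mul, Polynomial.eval₂_pow, Polynomial.eval₂_X, eq_comm, mul_eq_zero] at h1
  have h2 := h1.resolve_left (pow_ne_zero _ hQ)
  rw [← Polynomial.X_mul_divX_add r, Polynomial.eval₂_add, Polynomial.eval₂_mul, Polynomial.eval₂_X, Polynomial.eval₂_C] at h2
  exact ⟨- Polynomial.eval₂ (aeval y : MvPolynomial (Fin n) ℂ →ₐ[ℂ] _).toRingHom Q r.divX, by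
    rw [mul_neg]; exact eq_neg_of_add_eq_zero_right h2⟩

theorem bertini {n : ℕ} (Q : MvPolynomial (Fin n) ℂ) (hQ : Q ≠ 0) (S : Finset (Fin n → ℂ)) (hS : ∀ w ∈ S, w ≠ 0) :
    ∃ l : Fin n → ℂ, (∀ i, l i ≠ 0) ∧ (∀ w ∈ S, ∑ i, l i * w i ≠ 0) ∧
      ∀ x, eval x Q = 0 → ¬ ∀ i, eval x (pderiv i Q) = l i := by
  obtain ⟨G, hG, hGQ⟩ := alg_dep Q hQ (fun i => pderiv i Q)
  let M : MvPolynomial (Fin n) ℂ := G * (∏ i, X i) * ∏ w ∈ S, ∑ i, X i * C (w i)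
  have hM : M ≠ 0 := by
    refine mul_ne_zero (mul_ne_zero hG (Finset.prod_ne_zero_iff.2 fun i _ => X_ne_zero i)) (Finset.prod_ne_zero_iff.2 fun w hw => ?_)
    intro h
    apply hS w hw
    funext i
    have := congrArg (eval (Pi.single i 1)) h
    simpa [Pi.single_apply] using this
  obtain ⟨l, hl⟩ : ∃ l, eval l M ≠ 0 := by
    by_contra hcon
    push_neg at hcon
    exact hM (MvPolynomial.funext fun x => by rw [hcon x, map_zero])
  simp only [M, map_mul, map_prod, map_sum, eval_X, eval_C, mul_ne_zero_iff, Finset.prod_ne_zero_iff] at hl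
  refine ⟨l, fun i => hl.1.2 i (Finset.mem_univ i), hl.2, ?_⟩
  intro x hx hxl
  apply hl.1.1
  obtain ⟨c, hc⟩ := hGQ
  have := congrArg (eval x) hc
  rw [map_mul, hx, zero_mul] at this
  rw [← this, ← funext hxl, ← coe_aeval_eq_eval, ← coe_aeval_eq_eval]
  exact (MvPolynomial.comp_aeval_apply (fun i => pderiv i Q) (aeval x : MvPolynomial (Fin n) ℂ →ₐ[ℂ] ℂ) G).symm

lemma avoid {σ : Type*} [Fintype σ] (S : Finset (σ → ℂ)) (hS : ∀ w ∈ S, w ≠ 0) :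
    ∃ l : σ → ℂ, ∀ w ∈ S, ∑ i, l i * w i ≠ 0 := by
  classical
  let M : MvPolynomial σ ℂ := ∏ w ∈ S, ∑ i, X i * C (w i)
  have hM : M ≠ 0 := by
    refine (Finset.prod_ne_zero_iff.2 fun w hw => ?_)
    intro h
    apply hS w hw
    funext i
    have := congrArg (eval (Pi.single i 1)) h
    simpa [Pi.single_apply] using this
  obtain ⟨l, hl⟩ : ∃ l, eval l M ≠ 0 := by
    by_contra hcon
    push_neg at hcon
    exact hM (MvPolynomial.funext fun x => by rw [hcon x, map_zero])
  simp only [M, map_prod, map_sum, map_mul, eval_X, eval_C, Finset.prod_ne_zero_iff] at hl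
  exact ⟨l, hl⟩

end BT

section S1
variable {σ : Type} [Fintype σ] [DecidableEq σ]

/-- generated by one element less than the number of variables -/
def GenC (E : Ideal (MvPolynomial σ ℂ)) : Prop :=
  ∃ (ι : Type) (_ : Fintype ι) (g : ι → MvPolynomial σ ℂ), Fintype.card ι + 1 = Fintype.card σ ∧
    E = Ideal.span (Set.range g)

/-- an arc near a point -/
def Near (a : σ → KK) (v : σ → ℂ) : Prop := ∀ i, 0 < (a i - HahnSeries.C (v i)).orderTop

theorem MS {E : Ideal (MvPolynomial σ ℂ)} (hE : GenC E) (u : MvPolynomial σ ℂ) (v : σ → ℂ)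
    (hfin : FinAt (E ⊔ Ideal.span {u}) v) (huv : eval v u = 0) :
    ∃ (m : ℕ) (a : Fin m → σ → KK), (∀ φ, Near (a φ) v) ∧
      (∀ φ, ∀ g ∈ E, aeval (a φ) g = 0) ∧
      (∀ φ, aeval (a φ) u = HahnSeries.single (1:ℚ) (1:ℂ)) ∧
      ∀ w, (FinAt (E ⊔ Ideal.span {w}) v ↔ ∀ φ, aeval (a φ) w ≠ 0) ∧
        ((∀ φ, aeval (a φ) w ≠ 0) →
          (imu (E ⊔ Ideal.span {w}) v : ℚ) = ∑ φ, (aeval (a φ) w).order) := by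
  obtain ⟨ι, _, g, hc, rfl⟩ := hE
  have hc2 : Fintype.card (Option ι) = Fintype.card σ := by rw [Fintype.card_option, hc]
  let e : Option ι ≃ σ := Fintype.equivOfCardEq hc2
  let θ : σ → MvPolynomial σ ℂ := fun i => (e.symm i).elim u g
  have him : θ '' {e none}ᶜ = Set.range g := by
    ext x; constructor
    · rintro ⟨i, hi, rfl⟩
      obtain ⟨o, rfl⟩ := e.surjective i
      cases o with
      | none => exact absurd rfl hi
      | some o => exact ⟨o, by simp [θ]⟩
    · rintro ⟨o, rfl⟩
      exact ⟨e (some o), by simp, by simp [θ]⟩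
  have h0 : θ (e none) = u := by simp [θ]
  have hf : FinAt (Ideal.span (Set.range θ)) v := by
    rw [range_eq_sup θ (e none), him, h0]; exact hfin
  obtain ⟨m, a, h1, h2, h3, h4⟩ := Mstar θ v (e none) hf (by rw [h0]; exact huv)
  rw [him] at h4
  rw [h0] at h3
  refine ⟨m, a, h1, fun φ x hx => ?_, h3, h4⟩
  have : Ideal.span (Set.range g) ≤ RingHom.ker (aeval (R := ℂ) (a φ)) := by
    rw [Ideal.span_le]
    rintro _ ⟨o, rfl⟩
    have := h2 φ (e (some o)) (by simp)
    simpa [θ] using this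
  exact this hx

lemma C_ot_nonneg (c : ℂ) : (0 : WithTop ℚ) ≤ (HahnSeries.C c : KK).orderTop :=
  HahnSeries.orderTop_single_le

lemma ot_nonneg_of {x : KK} {c : ℂ} (h : 0 < (x - HahnSeries.C c).orderTop) : 0 ≤ x.orderTop := by
  have h2 : x = (x - HahnSeries.C c) + HahnSeries.C c := by ring
  rw [h2]
  exact le_trans (le_min h.le (C_ot_nonneg c)) HahnSeries.min_orderTop_le_orderTop_add

lemma Near.aeval {a : σ → KK} {v : σ → ℂ} (h : Near a v) (p : MvPolynomial σ ℂ) :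
    0 < (MvPolynomial.aeval a p - HahnSeries.C (eval v p)).orderTop := by
  induction p using MvPolynomial.induction_on with
  | C c => simp [MvPolynomial.aeval_C, kk_algebraMap]
  | add p q hp hq =>
    have := ot_pos_add hp hq
    convert this using 2
    simp only [map_add]; ring
  | mul_X p i hp =>
    have h1 := ot_pos_mul_left (ot_nonneg_of hp) (h i)
    have h2 := ot_pos_mul_left (C_ot_nonneg (v i)) hp
    have := ot_pos_add h1 h2
    convert this using 2
    simp only [map_mul, MvPolynomial.aeval_X, eval_X]; ring

lemma order_zero_of {x : KK} {c : ℂ} (h : 0 < (x - HahnSeries.C c).orderTop) (hc : c ≠ 0) :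
    x ≠ 0 ∧ x.order = 0 := by
  have h0 : x.coeff 0 = c := by
    have := HahnSeries.coeff_eq_zero_of_lt_orderTop (x := x - HahnSeries.C c) (i := 0) h
    simpa [sub_eq_zero] using this
  have hx : x ≠ 0 := by rintro rfl; exact hc (by simpa using h0.symm)
  refine ⟨hx, le_antisymm (HahnSeries.order_le_of_coeff_ne_zero (by rwa [h0])) ?_⟩
  have := ot_nonneg_of h
  rw [← HahnSeries.order_eq_orderTop_of_ne_zero hx] at this
  exact_mod_cast this

lemma Near.ne {a : σ → KK} {v : σ → ℂ} (h : Near a v) {p : MvPolynomial σ ℂ} (hp : eval v p ≠ 0) :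
    MvPolynomial.aeval a p ≠ 0 ∧ (MvPolynomial.aeval a p).order = 0 := order_zero_of (h.aeval p) hp

/-- an arc killing a locally finite ideal is constant -/
lemma Near.const {a : σ → KK} {v : σ → ℂ} (h : Near a v) {I : Ideal (MvPolynomial σ ℂ)} (hI : FinAt I v)
    (ha : ∀ g ∈ I, MvPolynomial.aeval a g = 0) (i : σ) : a i = HahnSeries.C (v i) := by
  obtain ⟨k, q, hq, hk⟩ := hI.nilp (X i)
  have h1 := ha _ hk
  rw [map_mul] at h1
  have h2 := (mul_eq_zero.1 h1).resolve_left (h.ne hq).1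
  rw [map_pow] at h2
  have h3 := eq_zero_of_pow_eq_zero h2
  simpa [MvPolynomial.aeval_C, kk_algebraMap, sub_eq_zero] using h3

/-- chain rule -/
lemma chain (a : σ → KK) (p : MvPolynomial σ ℂ) :
    hD (aeval a p) = ∑ i, aeval a (pderiv i p) * hD (a i) := by
  classical
  induction p using MvPolynomial.induction_on with
  | C c => simp [MvPolynomial.aeval_C]
  | add p q hp hq => simp only [map_add, hp, hq, add_mul, Finset.sum_add_distrib]
  | mul_X p i hp =>
    simp only [map_mul, aeval_X, Derivation.leibniz, hp, pderiv_X, smul_eq_mul, map_add, add_mul,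
      Finset.sum_add_distrib, Finset.mul_sum]
    congr 1
    · rw [Finset.sum_eq_single i]
      · simp
      · intro b _ hb; simp [Pi.single_apply, hb.symm]
      · simp
    · exact Finset.sum_congr rfl fun j _ => by ring

lemma euler_ae {p : MvPolynomial σ ℂ} {d : ℕ} (hp : p.IsHomogeneous d) (a : σ → KK) :
    ∑ i, a i * aeval a (pderiv i p) = (d : KK) * aeval a p := by
  have := congrArg (aeval a) hp.sum_X_mul_pderiv
  simpa [map_sum] using this

lemma hom_smul {p : MvPolynomial σ ℂ} {d : ℕ} (hp : p.IsHomogeneous d) (a : σ → KK) (c : KK) :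
    aeval (fun i => c * a i) p = c^d * aeval a p := by
  rw [aeval_def, eval₂_eq, aeval_def, eval₂_eq, Finset.mul_sum]
  refine Finset.sum_congr rfl fun m hm => ?_
  have h1 : Finsupp.degree m = d := by
    have := hp (mem_support_iff.1 hm)
    rwa [Finsupp.degree_eq_weight_one]
  simp only [mul_pow, Finset.prod_mul_distrib, Finset.prod_pow_eq_pow_sum]
  have h2 : ∑ i ∈ m.support, m i = d := h1
  rw [h2]
  ring

/-- linear form -/
def lin (L : σ → ℂ) : MvPolynomial σ ℂ := ∑ i, C (L i) * X i

@[simp] lemma eval_lin (L v : σ → ℂ) : eval v (lin L) = ∑ i, L i * v i := by simp [lin]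

lemma aeval_lin (L : σ → ℂ) (a : σ → KK) : aeval a (lin L) = ∑ i, HahnSeries.C (L i) * a i := by
  simp [lin, MvPolynomial.aeval_C, kk_algebraMap]

theorem changeL1 {ι : Type} [Fintype ι] (g : ι → MvPolynomial σ ℂ) (hc : Fintype.card ι + 1 = Fintype.card σ)
    (hg : ∀ i, ∃ m, (g i).IsHomogeneous m) (L L' v : σ → ℂ) (hL : ∑ i, L i * v i = 1)
    (hL' : ∑ i, L' i * v i = 1)
    (hfin : FinAt (Ideal.span (Set.range g) ⊔ Ideal.span {lin L - 1}) v) :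
    FinAt (Ideal.span (Set.range g) ⊔ Ideal.span {lin L' - 1}) v ∧
    imu (Ideal.span (Set.range g) ⊔ Ideal.span {lin L' - 1}) v =
      imu (Ideal.span (Set.range g) ⊔ Ideal.span {lin L - 1}) v := by
  obtain ⟨m, a, h1, h2, h3, h4⟩ := MS ⟨ι, inferInstance, g, hc, rfl⟩ (lin L - 1) v hfin (by simp [hL])
  have key : ∀ φ, aeval (a φ) (lin L' - 1) = aeval (a φ) (lin L - 1) := by
    intro φ
    set b : KK := aeval (a φ) (lin L) with hb
    have hbn := (h1 φ).ne (p := lin L) (by simp [hL])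
    rw [← hb] at hbn
    have hbp : 0 < (b - HahnSeries.C 1).orderTop := by
      have := (h1 φ).aeval (lin L); simpa [hL] using this
    have hbi : 0 < (b⁻¹ - HahnSeries.C 1).orderTop := by
      have e : b⁻¹ - HahnSeries.C 1 = (-b⁻¹) * (b - HahnSeries.C 1) := by
        have := hbn.1
        simp only [map_one]
        field_simp
        ring
      rw [e]
      refine ot_pos_mul_left ?_ hbp
      rw [HahnSeries.orderTop_neg]
      have e2 : (b⁻¹).orderTop + b.orderTop = 0 := by
        rw [← HahnSeries.orderTop_mul, inv_mul_cancel₀ hbn.1, HahnSeries.orderTop_one]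
      rw [← HahnSeries.order_eq_orderTop_of_ne_zero hbn.1, hbn.2] at e2
      simpa using e2.ge
    have hnear : Near (fun i => b⁻¹ * a φ i) v := by
      intro i
      have e1 := ot_pos_mul_left (ot_nonneg_of hbi) (h1 φ i)
      have e2 := ot_pos_mul_left (C_ot_nonneg (v i)) hbi
      have := ot_pos_add e1 e2
      convert this using 2
      simp only [map_one]; ring
    have hz : ∀ x ∈ Ideal.span (Set.range g) ⊔ Ideal.span {lin L - 1},
        aeval (fun i => b⁻¹ * a φ i) x = 0 := by
      have : Ideal.span (Set.range g) ⊔ Ideal.span {lin L - 1} ≤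
          RingHom.ker (aeval (R := ℂ) (fun i => b⁻¹ * a φ i)) := by
        rw [sup_le_iff, Ideal.span_le, Ideal.span_le]
        constructor
        · rintro _ ⟨o, rfl⟩
          obtain ⟨e, he⟩ := hg o
          have := hom_smul he (a φ) b⁻¹
          rw [h2 φ _ (Ideal.subset_span ⟨o, rfl⟩), mul_zero] at this
          exact this
        · rintro _ rfl
          show aeval _ _ = 0
          rw [map_sub, aeval_lin, map_one, sub_eq_zero]
          have : ∑ i, HahnSeries.C (L i) * (b⁻¹ * a φ i) = b⁻¹ * b := by
            rw [hb, aeval_lin, Finset.mul_sum]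
            exact Finset.sum_congr rfl fun i _ => by ring
          rw [this, inv_mul_cancel₀ hbn.1]
      exact fun x hx => this hx
    have hconst := hnear.const hfin hz
    have hab : ∀ i, a φ i = b * HahnSeries.C (v i) := by
      intro i
      have := hconst i
      rw [← this, mul_inv_cancel_left₀ hbn.1]
    rw [map_sub, map_sub, ← hb, aeval_lin]
    congr 1
    have : ∑ i, HahnSeries.C (L' i) * a φ i = b * HahnSeries.C (∑ i, L' i * v i) := by
      rw [map_sum, Finset.mul_sum]
      refine Finset.sum_congr rfl fun i _ => ?_
      rw [hab, map_mul]; ring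
    rw [this, hL']; simp
  have hne : ∀ φ, aeval (a φ) (lin L' - 1) ≠ 0 := by
    intro φ; rw [key, h3]; simp
  have hne' : ∀ φ, aeval (a φ) (lin L - 1) ≠ 0 := by
    intro φ; rw [h3]; simp
  refine ⟨(h4 _).1.2 hne, ?_⟩
  have := ((h4 _).2 hne).trans ((Finset.sum_congr rfl fun φ _ => by rw [key]).trans ((h4 _).2 hne').symm)
  exact_mod_cast this

lemma scale_eval (c : ℂ) (v : σ → ℂ) (x : MvPolynomial σ ℂ) :
    eval v (aeval (R := ℂ) (fun i => C c * X i : σ → MvPolynomial σ ℂ) x) = eval (fun i => c * v i) x := by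
  induction x using MvPolynomial.induction_on with
  | C a => simp
  | add p q hp hq => simp only [map_add, hp, hq]
  | mul_X p i hp => simp only [map_mul, hp, aeval_X, eval_C, eval_X]

lemma hom_smulC {p : MvPolynomial σ ℂ} {d : ℕ} (hp : p.IsHomogeneous d) (c : ℂ) :
    aeval (R := ℂ) (fun i => C c * X i : σ → MvPolynomial σ ℂ) p = C (c^d) * p := by
  rw [aeval_def, eval₂_eq]
  conv_rhs => rw [p.as_sum, Finset.mul_sum]
  refine Finset.sum_congr rfl fun m hm => ?_
  have h1 : Finsupp.degree m = d := by
    have := hp (mem_support_iff.1 hm)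
    rwa [Finsupp.degree_eq_weight_one]
  simp only [mul_pow, Finset.prod_mul_distrib, Finset.prod_pow_eq_pow_sum]
  have h2 : ∑ i ∈ m.support, m i = d := h1
  rw [h2, monomial_eq, Finsupp.prod, map_pow, MvPolynomial.algebraMap_eq]
  ring

theorem scaleL {ι : Type} (g : ι → MvPolynomial σ ℂ)
    (hg : ∀ i, ∃ m, (g i).IsHomogeneous m) (L v : σ → ℂ) (c : ℂ) (hc0 : c ≠ 0) :
    (FinAt (Ideal.span (Set.range g) ⊔ Ideal.span {lin L - 1}) (fun i => c * v i) ↔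
      FinAt (Ideal.span (Set.range g) ⊔ Ideal.span {lin (fun i => c * L i) - 1}) v) ∧
    imu (Ideal.span (Set.range g) ⊔ Ideal.span {lin L - 1}) (fun i => c * v i) =
      imu (Ideal.span (Set.range g) ⊔ Ideal.span {lin (fun i => c * L i) - 1}) v := by
  have hle : ∀ (c : ℂ) (L : σ → ℂ), Ideal.span (Set.range g) ⊔ Ideal.span {lin L - 1} ≤
      (Ideal.span (Set.range g) ⊔ Ideal.span {lin (fun i => c * L i) - 1}).comap
        (aeval (R := ℂ) (fun i => C c * X i : σ → MvPolynomial σ ℂ)) := by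
    intro c L
    rw [sup_le_iff, Ideal.span_le, Ideal.span_le]
    constructor
    · rintro _ ⟨o, rfl⟩
      obtain ⟨e, he⟩ := hg o
      rw [SetLike.mem_coe, Ideal.mem_comap]
      rw [hom_smulC he]
      exact Ideal.mul_mem_left _ _ (Ideal.mem_sup_left (Ideal.subset_span ⟨o, rfl⟩))
    · rintro _ rfl
      rw [SetLike.mem_coe, Ideal.mem_comap]
      refine Ideal.mem_sup_right (Ideal.subset_span ?_)
      simp only [lin, map_sub, map_sum, map_mul, aeval_X, map_one, Set.mem_singleton_iff, aeval_C,
        MvPolynomial.algebraMap_eq]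
      congr 1
      exact Finset.sum_congr rfl fun i _ => by ring
  have hinv : ∀ (c : ℂ), c ≠ 0 → ∀ x, aeval (R := ℂ) (fun i => C c * X i : σ → MvPolynomial σ ℂ)
      (aeval (R := ℂ) (fun i => C c⁻¹ * X i : σ → MvPolynomial σ ℂ) x) = x := by
    intro c hc x
    induction x using MvPolynomial.induction_on with
    | C a => simp
    | add p q hp hq => simp only [map_add, hp, hq]
    | mul_X p i hp =>
      simp only [map_mul, hp, aeval_X, aeval_C, MvPolynomial.algebraMap_eq]
      rw [← mul_assoc (C c⁻¹), ← C_mul, inv_mul_cancel₀ hc]; simp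
  have heq : Ideal.span (Set.range g) ⊔ Ideal.span {lin L - 1} =
      (Ideal.span (Set.range g) ⊔ Ideal.span {lin (fun i => c * L i) - 1}).comap
        (aeval (R := ℂ) (fun i => C c * X i : σ → MvPolynomial σ ℂ)) := by
    refine le_antisymm (hle c L) ?_
    intro x hx
    have h2 := hle c⁻¹ (fun i => c * L i) hx
    simp only [Ideal.mem_comap] at h2
    have h3 := hinv c⁻¹ (inv_ne_zero hc0) x
    rw [inv_inv] at h3
    rw [h3] at h2
    simpa [inv_mul_cancel_left₀ hc0] using h2
  have hsurj : Function.Surjective (aeval (R := ℂ) (fun i => C c * X i : σ → MvPolynomial σ ℂ)) :=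
    fun x => ⟨_, hinv c hc0 x⟩
  constructor
  · rw [heq]
    exact TR_fin _ hsurj (scale_eval c v) _
  · rw [heq]
    exact TR_imu _ hsurj (scale_eval c v) _

theorem changeL {ι : Type} [Fintype ι] (g : ι → MvPolynomial σ ℂ) (hc : Fintype.card ι + 1 = Fintype.card σ)
    (hg : ∀ i, ∃ m, (g i).IsHomogeneous m) (L L' v v' : σ → ℂ) (c : ℂ) (hc0 : c ≠ 0)
    (hv : v' = fun i => c * v i) (hL : ∑ i, L i * v i = 1)
    (hL' : ∑ i, L' i * v' i = 1)
    (hfin : FinAt (Ideal.span (Set.range g) ⊔ Ideal.span {lin L - 1}) v) :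
    FinAt (Ideal.span (Set.range g) ⊔ Ideal.span {lin L' - 1}) v' ∧
    imu (Ideal.span (Set.range g) ⊔ Ideal.span {lin L' - 1}) v' =
      imu (Ideal.span (Set.range g) ⊔ Ideal.span {lin L - 1}) v := by
  subst hv
  have h1 := changeL1 g hc hg L (fun i => c * L' i) v hL (by
    rw [← hL']; exact Finset.sum_congr rfl fun i _ => by ring) hfin
  have h2 := scaleL g hg L' v c hc0
  exact ⟨h2.1.2 h1.1, h2.2.trans h1.2⟩
end S1

section S2

lemma span_option {A ι : Type*} [CommRing A] (g : ι → A) (x : A) :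
    Ideal.span (Set.range g) ⊔ Ideal.span {x} =
      Ideal.span (Set.range (fun o : Option ι => o.elim x g)) := by
  rw [← Ideal.span_union]
  congr 1
  ext y
  constructor
  · rintro (⟨i, rfl⟩ | rfl)
    · exact ⟨some i, rfl⟩
    · exact ⟨none, rfl⟩
  · rintro ⟨o, rfl⟩
    cases o with
    | none => right; rfl
    | some i => left; exact ⟨i, rfl⟩

lemma genC_sup {σ : Type} [Fintype σ] {ι : Type} [Fintype ι] (g : ι → MvPolynomial σ ℂ)
    (x : MvPolynomial σ ℂ) (h : Fintype.card ι + 2 = Fintype.card σ) :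
    GenC (Ideal.span (Set.range g) ⊔ Ideal.span {x}) :=
  ⟨Option ι, inferInstance, _, by rw [Fintype.card_option, ← h], span_option g x⟩

lemma genC_sup2 {σ : Type} [Fintype σ] {ι : Type} [Fintype ι] (g : ι → MvPolynomial σ ℂ)
    (x y : MvPolynomial σ ℂ) (h : Fintype.card ι + 3 = Fintype.card σ) :
    GenC (Ideal.span (Set.range g) ⊔ Ideal.span {x} ⊔ Ideal.span {y}) := by
  rw [span_option]
  exact genC_sup _ _ (by rw [Fintype.card_option, ← h])

variable {n : ℕ}

/-- the variable `x₀` -/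
def x0 (n : ℕ) : MvPolynomial (Fin n ⊕ Unit) ℂ := X (Sum.inr ())

/-- directional derivatives along `ker l` -/
def DG (H : MvPolynomial (Fin n ⊕ Unit) ℂ) (l : Fin n → ℂ) (k i : Fin n) : MvPolynomial (Fin n ⊕ Unit) ℂ :=
  pderiv (Sum.inl i) H - C (l i / l k) * pderiv (Sum.inl k) H

/-- ideal of the directional derivatives along `ker l` -/
def DI (H : MvPolynomial (Fin n ⊕ Unit) ℂ) (l : Fin n → ℂ) (k : Fin n) : Ideal (MvPolynomial (Fin n ⊕ Unit) ℂ) :=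
  Ideal.span (Set.range (DG H l k))

/-- ideal of the derivatives along `x` -/
def KA (H : MvPolynomial (Fin n ⊕ Unit) ℂ) : Ideal (MvPolynomial (Fin n ⊕ Unit) ℂ) :=
  Ideal.span (Set.range fun i : Fin n => pderiv (Sum.inl i) H)

/-- the linear form `l` minus one -/
def lf (l : Fin n → ℂ) : Fin n ⊕ Unit → ℂ := Sum.elim l (fun _ => 0)

/-- `F_t` -/
def Ft (d : ℕ) (H : MvPolynomial (Fin n ⊕ Unit) ℂ) (t : ℂ) : MvPolynomial (Fin n ⊕ Unit) ℂ := H - C t * x0 n ^ d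

lemma DG_self (H : MvPolynomial (Fin n ⊕ Unit) ℂ) (l : Fin n → ℂ) (k : Fin n) (hk : l k ≠ 0) : DG H l k k = 0 := by
  simp [DG, div_self hk]

lemma DI_sub (H : MvPolynomial (Fin n ⊕ Unit) ℂ) (l : Fin n → ℂ) (k : Fin n) (hk : l k ≠ 0) :
    DI H l k = Ideal.span (Set.range fun i : {i : Fin n // i ≠ k} => DG H l k i.1) := by
  apply le_antisymm
  · rw [DI, Ideal.span_le]
    rintro _ ⟨i, rfl⟩
    by_cases h : i = k
    · subst h
      rw [DG_self H l i hk]; exact Ideal.zero_mem _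
    · exact Ideal.subset_span ⟨⟨i, h⟩, rfl⟩
  · rw [DI, Ideal.span_le]
    rintro _ ⟨i, rfl⟩
    exact Ideal.subset_span ⟨i.1, rfl⟩

lemma DI_le (H : MvPolynomial (Fin n ⊕ Unit) ℂ) (l : Fin n → ℂ) (k k' : Fin n) (hk : l k ≠ 0) (hk' : l k' ≠ 0) :
    DI H l k ≤ DI H l k' := by
  rw [DI, Ideal.span_le]
  rintro _ ⟨i, rfl⟩
  have : DG H l k i = DG H l k' i - C (l i / l k) * DG H l k' k := by
    simp only [DG, mul_sub, ← mul_assoc, ← C_mul]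
    rw [div_mul_div_cancel₀ hk]
    ring
  rw [SetLike.mem_coe, this]
  exact Ideal.sub_mem _ (Ideal.subset_span ⟨i, rfl⟩)
    (Ideal.mul_mem_left _ _ (Ideal.subset_span ⟨k, rfl⟩))

lemma DI_eq (H : MvPolynomial (Fin n ⊕ Unit) ℂ) (l : Fin n → ℂ) (k k' : Fin n) (hk : l k ≠ 0) (hk' : l k' ≠ 0) :
    DI H l k = DI H l k' := le_antisymm (DI_le H l k k' hk hk') (DI_le H l k' k hk' hk)

lemma KA_eq (H : MvPolynomial (Fin n ⊕ Unit) ℂ) (l : Fin n → ℂ) (k : Fin n) :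
    KA H = DI H l k ⊔ Ideal.span {pderiv (Sum.inl k) H} := by
  apply le_antisymm
  · rw [KA, Ideal.span_le]
    rintro _ ⟨i, rfl⟩
    have : pderiv (Sum.inl i) H = DG H l k i + C (l i / l k) * pderiv (Sum.inl k) H := by simp [DG]
    rw [SetLike.mem_coe]
    show pderiv (Sum.inl i) H ∈ _
    rw [this]
    exact Ideal.add_mem _ (Ideal.mem_sup_left (Ideal.subset_span ⟨i, rfl⟩))
      (Ideal.mul_mem_left _ _ (Ideal.mem_sup_right (Ideal.subset_span rfl)))
  · rw [sup_le_iff, DI, Ideal.span_le, Ideal.span_le]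
    constructor
    · rintro _ ⟨i, rfl⟩
      exact Ideal.sub_mem _ (Ideal.subset_span ⟨i, rfl⟩)
        (Ideal.mul_mem_left _ _ (Ideal.subset_span ⟨k, rfl⟩))
    · rintro _ rfl
      exact Ideal.subset_span ⟨k, rfl⟩

lemma ser_order {A y : KK} {c : ℂ} {d : ℕ} (hc : c ≠ 0) (hA : A ≠ 0)
    (h : ∀ q : ℚ, A.coeff q = c * ((d:ℂ) - q) * y.coeff q) (t : ℂ) :
    y - HahnSeries.single (d:ℚ) t ≠ 0 ∧
    (y - HahnSeries.single (d:ℚ) t).order = if t = y.coeff d then A.order else min A.order d := by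
  set r := A.order with hr
  have hrA : A.coeff r ≠ 0 := fun h0 => hA (HahnSeries.coeff_order_eq_zero.1 h0)
  have hrd : r ≠ d := by
    intro h0; apply hrA; rw [h, h0]; simp
  have hyr : y.coeff r ≠ 0 := by
    intro h0; apply hrA; rw [h, h0]; simp
  have hlow : ∀ q : ℚ, q < r → q ≠ d → y.coeff q = 0 := by
    intro q hq hqd
    have h1 : A.coeff q = 0 := HahnSeries.coeff_eq_zero_of_lt_order hq
    rw [h] at h1
    have h2 : (d:ℂ) - q ≠ 0 := by
      rw [sub_ne_zero]; intro h3; apply hqd; exact_mod_cast h3.symm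
    exact (mul_eq_zero.1 h1).resolve_left (mul_ne_zero hc h2)
  have hco : ∀ q : ℚ, q ≠ d → (y - HahnSeries.single (d:ℚ) t).coeff q = y.coeff q := by
    intro q hq
    rw [HahnSeries.coeff_sub, HahnSeries.coeff_single_of_ne hq, sub_zero]
  have hcd : (y - HahnSeries.single (d:ℚ) t).coeff d = y.coeff d - t := by
    rw [HahnSeries.coeff_sub, HahnSeries.coeff_single_same]
  have hne : y - HahnSeries.single (d:ℚ) t ≠ 0 := by
    intro h0
    apply hyr
    rw [← hco r hrd, h0]; simp
  refine ⟨hne, ?_⟩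
  set z := y - HahnSeries.single (d:ℚ) t with hz
  have hzo : z.coeff z.order ≠ 0 := fun h0 => hne (HahnSeries.coeff_order_eq_zero.1 h0)
  have hle : z.order ≤ r := HahnSeries.order_le_of_coeff_ne_zero (by rw [hco r hrd]; exact hyr)
  split_ifs with ht
  · apply le_antisymm hle
    by_contra hlt
    push Not at hlt
    by_cases h1 : z.order = d
    · apply hzo; rw [h1, hcd, ht, sub_self]
    · apply hzo; rw [hco _ h1]; exact hlow _ hlt h1
  · apply le_antisymm
    · refine le_min hle (HahnSeries.order_le_of_coeff_ne_zero ?_)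
      rw [hcd]; exact sub_ne_zero.2 (Ne.symm ht)
    · by_contra hlt
      push Not at hlt
      obtain ⟨h1, h2⟩ := lt_min_iff.1 hlt
      apply hzo; rw [hco _ h2.ne]; exact hlow _ h1 h2.ne

lemma hD_C_mul (c : ℂ) (x : KK) : hD (HahnSeries.C c * x) = HahnSeries.C c * hD x := by
  ext q
  rw [hD_coeff, HahnSeries.C_mul_eq_smul, HahnSeries.C_mul_eq_smul, HahnSeries.coeff_smul,
    HahnSeries.coeff_smul, hD_coeff, smul_eq_mul, smul_eq_mul]
  ring

lemma arc_lf {l : Fin n → ℂ} {k : Fin n} (hk : l k ≠ 0) {H : MvPolynomial (Fin n ⊕ Unit) ℂ} {a : Fin n ⊕ Unit → KK}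
    (i : Fin n) (h : aeval a (DG H l k i) = 0) :
    aeval a (pderiv (Sum.inl i) H) = HahnSeries.C (l i) * (HahnSeries.C (l k)⁻¹ * aeval a (pderiv (Sum.inl k) H)) := by
  rw [DG, map_sub, sub_eq_zero, map_mul, MvPolynomial.aeval_C, kk_algebraMap] at h
  rw [h, div_eq_mul_inv, map_mul, mul_assoc]

lemma ae_lf (l : Fin n → ℂ) (a : Fin n ⊕ Unit → KK) :
    aeval a (lin (lf l)) = ∑ i, HahnSeries.C (l i) * a (Sum.inl i) := by
  rw [aeval_lin, Fintype.sum_sum_type]; simp [lf]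

theorem four_b {d : ℕ} (H : MvPolynomial (Fin n ⊕ Unit) ℂ) (hH : H.IsHomogeneous d) (l : Fin n → ℂ)
    (k : Fin n) (hk : l k ≠ 0) (v : Fin n ⊕ Unit → ℂ) (hv0 : v (Sum.inr ()) = 0)
    (hA : FinAt (DI H l k ⊔ Ideal.span {lin (lf l) - 1} ⊔ Ideal.span {x0 n}) v)
    (hB : FinAt (KA H ⊔ Ideal.span {lin (lf l) - 1}) v) :
    ∃ (G : ℕ) (Z : Finset ℂ),
      (∀ t, FinAt (DI H l k ⊔ Ideal.span {lin (lf l) - 1} ⊔ Ideal.span {Ft d H t}) v) ∧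
      (∀ t, G ≤ imu (DI H l k ⊔ Ideal.span {lin (lf l) - 1} ⊔ Ideal.span {Ft d H t}) v) ∧
      (∀ t, t ∉ Z → imu (DI H l k ⊔ Ideal.span {lin (lf l) - 1} ⊔ Ideal.span {Ft d H t}) v = G) ∧
      ∑ t ∈ Z, (imu (DI H l k ⊔ Ideal.span {lin (lf l) - 1} ⊔ Ideal.span {Ft d H t}) v - G) + G =
        imu (KA H ⊔ Ideal.span {lin (lf l) - 1}) v := by
  have hgen : GenC (DI H l k ⊔ Ideal.span {lin (lf l) - 1}) := by
    rw [DI_sub H l k hk]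
    refine genC_sup _ _ ?_
    have : 0 < n := k.pos
    simp [Fintype.card_subtype_compl]
    omega
  obtain ⟨m, a, h1, h2, h3, h4⟩ := MS hgen (x0 n) v hA (by simp [x0, hv0])
  have hKA : KA H ⊔ Ideal.span {lin (lf l) - 1} =
      DI H l k ⊔ Ideal.span {lin (lf l) - 1} ⊔ Ideal.span {pderiv (Sum.inl k) H} := by
    rw [KA_eq H l k, sup_right_comm]
  rw [hKA] at hB ⊢
  have hAne := (h4 _).1.1 hB
  have hκ := (h4 _).2 hAne
  have key : ∀ φ (q : ℚ), (aeval (a φ) (pderiv (Sum.inl k) H)).coeff q =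
      l k * ((d:ℂ) - q) * (aeval (a φ) H).coeff q := by
    intro φ q
    have ha0 : a φ (Sum.inr ()) = HahnSeries.single (1:ℚ) (1:ℂ) := by
      have := h3 φ; simpa [x0] using this
    have hl1 : ∑ i, HahnSeries.C (l i) * a φ (Sum.inl i) = 1 := by
      have := h2 φ _ (Ideal.mem_sup_right (Ideal.subset_span rfl))
      rwa [map_sub, ae_lf, map_one, sub_eq_zero] at this
    have hDl : ∑ i, HahnSeries.C (l i) * hD (a φ (Sum.inl i)) = 0 := by
      have := congrArg hD hl1
      rw [map_sum] at this
      rw [show hD (1:KK) = 0 from Derivation.map_one_eq_zero hD] at this; rw [← this]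
      refine Finset.sum_congr rfl fun i _ => ?_
      rw [hD_C_mul]
    have hdi : ∀ i, aeval (a φ) (pderiv (Sum.inl i) H) = HahnSeries.C (l i) *
        (HahnSeries.C (l k)⁻¹ * aeval (a φ) (pderiv (Sum.inl k) H)) := fun i =>
      arc_lf hk i (h2 φ _ (Ideal.mem_sup_left (Ideal.subset_span ⟨i, rfl⟩)))
    have hch := chain (a φ) H
    have heu := euler_ae hH (a φ)
    rw [Fintype.sum_sum_type] at hch heu
    simp only [Finset.univ_unique, PUnit.default_eq_unit, Finset.sum_singleton, ha0, hD_single] at hch heu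
    set A := HahnSeries.C (l k)⁻¹ * aeval (a φ) (pderiv (Sum.inl k) H) with hAdef
    have e1 : ∑ i, aeval (a φ) (pderiv (Sum.inl i) H) * hD (a φ (Sum.inl i)) = 0 := by
      rw [← mul_zero A, ← hDl, Finset.mul_sum]
      exact Finset.sum_congr rfl fun i _ => by rw [hdi i]; ring
    have e2 : ∑ i, a φ (Sum.inl i) * aeval (a φ) (pderiv (Sum.inl i) H) = A := by
      rw [← mul_one A, ← hl1, Finset.mul_sum]
      exact Finset.sum_congr rfl fun i _ => by rw [hdi i]; ring
    rw [e1] at hch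
    rw [e2] at heu
    have e3 : A = (d:KK) * aeval (a φ) H - hD (aeval (a φ) H) := by
      rw [hch, ← heu]
      simp only [Rat.cast_one, mul_one]
      ring
    have e4 : aeval (a φ) (pderiv (Sum.inl k) H) = HahnSeries.C (l k) * A := by
      rw [hAdef, ← mul_assoc, ← map_mul, mul_inv_cancel₀ hk]; simp
    have e5 : (d:KK) = HahnSeries.C (d:ℂ) := by simp
    rw [e4, HahnSeries.C_mul_eq_smul, HahnSeries.coeff_smul, e3, HahnSeries.coeff_sub, hD_coeff, e5,
      HahnSeries.C_mul_eq_smul, HahnSeries.coeff_smul, smul_eq_mul, smul_eq_mul]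
    ring
  have hFt : ∀ φ t, aeval (a φ) (Ft d H t) = aeval (a φ) H - HahnSeries.single (d:ℚ) t := by
    intro φ t
    rw [Ft, map_sub, map_mul, map_pow, h3 φ, MvPolynomial.aeval_C, kk_algebraMap,
      HahnSeries.single_pow, HahnSeries.C_apply, HahnSeries.single_mul_single]
    simp
  have hord := fun φ t => ser_order hk (hAne φ) (key φ) t
  have hν : ∀ t, (imu (DI H l k ⊔ Ideal.span {lin (lf l) - 1} ⊔ Ideal.span {Ft d H t}) v : ℚ) =
      ∑ φ, if t = (aeval (a φ) H).coeff d then (aeval (a φ) (pderiv (Sum.inl k) H)).order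
        else min (aeval (a φ) (pderiv (Sum.inl k) H)).order d := by
    intro t
    rw [(h4 _).2 (fun φ => by rw [hFt]; exact (hord φ t).1)]
    exact Finset.sum_congr rfl fun φ _ => by rw [hFt]; exact (hord φ t).2
  set r := fun φ => (aeval (a φ) (pderiv (Sum.inl k) H)).order with hr
  set c := fun φ => (aeval (a φ) H).coeff (d:ℚ) with hcc
  set ν := fun t => imu (DI H l k ⊔ Ideal.span {lin (lf l) - 1} ⊔ Ideal.span {Ft d H t}) v with hνdef
  let Z : Finset ℂ := Finset.univ.image c
  obtain ⟨t1, ht1⟩ := Infinite.exists_notMem_finset Z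
  have hgenr : ∀ t, t ∉ Z → (ν t : ℚ) = ∑ φ, min (r φ) d := by
    intro t ht
    rw [hν t]
    refine Finset.sum_congr rfl fun φ _ => ?_
    rw [if_neg]
    rintro rfl
    exact ht (Finset.mem_image_of_mem _ (Finset.mem_univ φ))
  have hge : ∀ t, ν t1 ≤ ν t := by
    intro t
    have : (ν t1 : ℚ) ≤ ν t := by
      rw [hgenr t1 ht1, hν t]
      refine Finset.sum_le_sum fun φ _ => ?_
      split_ifs
      · exact min_le_left _ _
      · exact le_rfl
    exact_mod_cast this
  refine ⟨ν t1, Z, fun t => (h4 _).1.2 fun φ => by rw [hFt]; exact (hord φ t).1, hge, ?_, ?_⟩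
  · intro t ht
    have := (hgenr t ht).trans (hgenr t1 ht1).symm
    exact_mod_cast this
  · have : ((∑ t ∈ Z, (ν t - ν t1) + ν t1 : ℕ) : ℚ) = ∑ φ, r φ := by
      push_cast
      have e : ∀ t, ((ν t - ν t1 : ℕ) : ℚ) = ∑ φ, if t = c φ then r φ - min (r φ) d else 0 := by
        intro t
        rw [Nat.cast_sub (hge t), hgenr t1 ht1, hν t, ← Finset.sum_sub_distrib]
        refine Finset.sum_congr rfl fun φ _ => ?_
        split_ifs <;> simp [hr]
      rw [Finset.sum_congr rfl fun t _ => e t, Finset.sum_comm, hgenr t1 ht1, ← Finset.sum_add_distrib]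
      refine Finset.sum_congr rfl fun φ _ => ?_
      rw [Finset.sum_ite_eq' Z (c φ), if_pos (Finset.mem_image_of_mem _ (Finset.mem_univ φ))]
      ring
    have h5 := this.trans hκ.symm
    exact_mod_cast h5
end S2

section S3
variable {n : ℕ}

/-- `∂_i F`, `i ≠ j` -/
def KJ (F : MvPolynomial (Fin n ⊕ Unit) ℂ) (j : Fin n) : Ideal (MvPolynomial (Fin n ⊕ Unit) ℂ) :=
  Ideal.span (Set.range fun i : {i : Fin n // i ≠ j} => pderiv (Sum.inl i.1) F)

lemma lin_single (j : Fin n) :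
    lin (Pi.single (Sum.inl j : Fin n ⊕ Unit) (1:ℂ)) = X (Sum.inl j) := by
  rw [lin, Finset.sum_eq_single (Sum.inl j)]
  · simp
  · intro b _ hb; simp [Pi.single_apply, hb]
  · simp

lemma rho (x : KK) (hx : 0 < x.orderTop) : ∃ ρ : KK, 0 ≤ ρ.orderTop ∧ x = ρ * hD x := by
  by_cases h : x = 0
  · exact ⟨0, by simp, by simp [h]⟩
  · have h1 := hD_orderTop x hx.ne'
    have h2 : hD x ≠ 0 := by
      intro h0; rw [h0, HahnSeries.orderTop_zero] at h1
      exact h (HahnSeries.orderTop_eq_top.1 h1.symm)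
    refine ⟨x * (hD x)⁻¹, ?_, by rw [inv_mul_cancel_right₀ h2]⟩
    have h3 : (x * (hD x)⁻¹).orderTop + (hD x).orderTop = x.orderTop := by
      rw [← HahnSeries.orderTop_mul, inv_mul_cancel_right₀ h2]
    rw [h1] at h3
    rw [← HahnSeries.order_eq_orderTop_of_ne_zero h,
      ← HahnSeries.order_eq_orderTop_of_ne_zero (mul_ne_zero h (inv_ne_zero h2))] at h3
    rw [← HahnSeries.order_eq_orderTop_of_ne_zero (mul_ne_zero h (inv_ne_zero h2))]
    have h4 : (x * (hD x)⁻¹).order + x.order = x.order := by exact_mod_cast h3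
    have : (x * (hD x)⁻¹).order = 0 := by linarith
    rw [this]; exact le_rfl

theorem three {d : ℕ} (F : MvPolynomial (Fin n ⊕ Unit) ℂ) (hF : F.IsHomogeneous d) (l : Fin n → ℂ)
    (j k : Fin n) (hjk : j ≠ k) (hk : l k ≠ 0) (v : Fin n ⊕ Unit → ℂ)
    (hv0 : v (Sum.inr ()) = 0) (hlv : ∑ i, l i * v (Sum.inl i) ≠ 0)
    (hW : ∀ i, eval v (pderiv (Sum.inl i) F) = 0)
    (hfin : FinAt (DI F l k ⊔ Ideal.span {F} ⊔ Ideal.span {X (Sum.inl j) - 1}) v) :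
    FinAt (KJ F j ⊔ Ideal.span {X (Sum.inl j) - 1} ⊔ Ideal.span {F}) v ∧
    imu (KJ F j ⊔ Ideal.span {X (Sum.inl j) - 1} ⊔ Ideal.span {F}) v =
      imu (DI F l k ⊔ Ideal.span {F} ⊔ Ideal.span {X (Sum.inl j) - 1}) v := by
  set E0 := Ideal.span (Set.range fun i : {i : Fin n // i ≠ j ∧ i ≠ k} => DG F l k i.1) with hE0
  have hgen : GenC (E0 ⊔ Ideal.span {F} ⊔ Ideal.span {X (Sum.inl j) - 1}) := by
    refine genC_sup2 _ _ _ ?_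
    rw [Fintype.card_subtype]
    have : (Finset.univ.filter fun i : Fin n => i ≠ j ∧ i ≠ k) = (Finset.univ.erase j).erase k := by
      ext i; simp [and_comm]
    rw [this, Finset.card_erase_of_mem (by simp [hjk.symm]), Finset.card_erase_of_mem (by simp)]
    have : 1 < n := by
      have h1 := j.2; have h2 := k.2
      have h3 : (j:ℕ) ≠ k := fun h => hjk (Fin.ext h)
      omega
    simp; omega
  have hDI : DI F l k = E0 ⊔ Ideal.span {DG F l k j} := by
    apply le_antisymm
    · rw [DI, Ideal.span_le]
      rintro _ ⟨i, rfl⟩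
      by_cases h1 : i = k
      · subst h1; rw [DG_self F l i hk]; exact Ideal.zero_mem _
      · by_cases h2 : i = j
        · subst h2; exact Ideal.mem_sup_right (Ideal.subset_span rfl)
        · exact Ideal.mem_sup_left (Ideal.subset_span ⟨⟨i, h2, h1⟩, rfl⟩)
    · rw [sup_le_iff, DI, Ideal.span_le, Ideal.span_le]
      constructor
      · rintro _ ⟨i, rfl⟩
        exact Ideal.subset_span ⟨i.1, rfl⟩
      · rintro _ rfl
        exact Ideal.subset_span ⟨j, rfl⟩
  have hKJ : KJ F j = E0 ⊔ Ideal.span {pderiv (Sum.inl k) F} := by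
    apply le_antisymm
    · rw [KJ, Ideal.span_le]
      rintro _ ⟨i, rfl⟩
      by_cases h1 : i.1 = k
      · show pderiv (Sum.inl i.1) F ∈ _
        rw [h1]; exact Ideal.mem_sup_right (Ideal.subset_span rfl)
      · have : pderiv (Sum.inl i.1) F = DG F l k i.1 + C (l i.1 / l k) * pderiv (Sum.inl k) F := by simp [DG]
        show pderiv (Sum.inl i.1) F ∈ _
        rw [this]
        exact Ideal.add_mem _ (Ideal.mem_sup_left (Ideal.subset_span ⟨⟨i.1, i.2, h1⟩, rfl⟩))
          (Ideal.mul_mem_left _ _ (Ideal.mem_sup_right (Ideal.subset_span rfl)))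
    · rw [sup_le_iff, hE0, Ideal.span_le, Ideal.span_le]
      constructor
      · rintro _ ⟨i, rfl⟩
        exact Ideal.sub_mem _ (Ideal.subset_span ⟨⟨i.1, i.2.1⟩, rfl⟩)
          (Ideal.mul_mem_left _ _ (Ideal.subset_span ⟨⟨k, hjk.symm⟩, rfl⟩))
      · rintro _ rfl
        exact Ideal.subset_span ⟨⟨k, hjk.symm⟩, rfl⟩
  have r1 : DI F l k ⊔ Ideal.span {F} ⊔ Ideal.span {X (Sum.inl j) - 1} =
      E0 ⊔ Ideal.span {F} ⊔ Ideal.span {X (Sum.inl j) - 1} ⊔ Ideal.span {DG F l k j} := by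
    rw [hDI]; ac_rfl
  have r2 : KJ F j ⊔ Ideal.span {X (Sum.inl j) - 1} ⊔ Ideal.span {F} =
      E0 ⊔ Ideal.span {F} ⊔ Ideal.span {X (Sum.inl j) - 1} ⊔ Ideal.span {pderiv (Sum.inl k) F} := by
    rw [hKJ]; ac_rfl
  rw [r1] at hfin ⊢
  rw [r2]
  obtain ⟨m, a, h1, h2, h3, h4⟩ := MS hgen (DG F l k j) v hfin (by simp [DG, hW])
  have key : ∀ φ, aeval (a φ) (pderiv (Sum.inl k) F) ≠ 0 ∧
      (aeval (a φ) (pderiv (Sum.inl k) F)).order = (aeval (a φ) (DG F l k j)).order := by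
    intro φ
    have ha0 : 0 < (a φ (Sum.inr ())).orderTop := by
      have := h1 φ (Sum.inr ()); simpa [hv0] using this
    have haj : a φ (Sum.inl j) = 1 := by
      have := h2 φ _ (Ideal.mem_sup_right (Ideal.subset_span rfl))
      simpa [sub_eq_zero] using this
    have haF : aeval (a φ) F = 0 :=
      h2 φ _ (Ideal.mem_sup_left (Ideal.mem_sup_right (Ideal.subset_span rfl)))
    set A : KK := HahnSeries.C (l k)⁻¹ * aeval (a φ) (pderiv (Sum.inl k) F) with hAdef
    set B := aeval (a φ) (DG F l k j) with hB
    have hBne : B ≠ 0 := by rw [hB, h3 φ]; simp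
    have hdi : ∀ i, aeval (a φ) (pderiv (Sum.inl i) F) = HahnSeries.C (l i) * A + if i = j then B else 0 := by
      intro i
      by_cases hij : i = j
      · subst hij
        rw [if_pos rfl, hB, hAdef, DG, map_sub, map_mul, MvPolynomial.aeval_C, kk_algebraMap,
          div_eq_mul_inv, map_mul]
        ring
      · rw [if_neg hij, add_zero]
        apply arc_lf hk i
        by_cases hik : i = k
        · subst hik; rw [DG_self F l i hk, map_zero]
        · exact h2 φ _ (Ideal.mem_sup_left (Ideal.mem_sup_left (Ideal.subset_span ⟨⟨i, hij, hik⟩, rfl⟩)))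
    have hch := chain (a φ) F
    have heu := euler_ae hF (a φ)
    rw [Fintype.sum_sum_type, haF] at hch heu
    simp only [Finset.univ_unique, PUnit.default_eq_unit, Finset.sum_singleton, map_zero, mul_zero] at hch heu
    set la := ∑ i, HahnSeries.C (l i) * a φ (Sum.inl i) with hla
    have e1 : ∑ i, aeval (a φ) (pderiv (Sum.inl i) F) * hD (a φ (Sum.inl i)) = A * hD la := by
      rw [hla, map_sum, Finset.mul_sum]
      have : ∀ i, aeval (a φ) (pderiv (Sum.inl i) F) * hD (a φ (Sum.inl i)) =
          A * hD (HahnSeries.C (l i) * a φ (Sum.inl i)) := by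
        intro i
        rw [hdi, hD_C_mul]
        split_ifs with hij
        · subst hij; rw [haj, show hD (1:KK) = 0 from Derivation.map_one_eq_zero hD]; ring
        · ring
      exact Finset.sum_congr rfl fun i _ => this i
    have e2 : ∑ i, a φ (Sum.inl i) * aeval (a φ) (pderiv (Sum.inl i) F) = A * la + B := by
      have : ∀ i, a φ (Sum.inl i) * aeval (a φ) (pderiv (Sum.inl i) F) =
          A * (HahnSeries.C (l i) * a φ (Sum.inl i)) + if i = j then B else 0 := by
        intro i
        rw [hdi]
        split_ifs with hij
        · subst hij; rw [haj]; ring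
        · ring
      rw [Finset.sum_congr rfl fun i _ => this i, Finset.sum_add_distrib, ← Finset.mul_sum,
        Finset.sum_ite_eq' Finset.univ j, if_pos (Finset.mem_univ j)]
    rw [e1] at hch
    rw [e2] at heu
    obtain ⟨ρ, hρ, hρ2⟩ := rho _ ha0
    have hlan : 0 < (la - HahnSeries.C (∑ i, l i * v (Sum.inl i))).orderTop := by
      have := (h1 φ).aeval (lin (lf l))
      rwa [ae_lf, eval_lin, Fintype.sum_sum_type, show (∑ x : Unit, lf l (Sum.inr x) * v (Sum.inr x)) = 0 by simp [lf],
        add_zero] at this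
    set cl := ∑ i, l i * v (Sum.inl i) with hcl
    have hDla : 0 < (hD la).orderTop := by
      have : hD la = hD (la - HahnSeries.C cl) := by
        rw [map_sub, ← kk_algebraMap, Derivation.map_algebraMap, sub_zero]
      rw [this, hD_orderTop _ hlan.ne']; exact hlan
    set M := la - ρ * hD la with hM
    have hMM : M ≠ 0 ∧ M.order = 0 := by
      refine order_zero_of (c := cl) ?_ hlv
      have h5 := ot_pos_mul_left hρ hDla
      have h6 := ot_pos_add hlan (y := -(ρ * hD la)) (by rwa [HahnSeries.orderTop_neg])
      convert h6 using 2
      rw [hM]; ring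
    have hBA : B = -M * A := by
      rw [hM]
      have : a φ (Sum.inr ()) * aeval (a φ) (pderiv (Sum.inr ()) F) = - ρ * (A * hD la) := by
        rw [hρ2]
        linear_combination -ρ * hch
      rw [this] at heu
      linear_combination heu
    have hAA : A ≠ 0 := by rintro h0; apply hBne; rw [hBA, h0, mul_zero]
    have e4 : aeval (a φ) (pderiv (Sum.inl k) F) = HahnSeries.C (l k) * A := by
      rw [hAdef, ← mul_assoc, ← map_mul, mul_inv_cancel₀ hk]; simp
    have hCn : (HahnSeries.C (l k) : KK) ≠ 0 := by simpa using hk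
    refine ⟨by rw [e4]; exact mul_ne_zero hCn hAA, ?_⟩
    rw [e4, HahnSeries.order_mul hCn hAA, HahnSeries.order_C, hBA,
      HahnSeries.order_mul (neg_ne_zero.2 hMM.1) hAA, HahnSeries.order_neg, hMM.2]
  have hne := fun φ => (key φ).1
  have hBn : ∀ φ, aeval (a φ) (DG F l k j) ≠ 0 := by
    intro φ; rw [h3]; simp
  refine ⟨(h4 _).1.2 hne, ?_⟩
  have := ((h4 _).2 hne).trans ((Finset.sum_congr rfl fun φ _ => (key φ).2).trans ((h4 _).2 hBn).symm)
  exact_mod_cast this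

theorem four_a (F : MvPolynomial (Fin n ⊕ Unit) ℂ)
    (j : Fin n) (v : Fin n ⊕ Unit → ℂ)
    (hv0 : v (Sum.inr ()) = 0) (hvF : eval v F = 0)
    (hfin : FinAt (KJ F j ⊔ Ideal.span {X (Sum.inl j) - 1} ⊔ Ideal.span {F}) v) :
    FinAt (KJ F j ⊔ Ideal.span {X (Sum.inl j) - 1} ⊔ Ideal.span {pderiv (Sum.inr ()) F}) v ∧
    imu (KJ F j ⊔ Ideal.span {X (Sum.inl j) - 1} ⊔ Ideal.span {F}) v =
      imu (KJ F j ⊔ Ideal.span {X (Sum.inl j) - 1} ⊔ Ideal.span {x0 n}) v +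
      imu (KJ F j ⊔ Ideal.span {X (Sum.inl j) - 1} ⊔ Ideal.span {pderiv (Sum.inr ()) F}) v := by
  have hgen : GenC (KJ F j ⊔ Ideal.span {X (Sum.inl j) - 1}) := by
    refine genC_sup _ _ ?_
    have : 0 < n := j.pos
    simp [Fintype.card_subtype_compl]
    omega
  obtain ⟨m, a, h1, h2, h3, h4⟩ := MS hgen F v hfin hvF
  have key : ∀ φ, a φ (Sum.inr ()) ≠ 0 ∧ aeval (a φ) (pderiv (Sum.inr ()) F) ≠ 0 ∧
      (aeval (a φ) F).order = (a φ (Sum.inr ())).order + (aeval (a φ) (pderiv (Sum.inr ()) F)).order := by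
    intro φ
    have ha0 : 0 < (a φ (Sum.inr ())).orderTop := by
      have := h1 φ (Sum.inr ()); simpa [hv0] using this
    have haj : a φ (Sum.inl j) = 1 := by
      have := h2 φ _ (Ideal.mem_sup_right (Ideal.subset_span rfl))
      simpa [sub_eq_zero] using this
    have hch := chain (a φ) F
    rw [Fintype.sum_sum_type, Finset.sum_eq_zero, zero_add] at hch
    · simp only [Finset.univ_unique, PUnit.default_eq_unit, Finset.sum_singleton, h3 φ, hD_single] at hch
      simp only [Rat.cast_one, mul_one] at hch
      have hn0 : (HahnSeries.single (1:ℚ) (1:ℂ)) ≠ 0 := by simp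
      rw [hch] at hn0
      have hd1 := right_ne_zero_of_mul hn0
      have hd2 := left_ne_zero_of_mul hn0
      have hd3 : a φ (Sum.inr ()) ≠ 0 := by rintro h0; apply hd1; rw [h0, map_zero]
      refine ⟨hd3, hd2, ?_⟩
      rw [h3 φ, hch, HahnSeries.order_mul hd2 hd1, add_comm]
      congr 1
      have := hD_orderTop _ ha0.ne'
      rw [← HahnSeries.order_eq_orderTop_of_ne_zero hd3, ← HahnSeries.order_eq_orderTop_of_ne_zero hd1] at this
      exact_mod_cast this
    · intro i _
      by_cases hij : i = j
      · subst hij; rw [haj, show hD (1:KK) = 0 from Derivation.map_one_eq_zero hD, mul_zero]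
      · rw [h2 φ _ (Ideal.mem_sup_left (Ideal.subset_span ⟨⟨i, hij⟩, rfl⟩)), zero_mul]
  have hx : ∀ φ, aeval (a φ) (x0 n) = a φ (Sum.inr ()) := fun φ => by simp [x0]
  refine ⟨(h4 _).1.2 fun φ => (key φ).2.1, ?_⟩
  have e1 := (h4 (x0 n)).2 fun φ => by rw [hx]; exact (key φ).1
  have e2 := (h4 (pderiv (Sum.inr ()) F)).2 fun φ => (key φ).2.1
  have e3 := (h4 F).2 fun φ => by rw [h3]; simp
  have : (imu (KJ F j ⊔ Ideal.span {X (Sum.inl j) - 1} ⊔ Ideal.span {F}) v : ℚ) =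
      imu (KJ F j ⊔ Ideal.span {X (Sum.inl j) - 1} ⊔ Ideal.span {x0 n}) v +
      imu (KJ F j ⊔ Ideal.span {X (Sum.inl j) - 1} ⊔ Ideal.span {pderiv (Sum.inr ()) F}) v := by
    rw [e1, e2, e3, ← Finset.sum_add_distrib]
    exact Finset.sum_congr rfl fun φ _ => by rw [hx]; exact (key φ).2.2
  exact_mod_cast this

lemma pd_Ft (d : ℕ) (H : MvPolynomial (Fin n ⊕ Unit) ℂ) (t : ℂ) (i : Fin n) :
    pderiv (Sum.inl i) (Ft d H t) = pderiv (Sum.inl i) H := by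
  rw [Ft, x0, map_sub, pderiv_C_mul, pderiv_pow, pderiv_X_of_ne (by simp)]
  simp

lemma DG_Ft (d : ℕ) (H : MvPolynomial (Fin n ⊕ Unit) ℂ) (t : ℂ) (l : Fin n → ℂ) (k : Fin n) :
    DG (Ft d H t) l k = DG H l k := by
  funext i; simp only [DG, pd_Ft]

lemma KJ_Ft (d : ℕ) (H : MvPolynomial (Fin n ⊕ Unit) ℂ) (t : ℂ) (j : Fin n) :
    KJ (Ft d H t) j = KJ H j := by
  simp only [KJ, pd_Ft]

lemma Ft_hom {d : ℕ} {H : MvPolynomial (Fin n ⊕ Unit) ℂ} (hH : H.IsHomogeneous d) (t : ℂ) :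
    (Ft d H t).IsHomogeneous d := by
  refine hH.sub ?_
  have := (isHomogeneous_C (Fin n ⊕ Unit) t).mul ((isHomogeneous_X ℂ (Sum.inr () : Fin n ⊕ Unit)).pow d)
  simpa [x0] using this

lemma DG_hom {d : ℕ} {H : MvPolynomial (Fin n ⊕ Unit) ℂ} (hH : H.IsHomogeneous d) (l : Fin n → ℂ)
    (k i : Fin n) : (DG H l k i).IsHomogeneous (d-1) := by
  refine hH.pderiv.sub ?_
  have := (isHomogeneous_C (Fin n ⊕ Unit) (l i / l k)).mul (hH.pderiv (i := Sum.inl k))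
  simpa using this

lemma euler_ev {d : ℕ} {F : MvPolynomial (Fin n ⊕ Unit) ℂ} (hF : F.IsHomogeneous d) (v : Fin n ⊕ Unit → ℂ) :
    ∑ i, v (Sum.inl i) * eval v (pderiv (Sum.inl i) F) +
      v (Sum.inr ()) * eval v (pderiv (Sum.inr ()) F) = d * eval v F := by
  have := congrArg (eval v) hF.sum_X_mul_pderiv
  simpa [map_sum, Fintype.sum_sum_type] using this

/-- comparison at a point at infinity -/
theorem infinity {d : ℕ} (hd : 1 ≤ d) (H : MvPolynomial (Fin n ⊕ Unit) ℂ) (hH : H.IsHomogeneous d) (l : Fin n → ℂ)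
    (j k : Fin n) (hjk : j ≠ k) (hk : l k ≠ 0) (v v' : Fin n ⊕ Unit → ℂ)
    (hv0 : v (Sum.inr ()) = 0) (hlv : ∑ i, l i * v (Sum.inl i) = 1) (c : ℂ) (hc0 : c ≠ 0)
    (hvc : v' = fun i => c * v i) (hvj : v' (Sum.inl j) = 1)
    (hW : ∀ i, eval v' (pderiv (Sum.inl i) H) = 0) (t : ℂ)
    (hfin : FinAt (DI H l k ⊔ Ideal.span {lin (lf l) - 1} ⊔ Ideal.span {Ft d H t}) v) :
    FinAt (KJ H j ⊔ Ideal.span {X (Sum.inl j) - 1} ⊔ Ideal.span {pderiv (Sum.inr ()) (Ft d H t)}) v' ∧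
    imu (DI H l k ⊔ Ideal.span {lin (lf l) - 1} ⊔ Ideal.span {Ft d H t}) v =
      imu (KJ H j ⊔ Ideal.span {X (Sum.inl j) - 1} ⊔ Ideal.span {x0 n}) v' +
      imu (KJ H j ⊔ Ideal.span {X (Sum.inl j) - 1} ⊔ Ideal.span {pderiv (Sum.inr ()) (Ft d H t)}) v' := by
  have hv0' : v' (Sum.inr ()) = 0 := by rw [hvc]; simp [hv0]
  have hFh := Ft_hom hH t
  have hsw : DI H l k ⊔ Ideal.span {lin (lf l) - 1} ⊔ Ideal.span {Ft d H t} =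
      Ideal.span (Set.range fun o : Option {i : Fin n // i ≠ k} =>
        o.elim (Ft d H t) fun i => DG H l k i.1) ⊔ Ideal.span {lin (lf l) - 1} := by
    rw [sup_right_comm, DI_sub H l k hk, span_option]
  rw [hsw] at hfin ⊢
  have hcl := changeL (σ := Fin n ⊕ Unit) (fun o : Option {i : Fin n // i ≠ k} =>
      o.elim (Ft d H t) fun i => DG H l k i.1)
    (by
      have : 0 < n := j.pos
      simp [Fintype.card_subtype_compl]
      omega)
    (fun o => by
      cases o with
      | none => exact ⟨d, hFh⟩
      | some i => exact ⟨d-1, DG_hom hH l k i.1⟩)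
    (lf l) (Pi.single (Sum.inl j) 1) v v' c hc0 hvc (by
      rw [Fintype.sum_sum_type]; simp [lf, hlv]) (by
      simp [Pi.single_apply, hvj]) hfin
  rw [lin_single, ← span_option, ← DI_sub H l k hk] at hcl
  have hDI : DI H l k = DI (Ft d H t) l k := by rw [DI, DI, DG_Ft]
  rw [hDI] at hcl
  have h3 := three (Ft d H t) hFh l j k hjk hk v' hv0' (by
    rw [hvc]
    simp only
    have : ∑ i, l i * (c * v (Sum.inl i)) = c * 1 := by
      rw [← hlv, Finset.mul_sum]; exact Finset.sum_congr rfl fun i _ => by ring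
    rw [this]; simpa using hc0) (fun i => by rw [pd_Ft]; exact hW i) hcl.1
  have hvF : eval v' (Ft d H t) = 0 := by
    have := euler_ev hFh v'
    rw [Finset.sum_eq_zero (fun i _ => by rw [pd_Ft, hW, mul_zero]), hv0', zero_mul, zero_add] at this
    have hd' : (d:ℂ) ≠ 0 := by exact_mod_cast (by omega : d ≠ 0)
    exact (mul_eq_zero.1 this.symm).resolve_left hd'
  have h4 := four_a (Ft d H t) j v' hv0' hvF h3.1
  rw [KJ_Ft] at h3 h4
  exact ⟨h4.1, by rw [← h4.2, h3.2, hcl.2, ← hDI, DI_sub H l k hk, ← span_option]⟩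
end S3

section S4
variable {n : ℕ}

/-- the homogenization, with the parameter in an arbitrary algebra -/
def HA {A : Type*} [CommRing A] [Algebra ℂ A] (d : ℕ) (P : MvPolynomial (XS n) ℂ) (c : A) :
    MvPolynomial (HV n) A :=
  ∑ q ∈ Finset.range (d+1), (X (Sum.inr ()))^(d-q) *
    aeval (Sum.elim (fun i => X (Sum.inl i)) (fun _ => C c) : XS n → MvPolynomial (HV n) A) (xpart P q)

lemma xpart_hom {A : Type*} [CommRing A] [Algebra ℂ A] (P : MvPolynomial (XS n) ℂ) (c : A) (q : ℕ) :
    (aeval (Sum.elim (fun i => X (Sum.inl i)) (fun _ => C c) : XS n → MvPolynomial (HV n) A)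
      (xpart P q)).IsHomogeneous q := by
  rw [aeval_def, eval₂_eq]
  refine IsHomogeneous.sum _ _ _ fun m hm => ?_
  have h1 : Finsupp.weight (wtx n) m = q :=
    weightedHomogeneousComponent_isWeightedHomogeneous q P (mem_support_iff.1 hm)
  have h2 : ∑ i : Fin n, m (Sum.inl i) = q := by
    rw [← h1, Finsupp.weight_apply, Finsupp.sum_fintype _ _ (by simp), Fintype.sum_sum_type]
    simp [wtx]
  have h3 : IsHomogeneous (∏ i ∈ m.support, (Sum.elim (fun i => X (Sum.inl i)) (fun _ => C c) :
      XS n → MvPolynomial (HV n) A) i ^ m i) q := by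
    have h5 : ∏ i ∈ m.support, (Sum.elim (fun i => X (Sum.inl i)) (fun _ => C c) :
      XS n → MvPolynomial (HV n) A) i ^ m i = ∏ i, (Sum.elim (fun i => X (Sum.inl i)) (fun _ => C c) :
      XS n → MvPolynomial (HV n) A) i ^ m i := by
      refine Finset.prod_subset (Finset.subset_univ _) fun i _ hi => ?_
      rw [Finsupp.notMem_support_iff.1 hi, pow_zero]
    rw [h5]
    have := IsHomogeneous.prod (Finset.univ : Finset (XS n)) (fun i => (Sum.elim (fun i => X (Sum.inl i)) (fun _ => C c) :
      XS n → MvPolynomial (HV n) A) i ^ m i) (fun i => wtx n i * m i) (by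
        intro i _
        rcases i with i | i
        · exact (isHomogeneous_X A _).pow _
        · exact (isHomogeneous_C _ c).pow _)
    convert this
    rw [Fintype.sum_sum_type]; simp [wtx, h2]
  have h4 := (isHomogeneous_C (HV n) (algebraMap ℂ A (coeff m (xpart P q)))).mul h3
  rw [zero_add] at h4
  exact h4

lemma HA_hom {A : Type*} [CommRing A] [Algebra ℂ A] (d : ℕ) (P : MvPolynomial (XS n) ℂ) (c : A) :
    (HA d P c).IsHomogeneous d := by
  refine IsHomogeneous.sum _ _ _ fun q hq => ?_
  have := ((isHomogeneous_X A (Sum.inr () : HV n)).pow (d-q)).mul (xpart_hom P c q)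
  convert this using 1
  have := Finset.mem_range.1 hq
  omega

lemma HA_map {A B : Type*} [CommRing A] [Algebra ℂ A] [CommRing B] [Algebra ℂ B] (f : A →ₐ[ℂ] B)
    (d : ℕ) (P : MvPolynomial (XS n) ℂ) (c : A) :
    MvPolynomial.map (f : A →+* B) (HA d P c) = HA d P (f c) := by
  simp only [HA, map_sum, map_mul, map_pow, map_X]
  refine Finset.sum_congr rfl fun q _ => ?_
  congr 1
  have h : ∀ p : MvPolynomial (XS n) ℂ, MvPolynomial.map (f : A →+* B)
      (aeval (Sum.elim (fun i => X (Sum.inl i)) (fun _ => C c) : XS n → MvPolynomial (HV n) A) p) =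
      aeval (Sum.elim (fun i => X (Sum.inl i)) (fun _ => C (f c)) : XS n → MvPolynomial (HV n) B) p := by
    intro p
    induction p using MvPolynomial.induction_on with
    | C a =>
      simp only [aeval_C]
      rw [IsScalarTower.algebraMap_apply ℂ A (MvPolynomial (HV n) A), MvPolynomial.algebraMap_eq, map_C,
        IsScalarTower.algebraMap_apply ℂ B (MvPolynomial (HV n) B), MvPolynomial.algebraMap_eq]
      simp
    | add p q hp hq => simp only [map_add, hp, hq]
    | mul_X p i hp =>
      rw [map_mul, map_mul, map_mul, hp, aeval_X, aeval_X]
      congr 1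
      rcases i with i | i <;> simp
  exact h _

/-- chain rule for substitutions -/
lemma chainP {σ τ : Type} [Fintype σ] (f : σ → MvPolynomial τ ℂ) (k : τ) (p : MvPolynomial σ ℂ) :
    pderiv k (aeval (R := ℂ) f p) = ∑ i, aeval (R := ℂ) f (pderiv i p) * pderiv k (f i) := by
  classical
  induction p using MvPolynomial.induction_on with
  | C c => simp [MvPolynomial.aeval_C, MvPolynomial.algebraMap_eq]
  | add p q hp hq => simp only [map_add, hp, hq, add_mul, Finset.sum_add_distrib]
  | mul_X p i hp =>
    simp only [map_mul, aeval_X, Derivation.leibniz, hp, pderiv_X, smul_eq_mul, map_add, add_mul,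
      Finset.sum_add_distrib, Finset.mul_sum]
    congr 1
    · rw [Finset.sum_eq_single i]
      · simp
      · intro b _ hb; simp [Pi.single_apply, hb.symm]
      · simp
    · exact Finset.sum_congr rfl fun j _ => by ring

lemma ker_sec {σ τ : Type} (π : MvPolynomial σ ℂ →ₐ[ℂ] MvPolynomial τ ℂ)
    (ρ : MvPolynomial τ ℂ →ₐ[ℂ] MvPolynomial σ ℂ) (h1 : ∀ i, π (ρ (X i)) = X i)
    (z : MvPolynomial σ ℂ) (hz : π z = 0) (h2 : ∀ i, X i - ρ (π (X i)) ∈ Ideal.span {z})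
    (I : Ideal (MvPolynomial σ ℂ)) :
    Function.Surjective π ∧ (I.map π).comap π = I ⊔ Ideal.span {z} := by
  have hs : ∀ y, π (ρ y) = y := by
    intro y
    have : (π.comp ρ) = AlgHom.id ℂ _ := by
      apply MvPolynomial.algHom_ext; intro i; simpa using h1 i
    exact DFunLike.congr_fun this y
  have hsurj : Function.Surjective π := fun y => ⟨_, hs y⟩
  refine ⟨hsurj, ?_⟩
  rw [Ideal.comap_map_of_surjective' _ hsurj]
  congr 1
  apply le_antisymm
  · intro x hx
    have hx0 : π x = 0 := hx
    have : ∀ x, x - ρ (π x) ∈ Ideal.span {z} := by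
      intro x
      induction x using MvPolynomial.induction_on with
      | C a =>
        have : ρ (π (C a)) = C a := by
          rw [← MvPolynomial.algebraMap_eq, AlgHom.commutes, AlgHom.commutes]
        rw [this, sub_self]; exact Ideal.zero_mem _
      | add p q hp hq =>
        have := Ideal.add_mem _ hp hq
        convert this using 1
        simp only [map_add]; ring
      | mul_X p i hp =>
        have := Ideal.add_mem _ (Ideal.mul_mem_left _ p (h2 i)) (Ideal.mul_mem_right (ρ (π (X i))) _ hp)
        convert this using 1
        simp only [map_mul]; ring
    have h3 := this x
    rwa [hx0, map_zero, sub_zero] at h3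
  · rw [Ideal.span_le]
    rintro _ rfl
    exact hz

/-- chart substitution -/
def piJ (j : Fin n) : MvPolynomial (HV n) ℂ →ₐ[ℂ] MvPolynomial (Fin n) ℂ :=
  aeval (Sum.elim (fun i => if i = j then 1 else X i) (fun _ => X j))

lemma chartEq_eq (d : ℕ) (P : MvPolynomial (XS n) ℂ) (j : Fin n) (s t : ℂ) :
    chartEq d P j s t = piJ j (Ft d (HA d P s) t) := by
  simp only [chartEq, FY, Ft, HA, map_sub, map_sum, map_mul, map_pow, x0]
  congr 1
  · refine Finset.sum_congr rfl fun q _ => ?_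
    congr 1
    · simp [piJ]
    · have h : ∀ p : MvPolynomial (XS n) ℂ,
          aeval (R := ℂ) (Sum.elim (fun i => if i = j then 1 else X i) ![X j, C s, C t] : TV n → MvPolynomial (Fin n) ℂ)
            (aeval embT p) = piJ j (aeval (Sum.elim (fun i => X (Sum.inl i)) (fun _ => C s) : XS n → MvPolynomial (HV n) ℂ) p) := by
        intro p
        induction p using MvPolynomial.induction_on with
        | C a => simp [piJ]
        | add p q hp hq => simp only [map_add, hp, hq]
        | mul_X p i hp =>
          simp only [map_mul, hp, aeval_X]
          congr 1
          rcases i with i | i <;> simp [piJ, embT, MvPolynomial.algebraMap_eq]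
      exact h _
  · simp [piJ, MvPolynomial.algebraMap_eq]

lemma pd_piJ_ne (j i : Fin n) (hij : i ≠ j) (F : MvPolynomial (HV n) ℂ) :
    pderiv i (piJ j F) = piJ j (pderiv (Sum.inl i) F) := by
  rw [piJ, chainP, Fintype.sum_sum_type, Finset.sum_eq_single i]
  · simp [hij, pderiv_X_of_ne hij.symm]
  · intro b _ hb
    simp only [Sum.elim_inl]
    split_ifs
    · simp
    · rw [pderiv_X_of_ne hb, mul_zero]
  · simp

lemma pd_piJ_self (j : Fin n) (F : MvPolynomial (HV n) ℂ) :
    pderiv j (piJ j F) = piJ j (pderiv (Sum.inr ()) F) := by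
  rw [piJ, chainP, Fintype.sum_sum_type, Finset.sum_eq_zero]
  · simp
  · intro b _
    simp only [Sum.elim_inl]
    split_ifs with h
    · simp
    · rw [pderiv_X_of_ne h, mul_zero]

lemma chart_ideal (F : MvPolynomial (HV n) ℂ) (j : Fin n) :
    Ideal.span (Set.range fun i => pderiv i (piJ j F)) =
      (KJ F j ⊔ Ideal.span {pderiv (Sum.inr ()) F}).map (piJ j) := by
  rw [Ideal.map_sup, KJ, Ideal.map_span, Ideal.map_span]
  apply le_antisymm
  · rw [Ideal.span_le]
    rintro _ ⟨i, rfl⟩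
    by_cases h : i = j
    · subst h
      simp only [pd_piJ_self]
      exact Ideal.mem_sup_right (Ideal.subset_span ⟨_, rfl, rfl⟩)
    · simp only [pd_piJ_ne j i h]
      exact Ideal.mem_sup_left (Ideal.subset_span ⟨_, ⟨⟨i, h⟩, rfl⟩, rfl⟩)
  · rw [sup_le_iff, Ideal.span_le, Ideal.span_le]
    constructor
    · rintro _ ⟨_, ⟨i, rfl⟩, rfl⟩
      rw [SetLike.mem_coe]
      refine Ideal.subset_span ⟨i.1, ?_⟩
      exact pd_piJ_ne j i.1 i.2 F
    · rintro _ ⟨_, rfl, rfl⟩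
      exact Ideal.subset_span ⟨j, pd_piJ_self j F⟩

lemma piJ_ker (j : Fin n) (I : Ideal (MvPolynomial (HV n) ℂ)) :
    Function.Surjective (piJ j) ∧ (I.map (piJ j)).comap (piJ j) = I ⊔ Ideal.span {X (Sum.inl j) - 1} := by
  refine ker_sec (piJ j) (aeval fun i => if i = j then X (Sum.inr ()) else X (Sum.inl i)) ?_ _ ?_ ?_ I
  · intro i
    rw [aeval_X]
    split_ifs with h
    · simp [piJ, h]
    · simp [piJ, h]
  · simp [piJ]
  · rintro (i | i)
    · by_cases h : i = j
      · subst h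
        have : (aeval fun k => if k = i then X (Sum.inr ()) else X (Sum.inl k) : MvPolynomial (Fin n) ℂ →ₐ[ℂ] MvPolynomial (HV n) ℂ)
          (piJ i (X (Sum.inl i))) = 1 := by simp [piJ]
        rw [this]; exact Ideal.subset_span rfl
      · have : (aeval fun k => if k = j then X (Sum.inr ()) else X (Sum.inl k) : MvPolynomial (Fin n) ℂ →ₐ[ℂ] MvPolynomial (HV n) ℂ)
          (piJ j (X (Sum.inl i))) = X (Sum.inl i) := by simp [piJ, h]
        rw [this, sub_self]; exact Ideal.zero_mem _
    · have : (aeval fun k => if k = j then X (Sum.inr ()) else X (Sum.inl k) : MvPolynomial (Fin n) ℂ →ₐ[ℂ] MvPolynomial (HV n) ℂ)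
          (piJ j (X (Sum.inr i))) = X (Sum.inr i) := by simp [piJ]
      rw [this, sub_self]; exact Ideal.zero_mem _

/-- the normalized representative of a point at infinity -/
def vP (p : PrjInf n) : HV n → ℂ := Sum.elim (fun i => p.rep i / p.rep (jp p)) (fun _ => 0)

lemma muP_eq (d : ℕ) (P : MvPolynomial (XS n) ℂ) (p : PrjInf n) (s t : ℂ)
    (hfin : FinAt (KJ (HA d P s) (jp p) ⊔ Ideal.span {X (Sum.inl (jp p)) - 1} ⊔
      Ideal.span {pderiv (Sum.inr ()) (Ft d (HA d P s) t)}) (vP p)) :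
    muP d P p s t = imu (KJ (HA d P s) (jp p) ⊔ Ideal.span {X (Sum.inl (jp p)) - 1} ⊔
      Ideal.span {pderiv (Sum.inr ()) (Ft d (HA d P s) t)}) (vP p) := by
  set F := Ft d (HA d P s) t with hF
  have hk := piJ_ker (jp p) (KJ F (jp p) ⊔ Ideal.span {pderiv (Sum.inr ()) F})
  rw [← chart_ideal, hF, KJ_Ft, sup_right_comm] at hk
  have hev : ∀ x, eval (chartPt p) (piJ (jp p) x) = eval (vP p) x := by
    intro x
    induction x using MvPolynomial.induction_on with
    | C a => simp [piJ]
    | add p' q hp hq => simp only [map_add, hp, hq]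
    | mul_X p' i hp =>
      simp only [map_mul, hp, eval_X]
      congr 1
      rcases i with i | i
      · by_cases h : i = jp p
        · subst h; simp [piJ, vP, div_self (jp_spec _)]
        · simp [piJ, vP, h, chartPt]
      · simp [piJ, vP, chartPt]
  rw [← hF] at hk
  rw [← hk.2] at hfin ⊢
  rw [TR_fin _ hk.1 hev] at hfin
  rw [TR_imu _ hk.1 hev, muP, chartEq_eq, C4 _ _ hfin]
end S4

section S5
variable {n : ℕ}

/-- dehomogenization -/
def pi0 (n : ℕ) : MvPolynomial (HV n) ℂ →ₐ[ℂ] MvPolynomial (Fin n) ℂ :=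
  aeval (Sum.elim X (fun _ => 1))

lemma eval_fsub (P : MvPolynomial (XS n) ℂ) (s : ℂ) (x : Fin n → ℂ) :
    eval x (aeval (R := ℂ) (Sum.elim X (fun _ => C s) : XS n → MvPolynomial (Fin n) ℂ) P) = eval (evA x s) P := by
  induction P using MvPolynomial.induction_on with
  | C a => simp
  | add p q hp hq => simp only [map_add, hp, hq]
  | mul_X p i hp =>
    simp only [map_mul, hp, aeval_X, eval_X]
    congr 1
    rcases i with i | i <;> simp [evA]

lemma eval_es (P : MvPolynomial (XS n) ℂ) (s : ℂ) (v : HV n → ℂ) :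
    eval v (aeval (R := ℂ) (Sum.elim (fun i => X (Sum.inl i)) (fun _ => C s) : XS n → MvPolynomial (HV n) ℂ) P) =
      eval (evA (fun i => v (Sum.inl i)) s) P := by
  induction P using MvPolynomial.induction_on with
  | C a => simp
  | add p q hp hq => simp only [map_add, hp, hq]
  | mul_X p i hp =>
    simp only [map_mul, hp, aeval_X, eval_X]
    congr 1
    rcases i with i | i <;> simp [evA]

lemma pi0_HA {d : ℕ} {P : MvPolynomial (XS n) ℂ} {s : ℂ} (h : DegXAt d P s) :
    pi0 n (HA d P s) = fS P s := by
  have h1 : pi0 n (HA d P s) = ∑ q ∈ Finset.range (d+1),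
      aeval (R := ℂ) (Sum.elim X (fun _ => C s) : XS n → MvPolynomial (Fin n) ℂ) (xpart P q) := by
    simp only [HA, map_sum, map_mul, map_pow]
    refine Finset.sum_congr rfl fun q _ => ?_
    have e1 : pi0 n (X (Sum.inr ())) = 1 := by simp [pi0]
    rw [e1, one_pow, one_mul]
    have h : ∀ p : MvPolynomial (XS n) ℂ, pi0 n (aeval (Sum.elim (fun i => X (Sum.inl i)) (fun _ => C s) : XS n → MvPolynomial (HV n) ℂ) p)
        = aeval (R := ℂ) (Sum.elim X (fun _ => C s) : XS n → MvPolynomial (Fin n) ℂ) p := by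
      intro p
      induction p using MvPolynomial.induction_on with
      | C a => simp [pi0]
      | add p q hp hq => simp only [map_add, hp, hq]
      | mul_X p i hp =>
        simp only [map_mul, hp, aeval_X]
        congr 1
        rcases i with i | i <;> simp [pi0, MvPolynomial.algebraMap_eq]
    exact h _
  have hfin := weightedHomogeneousComponent_finsupp (w := wtx n) P
  have h2 : P = ∑ q ∈ (Finset.range (d+1) ∪ hfin.toFinset), xpart P q := by
    conv_lhs => rw [← sum_weightedHomogeneousComponent (wtx n) P]
    rw [finsum_eq_sum_of_support_subset]
    · rfl
    · intro q hq
      simp only [Finset.coe_union, Set.mem_union]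
      right
      exact hfin.mem_toFinset.2 hq
  rw [h1, fS]
  conv_rhs => rw [h2, map_sum]
  apply Finset.sum_subset Finset.subset_union_left
  intro q _ hq
  apply MvPolynomial.funext
  intro x
  rw [eval_fsub, map_zero]
  exact h.1 q (by simpa using hq) x

lemma pd_pi0 (i : Fin n) (F : MvPolynomial (HV n) ℂ) :
    pderiv i (pi0 n F) = pi0 n (pderiv (Sum.inl i) F) := by
  rw [pi0, chainP, Fintype.sum_sum_type, Finset.sum_eq_single i]
  · simp
  · intro b _ hb
    simp [pderiv_X_of_ne hb]
  · simp

lemma pi0_ker (I : Ideal (MvPolynomial (HV n) ℂ)) :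
    Function.Surjective (pi0 n) ∧ (I.map (pi0 n)).comap (pi0 n) = I ⊔ Ideal.span {X (Sum.inr ()) - 1} := by
  refine ker_sec (pi0 n) (aeval fun i => X (Sum.inl i)) ?_ _ ?_ ?_ I
  · intro i; simp [pi0]
  · simp [pi0]
  · rintro (i | i)
    · have : (aeval (R := ℂ) fun k : Fin n => (X (Sum.inl k) : MvPolynomial (HV n) ℂ))
          (pi0 n (X (Sum.inl i))) = X (Sum.inl i) := by simp [pi0]
      rw [this, sub_self]; exact Ideal.zero_mem _
    · have : (aeval (R := ℂ) fun k : Fin n => (X (Sum.inl k) : MvPolynomial (HV n) ℂ))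
          (pi0 n (X (Sum.inr i))) = 1 := by simp [pi0]
      rw [this]; exact Ideal.subset_span rfl

/-- the affine point `(x,1)` -/
def aff (x : Fin n → ℂ) : HV n → ℂ := Sum.elim x (fun _ => 1)
/-- the point `(x,0)` -/
def inf (x : Fin n → ℂ) : HV n → ℂ := Sum.elim x (fun _ => 0)

lemma eval_pi0 (x : Fin n → ℂ) (F : MvPolynomial (HV n) ℂ) : eval x (pi0 n F) = eval (aff x) F := by
  induction F using MvPolynomial.induction_on with
  | C a => simp [pi0]
  | add p q hp hq => simp only [map_add, hp, hq]
  | mul_X p i hp =>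
    simp only [map_mul, hp, eval_X]
    congr 1
    rcases i with i | i <;> simp [pi0, aff]

lemma eval_pd_fS (P : MvPolynomial (XS n) ℂ) (s : ℂ) (x : Fin n → ℂ) (i : Fin n) :
    eval x (pderiv i (fS P s)) = eval (evA x s) (pderiv (Sum.inl i) P) := by
  rw [← eval_fsub, fS, chainP, Fintype.sum_sum_type, Finset.sum_eq_single i]
  · simp
  · intro b _ hb
    simp [pderiv_X_of_ne hb]
  · simp

lemma eval_aff {d : ℕ} {P : MvPolynomial (XS n) ℂ} {s : ℂ} (h : DegXAt d P s) (x : Fin n → ℂ) (i : Fin n) :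
    eval (aff x) (pderiv (Sum.inl i) (HA d P s)) = eval (evA x s) (pderiv (Sum.inl i) P) := by
  rw [← eval_pi0, ← pd_pi0, pi0_HA h, eval_pd_fS]

/-- the affine total Milnor number as a sum -/
lemma muTot_eq {d : ℕ} {P : MvPolynomial (XS n) ℂ} {s : ℂ} (h : DegXAt d P s)
    (Cr : Finset (Fin n → ℂ)) (hCr : ∀ x, CritPt P x s → x ∈ Cr) :
    muTot P s = ∑ x ∈ Cr, imu (KA (HA d P s) ⊔ Ideal.span {X (Sum.inr ()) - 1}) (aff x) := by
  have hz : ∀ x, (∀ g ∈ Ideal.span (Set.range fun i => pderiv i (fS P s)), eval x g = 0) → x ∈ Cr := by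
    intro x hx
    apply hCr
    intro i
    rw [← eval_pd_fS]
    exact hx _ (Ideal.subset_span ⟨i, rfl⟩)
  have hf := finite_of_zeros (I := Ideal.span (Set.range fun i => pderiv i (fS P s)))
    (Cr.finite_toSet.subset fun x hx => hz x hx)
  have hmap : Ideal.span (Set.range fun i => pderiv i (fS P s)) = (KA (HA d P s)).map (pi0 n) := by
    rw [KA, Ideal.map_span]
    congr 1
    rw [← Set.range_comp]
    congr 1
    funext i
    rw [← pi0_HA h, pd_pi0]; rfl
  rw [muTot, SUM hf Cr hz]
  refine Finset.sum_congr rfl fun x _ => ?_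
  have hk := pi0_ker (KA (HA d P s))
  rw [← hk.2, hmap]
  exact (TR_imu _ hk.1 (eval_pi0 x) _).symm

lemma eval_inf (d : ℕ) (P : MvPolynomial (XS n) ℂ) (s : ℂ) (x : Fin n → ℂ) (i : Fin n) :
    eval (inf x) (pderiv (Sum.inl i) (HA d P s)) = eval (evA x s) (pderiv (Sum.inl i) (xpart P d)) := by
  have h1 : ∀ q, pderiv (Sum.inl i) ((X (Sum.inr ()))^(d-q) *
    aeval (R := ℂ) (Sum.elim (fun i => X (Sum.inl i)) (fun _ => C s) : XS n → MvPolynomial (HV n) ℂ) (xpart P q)) =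
    (X (Sum.inr ()))^(d-q) *
    aeval (R := ℂ) (Sum.elim (fun i => X (Sum.inl i)) (fun _ => C s) : XS n → MvPolynomial (HV n) ℂ)
      (pderiv (Sum.inl i) (xpart P q)) := by
    intro q
    rw [pderiv_mul, pderiv_pow, pderiv_X_of_ne (by simp), mul_zero, zero_mul, zero_add, chainP,
      Fintype.sum_sum_type, Finset.sum_eq_single i]
    · simp
    · intro b _ hb
      simp only [Sum.elim_inl]
      rw [pderiv_X_of_ne (by simpa using hb), mul_zero]
    · simp
  rw [HA, map_sum, map_sum, Finset.sum_eq_single d]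
  · rw [h1, map_mul, eval_es]; simp [inf]
  · intro q hq hqd
    rw [h1, map_mul, map_pow, eval_X]
    have : d - q ≠ 0 := by have := Finset.mem_range.1 hq; omega
    simp [inf, this]
  · simp

lemma eval_inf0 {d : ℕ} (hd : 2 ≤ d) (P : MvPolynomial (XS n) ℂ) (s t : ℂ) (x : Fin n → ℂ) :
    eval (inf x) (pderiv (Sum.inr ()) (Ft d (HA d P s) t)) = eval (evA x s) (xpart P (d-1)) := by
  have h1 : ∀ q, pderiv (Sum.inr ()) ((X (Sum.inr ()))^(d-q) *
    aeval (R := ℂ) (Sum.elim (fun i => X (Sum.inl i)) (fun _ => C s) : XS n → MvPolynomial (HV n) ℂ) (xpart P q)) =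
    ((d-q : ℕ) : MvPolynomial (HV n) ℂ) * (X (Sum.inr ()))^(d-q-1) *
    aeval (R := ℂ) (Sum.elim (fun i => X (Sum.inl i)) (fun _ => C s) : XS n → MvPolynomial (HV n) ℂ) (xpart P q) := by
    intro q
    rw [pderiv_mul, pderiv_pow, pderiv_X_self, mul_one, chainP,
      Fintype.sum_sum_type, Finset.sum_eq_zero]
    · simp
    · intro b _
      simp only [Sum.elim_inl]
      rw [pderiv_X_of_ne (by simp), mul_zero]
  rw [Ft, map_sub, map_sub, pderiv_C_mul, x0, pderiv_pow, pderiv_X_self, HA, map_sum, map_sum,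
    Finset.sum_eq_single (d-1)]
  · rw [h1, map_mul, map_mul, eval_es, show d - (d-1) = 1 by omega]
    have : d - 1 ≠ 0 := by omega
    simp [inf, this]
  · intro q hq hqd
    rw [h1]
    have hq := Finset.mem_range.1 hq
    by_cases h : q = d
    · subst h; simp
    · have : d - q - 1 ≠ 0 := by omega
      simp [inf, this]
  · intro h; exact absurd (Finset.mem_range.2 (by omega)) h
end S5

section S6
variable {n : ℕ}

/-- the value of the linear form -/
def ldot {σ : Type*} [Fintype σ] (l x : σ → ℂ) : ℂ := ∑ i, l i * x i

/-- representative of `p` on the affine hyperplane `l = 1` -/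
def vl (l : Fin n → ℂ) (p : PrjInf n) : HV n → ℂ := inf (fun i => p.rep i / ldot l p.rep)

lemma eval_hom_smul {σ : Type*} {F : MvPolynomial σ ℂ} {m : ℕ} (hF : F.IsHomogeneous m) (c : ℂ) (v : σ → ℂ) :
    eval (fun i => c * v i) F = c ^ m * eval v F := by
  rw [eval_eq, eval_eq, Finset.mul_sum]
  refine Finset.sum_congr rfl fun q hq => ?_
  have h1 : Finsupp.degree q = m := by
    by_contra h
    exact (mem_support_iff.mp hq) (hF.coeff_eq_zero h)
  simp only [mul_pow, Finset.prod_mul_distrib, Finset.prod_pow_eq_pow_sum]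
  have h2 : ∑ i ∈ q.support, q i = m := by rw [← h1]; rfl
  rw [h2]; ring

lemma point {d : ℕ} (hn : 2 ≤ n) (hd : 2 ≤ d) (P : MvPolynomial (XS n) ℂ) (s : ℂ) (l : Fin n → ℂ)
    (hl : ∀ i, l i ≠ 0) (k0 : Fin n) (p : PrjInf n) (hp : p ∈ Wset d P s) (hlp : ldot l p.rep ≠ 0)
    (hA : FinAt (DI (HA d P s) l k0 ⊔ Ideal.span {lin (lf l) - 1} ⊔ Ideal.span {x0 n}) (vl l p))
    (hB : FinAt (KA (HA d P s) ⊔ Ideal.span {lin (lf l) - 1}) (vl l p)) :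
    ∃ (G : ℕ) (Z : Finset ℂ),
      (∀ t, FinAt (DI (HA d P s) l k0 ⊔ Ideal.span {lin (lf l) - 1} ⊔ Ideal.span {Ft d (HA d P s) t}) (vl l p)) ∧
      (∀ t, G ≤ imu (DI (HA d P s) l k0 ⊔ Ideal.span {lin (lf l) - 1} ⊔ Ideal.span {Ft d (HA d P s) t}) (vl l p)) ∧
      (∀ t ∉ Z, imu (DI (HA d P s) l k0 ⊔ Ideal.span {lin (lf l) - 1} ⊔ Ideal.span {Ft d (HA d P s) t}) (vl l p) = G) ∧
      (∑ᶠ t : ℂ, lamP d P p t s) + G = imu (KA (HA d P s) ⊔ Ideal.span {lin (lf l) - 1}) (vl l p) ∧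
      (p ∉ Sigset d P s → ∑ᶠ t : ℂ, lamP d P p t s = 0) := by
  set H := HA d P s with hH
  have hHh : H.IsHomogeneous d := HA_hom d P s
  obtain ⟨G, Z, h1, h2, h3, h4⟩ := four_b H hHh l k0 (hl k0) (vl l p) rfl hA hB
  refine ⟨G, Z, h1, h2, h3, ?_⟩
  set j := jp p with hj
  have hpj : p.rep j ≠ 0 := jp_spec p
  obtain ⟨k, hk⟩ : ∃ k : Fin n, j ≠ k := by
    haveI : Nontrivial (Fin n) := Fin.nontrivial_iff_two_le.mpr hn
    obtain ⟨k, hk⟩ := exists_ne j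
    exact ⟨k, hk.symm⟩
  have hDI : DI H l k0 = DI H l k := DI_eq H l k0 k (hl k0) (hl k)
  have hvc : vP p = fun i => (ldot l p.rep / p.rep j) * vl l p i := by
    funext i
    rcases i with i | i
    · simp only [vP, vl, inf, Sum.elim_inl]
      rw [← hj]
      field_simp
    · simp [vP, vl, inf]
  have hlv : ∑ i, l i * vl l p (Sum.inl i) = 1 := by
    simp only [vl, inf, Sum.elim_inl]
    simp_rw [mul_div_assoc']
    rw [← Finset.sum_div]
    exact div_self hlp
  have hvP : vP p = inf (fun i => (p.rep j)⁻¹ * p.rep i) := by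
    funext i
    rcases i with i | i
    · simp only [vP, inf, Sum.elim_inl]; rw [div_eq_inv_mul]
    · simp [vP, inf]
  have hvP' : vP p = fun i => (p.rep j)⁻¹ * inf p.rep i := by
    rw [hvP]; funext i; rcases i with i | i <;> simp [inf]
  have hW : ∀ i, eval (vP p) (pderiv (Sum.inl i) H) = 0 := by
    intro i
    rw [hvP', eval_hom_smul (hHh.pderiv), eval_inf, hp i, mul_zero]
  have hvj : vP p (Sum.inl j) = 1 := by simp only [vP, Sum.elim_inl]; exact div_self hpj
  have hc0 : ldot l p.rep / p.rep j ≠ 0 := div_ne_zero hlp hpj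
  have key : ∀ t, _ := fun t => infinity (by omega) H hHh l j k hk (hl k) (vl l p) (vP p) rfl hlv _ hc0 hvc hvj hW t
    (by rw [← hDI]; exact h1 t)
  rw [← hDI] at key
  set c1 := imu (KJ H j ⊔ Ideal.span {X (Sum.inl j) - 1} ⊔ Ideal.span {x0 n}) (vP p) with hc1
  set ν : ℂ → ℕ := fun t => imu (DI H l k0 ⊔ Ideal.span {lin (lf l) - 1} ⊔ Ideal.span {Ft d H t}) (vl l p) with hν
  have hmu : ∀ t, ν t = c1 + muP d P p s t := by
    intro t
    rw [muP_eq d P p s t (key t).1]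
    exact (key t).2
  have hνG : ∀ t, G ≤ ν t := h2
  have hνZ : ∀ t ∉ Z, ν t = G := h3
  obtain ⟨t1, ht1⟩ := Infinite.exists_notMem_finset Z
  have hgen : muGen d P p s = muP d P p s t1 := by
    apply le_antisymm
    · exact Nat.sInf_le ⟨t1, rfl⟩
    · refine le_csInf ⟨_, t1, rfl⟩ ?_
      rintro _ ⟨t, rfl⟩
      have a1 := hmu t
      have a2 := hmu t1
      have a3 := hνG t
      have a4 := hνZ t1 ht1
      omega
  have hlam : ∀ t, lamP d P p t s = ν t - G := by
    intro t
    unfold lamP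
    rw [hgen]
    have a1 := hmu t
    have a2 := hmu t1
    have a4 := hνZ t1 ht1
    omega
  constructor
  · rw [← h4]
    congr 1
    rw [finsum_eq_sum_of_support_subset (s := Z)]
    · exact Finset.sum_congr rfl fun t _ => hlam t
    · intro t ht
      by_contra hz
      apply ht
      show lamP d P p t s = 0
      rw [hlam, hνZ t hz, Nat.sub_self]
  · intro hns
    have hz : ∀ t, muP d P p s t = 0 := by
      intro t
      rw [muP_eq d P p s t (key t).1]
      refine imu_eq_zero (g := pderiv (Sum.inr ()) (Ft d H t))
        (Ideal.mem_sup_right (Ideal.subset_span rfl)) ?_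
      have hFh : (Ft d H t).IsHomogeneous d := Ft_hom hHh t
      rw [hvP', eval_hom_smul hFh.pderiv, eval_inf0 hd]
      refine mul_ne_zero (pow_ne_zero _ (inv_ne_zero hpj)) ?_
      intro h0
      exact hns ⟨hp, h0⟩
    have : ∀ t, lamP d P p t s = 0 := fun t => by unfold lamP; rw [hz t]; omega
    simp [this]
end S6

section S7
variable {n : ℕ}

/-- normalization of a vector with respect to a linear form -/
def nrm {σ : Type*} [Fintype σ] (L w : σ → ℂ) : σ → ℂ := fun i => (ldot L w)⁻¹ * w i

lemma nrm_one {σ : Type*} [Fintype σ] (L w : σ → ℂ) (h : ldot L w ≠ 0) : ∑ i, L i * nrm L w i = 1 := by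
  have : ∑ i, L i * nrm L w i = (ldot L w)⁻¹ * ldot L w := by
    rw [ldot, Finset.mul_sum]
    exact Finset.sum_congr rfl fun i _ => by simp only [nrm, ldot]; ring
  rw [this, inv_mul_cancel₀ h]

lemma ldot_smul {σ : Type*} [Fintype σ] (L w : σ → ℂ) (a : ℂ) : ldot L (fun i => a * w i) = a * ldot L w := by
  rw [ldot, ldot, Finset.mul_sum]
  exact Finset.sum_congr rfl fun i _ => by ring

lemma nrm_smul {σ : Type*} [Fintype σ] (L v : σ → ℂ) (a : ℂ) (ha : a ≠ 0) (h : ldot L v = 1) :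
    nrm L (fun i => a * v i) = v := by
  funext i
  simp only [nrm, ldot_smul, h]
  field_simp

lemma ldot_lf_inf (l x : Fin n → ℂ) : ldot (lf l) (inf x) = ldot l x := by
  simp [ldot, lf, inf, Fintype.sum_sum_type]

lemma lf_inr (l : Fin n → ℂ) (v : HV n → ℂ) : ∑ i, lf l i * v i = ∑ i, l i * v (Sum.inl i) := by
  simp [lf, Fintype.sum_sum_type]

lemma vl_eq (l : Fin n → ℂ) (p : PrjInf n) : vl l p = nrm (lf l) (inf p.rep) := by
  funext i
  simp only [vl, nrm, ldot_lf_inf]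
  rcases i with i | i
  · simp only [inf, Sum.elim_inl]; rw [div_eq_inv_mul]
  · simp [inf]

lemma rep_ne (p : PrjInf n) : inf p.rep ≠ 0 := by
  intro h
  apply p.rep_nonzero
  funext i
  exact congrFun h (Sum.inl i)

lemma inf_smul (a : ℂ) (x : Fin n → ℂ) : inf (fun i => a * x i) = fun i => a * inf x i := by
  funext i; rcases i with i | i <;> simp [inf]

/-- points at infinity of the gradient cone come from `W` -/
lemma exists_W {d : ℕ} {P : MvPolynomial (XS n) ℂ} {s : ℂ} (v : HV n → ℂ) (hv : v ≠ 0) (h0 : v (Sum.inr ()) = 0)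
    (hz : ∀ i, eval v (pderiv (Sum.inl i) (HA d P s)) = 0) :
    ∃ p ∈ Wset d P s, ∃ a : ℂ, a ≠ 0 ∧ inf p.rep = fun i => a * v i := by
  set x : Fin n → ℂ := fun i => v (Sum.inl i) with hx
  have hvx : v = inf x := by
    funext i; rcases i with i | i
    · rfl
    · cases i; simp [inf, h0]
  have hx0 : x ≠ 0 := by
    intro h; apply hv; rw [hvx, h]; funext i; rcases i with i | i <;> simp [inf]
  obtain ⟨a, ha⟩ := Projectivization.exists_smul_eq_mk_rep ℂ x hx0
  have hr : (Projectivization.mk ℂ x hx0).rep = fun i => (a : ℂ) * x i := by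
    rw [← ha]; funext i; simp [Units.smul_def]
  refine ⟨Projectivization.mk ℂ x hx0, ?_, a, a.ne_zero, ?_⟩
  · intro i
    rw [← eval_inf, hr, inf_smul, eval_hom_smul (HA_hom d P s).pderiv, ← hvx, hz i, mul_zero]
  · rw [hr, inf_smul, ← hvx]

lemma W_grad {d : ℕ} {P : MvPolynomial (XS n) ℂ} {s : ℂ} {p : PrjInf n} (hp : p ∈ Wset d P s) (i : Fin n) :
    eval (inf p.rep) (pderiv (Sum.inl i) (HA d P s)) = 0 := by
  rw [eval_inf]; exact hp i

lemma nrm_inj (L : HV n → ℂ) {p q : PrjInf n} (hp : ldot L (inf p.rep) ≠ 0) (hq : ldot L (inf q.rep) ≠ 0)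
    (h : nrm L (inf p.rep) = nrm L (inf q.rep)) : p = q := by
  rw [← p.mk_rep, ← q.mk_rep, Projectivization.mk_eq_mk_iff']
  refine ⟨ldot L (inf p.rep) * (ldot L (inf q.rep))⁻¹, ?_⟩
  funext i
  have := congrFun h (Sum.inl i)
  simp only [nrm, inf, Sum.elim_inl] at this
  simp only [Pi.smul_apply, smul_eq_mul]
  rw [mul_assoc]
  simp only [inf] at hp ⊢
  rw [← this, mul_inv_cancel_left₀ hp]

lemma lin_single_inr : lin (Pi.single (Sum.inr () : Fin n ⊕ Unit) (1:ℂ)) = X (Sum.inr ()) := by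
  rw [lin, Finset.sum_eq_single (Sum.inr ())]
  · simp
  · intro b _ hb; simp [Pi.single_apply, hb]
  · simp

theorem package {d : ℕ} (hn : 2 ≤ n) (hd : 2 ≤ d) (P : MvPolynomial (XS n) ℂ) (s : ℂ) (hdeg : DegXAt d P s)
    (hcr : {x : Fin n → ℂ | CritPt P x s}.Finite) (l : Fin n → ℂ)
    (hl : ∀ i, l i ≠ 0) (k0 : Fin n) (L : HV n → ℂ)
    (ha : Module.Finite ℂ (MvPolynomial (HV n) ℂ ⧸ (KA (HA d P s) ⊔ Ideal.span {lin L - 1})))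
    (hb : ∀ v : HV n → ℂ, v ≠ 0 → (∀ i, eval v (pderiv (Sum.inl i) (HA d P s)) = 0) → ldot L v ≠ 0)
    (hc : Module.Finite ℂ (MvPolynomial (HV n) ℂ ⧸
      (DI (HA d P s) l k0 ⊔ Ideal.span {lin (lf l) - 1} ⊔ Ideal.span {x0 n})))
    (hdd : ∀ x : Fin n → ℂ, x ≠ 0 → (∀ i, eval (inf x) (pderiv (Sum.inl i) (HA d P s)) = 0) → ldot l x ≠ 0) :
    ∃ (W : Finset (PrjInf n)) (G : PrjInf n → ℕ) (Z : PrjInf n → Finset ℂ),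
      (∀ p, p ∈ W ↔ p ∈ Wset d P s) ∧
      (∀ p ∈ W, ∀ t, FinAt (DI (HA d P s) l k0 ⊔ Ideal.span {lin (lf l) - 1} ⊔ Ideal.span {Ft d (HA d P s) t}) (vl l p)) ∧
      (∀ p ∈ W, ∀ t, G p ≤ imu (DI (HA d P s) l k0 ⊔ Ideal.span {lin (lf l) - 1} ⊔ Ideal.span {Ft d (HA d P s) t}) (vl l p)) ∧
      (∀ p ∈ W, ∀ t ∉ Z p, imu (DI (HA d P s) l k0 ⊔ Ideal.span {lin (lf l) - 1} ⊔ Ideal.span {Ft d (HA d P s) t}) (vl l p) = G p) ∧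
      Module.finrank ℂ (MvPolynomial (HV n) ℂ ⧸ (KA (HA d P s) ⊔ Ideal.span {lin L - 1})) =
        muTot P s + lamTot d P s + ∑ p ∈ W, G p := by
  classical
  set H := HA d P s with hH
  have hHh : H.IsHomogeneous d := HA_hom d P s
  set I := KA H ⊔ Ideal.span {lin L - 1} with hI
  have hzero : ∀ v, (∀ i, eval v (pderiv (Sum.inl i) H) = 0) → ∑ i, L i * v i = 1 → ∀ g ∈ I, eval v g = 0 := by
    intro v h1 h2 g hg
    have : I ≤ RingHom.ker (eval v) := by
      rw [hI, KA]
      refine sup_le (Ideal.span_le.2 ?_) (Ideal.span_le.2 ?_)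
      · rintro _ ⟨i, rfl⟩; exact h1 i
      · rintro _ rfl
        simp [RingHom.mem_ker, h2]
    exact this hg
  have hzero' : ∀ v, (∀ g ∈ I, eval v g = 0) → (∀ i, eval v (pderiv (Sum.inl i) H) = 0) ∧ ∑ i, L i * v i = 1 := by
    intro v hv
    refine ⟨fun i => hv _ (Ideal.mem_sup_left (Ideal.subset_span ⟨i, rfl⟩)), ?_⟩
    have := hv _ (Ideal.mem_sup_right (Ideal.subset_span rfl))
    simpa [sub_eq_zero] using this
  have hLp : ∀ p ∈ Wset d P s, ldot L (inf p.rep) ≠ 0 := fun p hp => hb _ (rep_ne p) (W_grad hp)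
  have hlp : ∀ p ∈ Wset d P s, ldot l p.rep ≠ 0 := fun p hp => hdd _ p.rep_nonzero (W_grad hp)
  have hWfin : (Wset d P s).Finite := by
    refine Set.Finite.of_finite_image (f := fun p : PrjInf n => nrm L (inf p.rep)) ?_ ?_
    · refine (zeros_finite ha).subset ?_
      rintro _ ⟨p, hp, rfl⟩
      refine hzero _ ?_ (nrm_one _ _ (hLp p hp))
      intro i
      show eval (fun j => (ldot L (inf p.rep))⁻¹ * inf p.rep j) _ = 0
      rw [eval_hom_smul hHh.pderiv, W_grad hp, mul_zero]
    · intro p hp q hq h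
      exact nrm_inj L (hLp p hp) (hLp q hq) h
  have hcrL : ∀ x, CritPt P x s → ldot L (aff x) ≠ 0 := by
    intro x hx
    refine hb _ ?_ ?_
    · intro h; simpa [aff] using congrFun h (Sum.inr ())
    · intro i; rw [hH, eval_aff hdeg]; exact hx i
  have hcard : Fintype.card (Fin n) + 1 = Fintype.card (Fin n ⊕ Unit) := by simp
  have hgh : ∀ i : Fin n, ∃ m, (pderiv (Sum.inl i : Fin n ⊕ Unit) H).IsHomogeneous m := fun i => ⟨_, hHh.pderiv⟩
  have hWc : ∀ p ∈ Wset d P s, FinAt (KA H ⊔ Ideal.span {lin (lf l) - 1}) (vl l p) ∧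
      imu (KA H ⊔ Ideal.span {lin (lf l) - 1}) (vl l p) = imu I (nrm L (inf p.rep)) := by
    intro p hp
    have h1 := hLp p hp
    have h2 := hlp p hp
    rw [← ldot_lf_inf] at h2
    refine changeL (fun i : Fin n => pderiv (Sum.inl i : Fin n ⊕ Unit) H) hcard hgh L (lf l)
      (nrm L (inf p.rep)) (vl l p) ((ldot (lf l) (inf p.rep))⁻¹ * ldot L (inf p.rep))
      (mul_ne_zero (inv_ne_zero h2) h1) ?_ (nrm_one _ _ h1) ?_ (finAt_of_finite ha _)
    · rw [vl_eq]; funext i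
      simp only [nrm]
      rw [mul_assoc, mul_inv_cancel_left₀ h1]
    · rw [vl_eq]; exact nrm_one _ _ h2
  have hCc : ∀ x, CritPt P x s → imu (KA H ⊔ Ideal.span {X (Sum.inr ()) - 1}) (aff x) = imu I (nrm L (aff x)) := by
    intro x hx
    have h1 := hcrL x hx
    have := (changeL (fun i : Fin n => pderiv (Sum.inl i : Fin n ⊕ Unit) H) hcard hgh L
      (Pi.single (Sum.inr () : Fin n ⊕ Unit) (1:ℂ)) (nrm L (aff x)) (aff x) (ldot L (aff x)) h1
      (by funext i; simp only [nrm]; rw [mul_inv_cancel_left₀ h1]) (nrm_one _ _ h1)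
      (by simp [Pi.single_apply, aff]) (finAt_of_finite ha _)).2
    rw [lin_single_inr] at this
    exact this
  have hpt : ∀ p, ∃ (G : ℕ) (Z : Finset ℂ), p ∈ Wset d P s →
      (∀ t, FinAt (DI H l k0 ⊔ Ideal.span {lin (lf l) - 1} ⊔ Ideal.span {Ft d H t}) (vl l p)) ∧
      (∀ t, G ≤ imu (DI H l k0 ⊔ Ideal.span {lin (lf l) - 1} ⊔ Ideal.span {Ft d H t}) (vl l p)) ∧
      (∀ t ∉ Z, imu (DI H l k0 ⊔ Ideal.span {lin (lf l) - 1} ⊔ Ideal.span {Ft d H t}) (vl l p) = G) ∧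
      (∑ᶠ t : ℂ, lamP d P p t s) + G = imu (KA H ⊔ Ideal.span {lin (lf l) - 1}) (vl l p) ∧
      (p ∉ Sigset d P s → ∑ᶠ t : ℂ, lamP d P p t s = 0) := by
    intro p
    by_cases hp : p ∈ Wset d P s
    · obtain ⟨G, Z, h⟩ := point hn hd P s l hl k0 p hp (hlp p hp) (finAt_of_finite hc _) (hWc p hp).1
      exact ⟨G, Z, fun _ => h⟩
    · exact ⟨0, ∅, fun h => absurd h hp⟩
  choose G Z hGZ using hpt
  have hWm : ∀ p, p ∈ hWfin.toFinset ↔ p ∈ Wset d P s := fun p => hWfin.mem_toFinset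
  refine ⟨hWfin.toFinset, G, Z, hWm, fun p hp => (hGZ p ((hWm p).1 hp)).1,
    fun p hp => (hGZ p ((hWm p).1 hp)).2.1, fun p hp => (hGZ p ((hWm p).1 hp)).2.2.1, ?_⟩
  set W := hWfin.toFinset with hW
  set Cr := hcr.toFinset with hCr
  have hCrm : ∀ x, x ∈ Cr ↔ CritPt P x s := fun x => hcr.mem_toFinset
  have hlam : lamTot d P s = ∑ p ∈ W, ∑ᶠ t : ℂ, lamP d P p t s := by
    unfold lamTot
    rw [finsum_mem_def, finsum_eq_sum_of_support_subset (s := W)]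
    · refine Finset.sum_congr rfl fun p hp => ?_
      by_cases h : p ∈ Sigset d P s
      · simp [h]
      · rw [Set.indicator_of_notMem h, (hGZ p ((hWm p).1 hp)).2.2.2.2 h]
    · intro p hp
      have : p ∈ Sigset d P s := by
        by_contra h
        exact hp (Set.indicator_of_notMem h _)
      exact (hWm p).2 this.1
  have hmu := muTot_eq hdeg Cr (fun x hx => (hCrm x).2 hx)
  have hsum := SUM ha (Cr.image (fun x => nrm L (aff x)) ∪ W.image (fun p => nrm L (inf p.rep))) (by
    intro v hv
    obtain ⟨h1, h2⟩ := hzero' v hv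
    have hv0 : v ≠ 0 := by rintro rfl; simp at h2
    rw [Finset.mem_union, Finset.mem_image, Finset.mem_image]
    by_cases h0 : v (Sum.inr ()) = 0
    · right
      obtain ⟨p, hp, a, ha0, hpa⟩ := exists_W v hv0 h0 h1
      exact ⟨p, (hWm p).2 hp, by rw [hpa]; exact nrm_smul L v a ha0 h2⟩
    · left
      have hx : aff (fun i => (v (Sum.inr ()))⁻¹ * v (Sum.inl i)) = fun i => (v (Sum.inr ()))⁻¹ * v i := by
        funext i; rcases i with i | i
        · rfl
        · cases i; simp [aff, h0]
      refine ⟨fun i => (v (Sum.inr ()))⁻¹ * v (Sum.inl i), ?_, ?_⟩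
      · rw [hCrm]
        intro i
        rw [← eval_aff hdeg, hx, eval_hom_smul (HA_hom d P s).pderiv, h1 i, mul_zero]
      · rw [hx]; exact nrm_smul L v _ (inv_ne_zero h0) h2)
  rw [hsum, Finset.sum_union, Finset.sum_image, Finset.sum_image, hmu, hlam, add_assoc, ← Finset.sum_add_distrib]
  · congr 1
    · exact Finset.sum_congr rfl fun x hx => (hCc x ((hCrm x).1 hx)).symm
    · refine Finset.sum_congr rfl fun p hp => ?_
      rw [(hGZ p ((hWm p).1 hp)).2.2.2.1, (hWc p ((hWm p).1 hp)).2]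
  · intro p hp q hq h
    exact nrm_inj L (hLp p ((hWm p).1 hp)) (hLp q ((hWm q).1 hq)) h
  · intro x hx y hy h
    have h1 := congrFun h (Sum.inr ())
    simp only [nrm, aff, Sum.elim_inr, mul_one] at h1
    funext i
    have h2 := congrFun h (Sum.inl i)
    have h3 := hcrL x ((hCrm x).1 hx)
    simp only [nrm, aff, Sum.elim_inl] at h2 h3
    rw [← h1] at h2
    exact mul_left_cancel₀ (inv_ne_zero h3) h2
  · rw [Finset.disjoint_left]
    intro v h1 h2
    obtain ⟨x, hx, rfl⟩ := Finset.mem_image.1 h1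
    obtain ⟨p, hp, h⟩ := Finset.mem_image.1 h2
    have h1 := congrFun h (Sum.inr ())
    have h3 := hcrL x ((hCrm x).1 hx)
    simp only [nrm, inf, Sum.elim_inr, mul_zero, aff, mul_one] at h1
    exact inv_ne_zero h3 h1.symm
end S7

section S8
variable {n : ℕ}

section gen
variable {σ ι : Type} [Fintype σ] [Fintype ι]

lemma spec_hom {A : MvPolynomial σ (Polynomial ℂ)} {m : ℕ} (hA : A.IsHomogeneous m) (c : ℂ) :
    (spec c A).IsHomogeneous m := hA.map _

lemma incP_hom {A : MvPolynomial σ ℂ} {m : ℕ} (hA : A.IsHomogeneous m) :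
    (incP A).IsHomogeneous m := hA.map _

lemma fam_td {A : MvPolynomial σ (Polynomial ℂ)} {m : ℕ} (hA : A.IsHomogeneous m) (b : ℂ) :
    (A - incP (C b)).totalDegree ≤ m := by
  refine (totalDegree_sub _ _).trans (max_le hA.totalDegree_le ?_)
  simp [incP]

lemma fam_lead {A : MvPolynomial σ (Polynomial ℂ)} {m : ℕ} (hA : A.IsHomogeneous m) (hm : 1 ≤ m) (b : ℂ) :
    homogeneousComponent m (spec 0 (A - incP (C b))) = spec 0 A := by
  rw [map_sub, spec_incP, map_sub, homogeneousComponent_of_mem (spec_hom hA 0), if_pos rfl,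
    homogeneousComponent_of_mem (isHomogeneous_C σ b), if_neg (by omega), sub_zero]

theorem FAMh (A : ι → MvPolynomial σ (Polynomial ℂ)) (δ : ι → ℕ) (hA : ∀ j, (A j).IsHomogeneous (δ j))
    (hδ : ∀ j, 1 ≤ δ j) (b : ι → ℂ) (hlead : ∀ x : σ → ℂ, (∀ j, eval x (spec 0 (A j)) = 0) → x = 0) :
    ∀ᶠ c in 𝓝 (0:ℂ), Module.Finite ℂ (MvPolynomial σ ℂ ⧸ Ideal.span (Set.range fun j => spec c (A j) - C (b j))) ∧
      Module.finrank ℂ (MvPolynomial σ ℂ ⧸ Ideal.span (Set.range fun j => spec c (A j) - C (b j))) ≤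
      Module.finrank ℂ (MvPolynomial σ ℂ ⧸ Ideal.span (Set.range fun j => spec 0 (A j) - C (b j))) := by
  have := FAM_a (fun j => A j - incP (C (b j))) δ (fun j => fam_td (hA j) _) (by
    intro x hx
    refine hlead x fun j => ?_
    have := hx j
    rwa [fam_lead (hA j) (hδ j)] at this)
  have e : ∀ c : ℂ, (fun j => spec c (A j - incP (C (b j)))) = fun j => spec c (A j) - C (b j) := by
    intro c; funext j; rw [map_sub, spec_incP]
  filter_upwards [this] with c hc
  rwa [e c, e 0] at hc

theorem FAMhb (A : σ → MvPolynomial σ (Polynomial ℂ)) (δ : σ → ℕ) (hA : ∀ j, (A j).IsHomogeneous (δ j))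
    (hδ : ∀ j, 1 ≤ δ j) (b : σ → ℂ) (hlead : ∀ x : σ → ℂ, (∀ j, eval x (spec 0 (A j)) = 0) → x = 0) :
    ∀ᶠ c in 𝓝 (0:ℂ), Module.Finite ℂ (MvPolynomial σ ℂ ⧸ Ideal.span (Set.range fun j => spec c (A j) - C (b j))) ∧
      Module.finrank ℂ (MvPolynomial σ ℂ ⧸ Ideal.span (Set.range fun j => spec c (A j) - C (b j))) =
      Module.finrank ℂ (MvPolynomial σ ℂ ⧸ Ideal.span (Set.range fun j => spec 0 (A j) - C (b j))) := by
  have := FAM_b (fun j => A j - incP (C (b j))) δ (fun j => fam_td (hA j) _) (by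
    intro x hx
    refine hlead x fun j => ?_
    have := hx j
    rwa [fam_lead (hA j) (hδ j)] at this)
  have e : ∀ c : ℂ, (fun j => spec c (A j - incP (C (b j)))) = fun j => spec c (A j) - C (b j) := by
    intro c; funext j; rw [map_sub, spec_incP]
  filter_upwards [this] with c hc
  rwa [e c, e 0] at hc

theorem FAMcone (A : ι → MvPolynomial σ (Polynomial ℂ)) (δ : ι → ℕ) (hA : ∀ j, (A j).IsHomogeneous (δ j))
    (hδ : ∀ j, 1 ≤ δ j) (hlead : ∀ x : σ → ℂ, (∀ j, eval x (spec 0 (A j)) = 0) → x = 0) :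
    ∀ᶠ c in 𝓝 (0:ℂ), ∀ x : σ → ℂ, (∀ j, eval x (spec c (A j)) = 0) → x = 0 := by
  filter_upwards [FAMh A δ hA hδ (fun _ => 0) hlead] with c hc x hx
  have hfin := zeros_finite hc.1
  by_contra hx0
  have hinj : Function.Injective (fun a : ℂ => (fun i => a * x i : σ → ℂ)) := by
    intro a a' h
    obtain ⟨i, hi⟩ := Function.ne_iff.1 hx0
    exact mul_right_cancel₀ hi (congrFun h i)
  refine Set.infinite_range_of_injective hinj (hfin.subset ?_)
  rintro _ ⟨a, rfl⟩ g hg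
  have : Ideal.span (Set.range fun j => spec c (A j) - C 0) ≤ RingHom.ker (eval (fun i => a * x i)) := by
    refine Ideal.span_le.2 ?_
    rintro _ ⟨j, rfl⟩
    simp only [SetLike.mem_coe, RingHom.mem_ker, map_sub, map_zero, sub_zero]
    rw [eval_hom_smul (spec_hom (hA j) c), hx j, mul_zero]
  exact this hg

lemma pow_mem_loc {B : Ideal (MvPolynomial σ ℂ)} {v : σ → ℂ} {x : MvPolynomial σ ℂ} (hx : eval v x = 0) {K : ℕ}
    (hfin : FinAt (B ⊔ Ideal.span {x ^ K}) v) (hK : imu (B ⊔ Ideal.span {x ^ K}) v < K) : x ^ K ∈ locI B v := by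
  set J := locI (B ⊔ Ideal.span {x ^ K}) v with hJ
  let f : Polynomial.degreeLT ℂ K →ₗ[ℂ] (MvPolynomial σ ℂ ⧸ J) :=
    (((Ideal.Quotient.mkₐ ℂ J).comp (Polynomial.aeval x)).toLinearMap).comp (Polynomial.degreeLT ℂ K).subtype
  have hker : LinearMap.ker f ≠ ⊥ := by
    haveI : Module.Finite ℂ (MvPolynomial σ ℂ ⧸ J) := hfin
    refine LinearMap.ker_ne_bot_of_finrank_lt ?_
    have : Module.finrank ℂ (Polynomial.degreeLT ℂ K) = K := by
      rw [(Polynomial.degreeLTEquiv ℂ K).finrank_eq]; simp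
    rw [this]; exact hK
  obtain ⟨g, hg, hg0⟩ := Submodule.exists_mem_ne_zero_of_ne_bot hker
  have hgm : Polynomial.aeval x g.1 ∈ J := Ideal.Quotient.eq_zero_iff_mem.1 hg
  have hgne : g.1 ≠ 0 := fun h => hg0 (Subtype.ext h)
  have hdeg := Polynomial.mem_degreeLT.1 g.2
  obtain ⟨q, hq, hnd⟩ := Polynomial.exists_eq_pow_rootMultiplicity_mul_and_not_dvd g.1 hgne 0
  set i := Polynomial.rootMultiplicity 0 g.1 with hi
  rw [Polynomial.C_0, sub_zero] at hq hnd
  have hqe : q.eval 0 ≠ 0 := by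
    intro h
    apply hnd
    rw [Polynomial.X_dvd_iff, Polynomial.coeff_zero_eq_eval_zero, h]
  have hiK : i < K := by
    have h1 : i ≤ g.1.natDegree := by
      have hq0 : q ≠ 0 := by rintro rfl; simp at hqe
      have : g.1.natDegree = i + q.natDegree := by
        conv_lhs => rw [hq]
        rw [Polynomial.natDegree_mul (pow_ne_zero _ Polynomial.X_ne_zero) hq0, Polynomial.natDegree_X_pow]
      omega
    have h2 : g.1.natDegree < K := (Polynomial.natDegree_lt_iff_degree_lt hgne).2 hdeg
    omega
  obtain ⟨r, hr, hrm⟩ := mem_locI.1 hgm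
  obtain ⟨b, hb, z, hz, hbz⟩ := Submodule.mem_sup.1 hrm
  obtain ⟨y, rfl⟩ := Ideal.mem_span_singleton'.1 hz
  have hxi : x ^ i ∈ locI B v := by
    refine mem_locI.2 ⟨r * Polynomial.aeval x q - y * x ^ (K - i), ?_, ?_⟩
    · have h1 : eval v (Polynomial.aeval x q) = q.eval 0 := by
        have := Polynomial.aeval_algHom_apply (MvPolynomial.aeval (R := ℂ) v) x q
        have h2 : (MvPolynomial.aeval (R := ℂ) v) x = 0 := by rw [MvPolynomial.aeval_eq_eval]; exact hx
        rw [h2, MvPolynomial.aeval_eq_eval] at this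
        simpa [Polynomial.aeval_def, Polynomial.eval₂_at_zero, Polynomial.coeff_zero_eq_eval_zero] using this.symm
      rw [map_sub, map_mul, map_mul, map_pow, hx, h1, zero_pow (by omega), mul_zero, sub_zero]
      exact mul_ne_zero hr hqe
    · have h3 : Polynomial.aeval x g.1 = x ^ i * Polynomial.aeval x q := by
        conv_lhs => rw [hq]
        simp
      rw [h3] at hbz
      have h4 : x ^ K = x ^ (K - i) * x ^ i := by rw [← pow_add]; congr 1; omega
      have : (r * Polynomial.aeval x q - y * x ^ (K - i)) * x ^ i = b := by
        rw [h4] at hbz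
        linear_combination -hbz
      rw [this]; exact hb
  have h4 : x ^ K = x ^ (K - i) * x ^ i := by rw [← pow_add]; congr 1; omega
  rw [h4]; exact Ideal.mul_mem_left _ _ hxi
end gen

/-- the family of homogenizations -/
def HR (d : ℕ) (P : MvPolynomial (XS n) ℂ) : MvPolynomial (HV n) (Polynomial ℂ) := HA d P (Polynomial.X : Polynomial ℂ)

lemma spec_HR (d : ℕ) (P : MvPolynomial (XS n) ℂ) (c : ℂ) : spec c (HR d P) = HA d P c := by
  have := HA_map (Polynomial.aeval c : Polynomial ℂ →ₐ[ℂ] ℂ) d P Polynomial.X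
  rw [Polynomial.aeval_X] at this
  rw [← this, HR, spec]
  congr 1

lemma spec_pd (d : ℕ) (P : MvPolynomial (XS n) ℂ) (c : ℂ) (i : HV n) :
    spec c (pderiv i (HR d P)) = pderiv i (HA d P c) := by
  rw [← spec_HR, spec, pderiv_map]

/-- family version of `DG` -/
def DGR (d : ℕ) (P : MvPolynomial (XS n) ℂ) (l : Fin n → ℂ) (k i : Fin n) : MvPolynomial (HV n) (Polynomial ℂ) :=
  pderiv (Sum.inl i) (HR d P) - incP (C (l i / l k)) * pderiv (Sum.inl k) (HR d P)

lemma spec_DGR (d : ℕ) (P : MvPolynomial (XS n) ℂ) (l : Fin n → ℂ) (k i : Fin n) (c : ℂ) :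
    spec c (DGR d P l k i) = DG (HA d P c) l k i := by
  rw [DGR, map_sub, map_mul, spec_incP, spec_pd, spec_pd, DG]

lemma HR_hom (d : ℕ) (P : MvPolynomial (XS n) ℂ) : (HR d P).IsHomogeneous d := HA_hom d P _

lemma DGR_hom (d : ℕ) (P : MvPolynomial (XS n) ℂ) (l : Fin n → ℂ) (k i : Fin n) :
    (DGR d P l k i).IsHomogeneous (d-1) := by
  refine (HR_hom d P).pderiv.sub ?_
  have := (incP_hom (isHomogeneous_C (Fin n ⊕ Unit) (l i / l k))).mul ((HR_hom d P).pderiv (i := Sum.inl k))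
  simpa using this

/-- family version of `Ft` -/
def FtR (d : ℕ) (P : MvPolynomial (XS n) ℂ) (t : ℂ) : MvPolynomial (HV n) (Polynomial ℂ) :=
  HR d P - incP (C t * x0 n ^ d)

lemma spec_FtR (d : ℕ) (P : MvPolynomial (XS n) ℂ) (t c : ℂ) : spec c (FtR d P t) = Ft d (HA d P c) t := by
  rw [FtR, map_sub, spec_incP, spec_HR, Ft]

lemma FtR_hom (d : ℕ) (P : MvPolynomial (XS n) ℂ) (t : ℂ) : (FtR d P t).IsHomogeneous d := by
  refine (HR_hom d P).sub (incP_hom ?_)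
  have := (isHomogeneous_C (Fin n ⊕ Unit) t).mul ((isHomogeneous_X ℂ (Sum.inr () : Fin n ⊕ Unit)).pow d)
  simpa [x0] using this

lemma lin_hom {σ : Type} [Fintype σ] (L : σ → ℂ) : (lin L).IsHomogeneous 1 := by
  refine IsHomogeneous.sum _ _ _ fun i _ => ?_
  have := (isHomogeneous_C σ (L i)).mul (isHomogeneous_X ℂ i)
  simpa using this

lemma x0_hom (K : ℕ) : (x0 n ^ K).IsHomogeneous K := by
  have := (isHomogeneous_X ℂ (Sum.inr () : Fin n ⊕ Unit)).pow K
  simpa [x0] using this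

end S8

section S9
variable {n : ℕ}

lemma eval_infH (d : ℕ) (P : MvPolynomial (XS n) ℂ) (s : ℂ) (x : Fin n → ℂ) :
    eval (inf x) (HA d P s) = eval (evA x s) (xpart P d) := by
  rw [HA, map_sum, Finset.sum_eq_single d]
  · rw [map_mul, eval_es]; simp [inf]
  · intro q hq hqd
    rw [map_mul, map_pow, eval_X]
    have : d - q ≠ 0 := by have := Finset.mem_range.1 hq; omega
    simp [inf, this]
  · simp

lemma eq_inf (v : HV n → ℂ) (h0 : v (Sum.inr ()) = 0) : v = inf (fun i => v (Sum.inl i)) := by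
  funext i; rcases i with i | i
  · rfl
  · cases i; simp [inf, h0]

lemma choice_l {d : ℕ} (hd : 2 ≤ d) (P : MvPolynomial (XS n) ℂ) (hdeg : DegXAt d P 0) (hW : (Wset d P 0).Finite) :
    ∃ l : Fin n → ℂ, (∀ i, l i ≠ 0) ∧ ∀ k, ∀ v : HV n → ℂ, (∀ i, eval v (DG (HA d P 0) l k i) = 0) →
      ldot (lf l) v = 0 → v (Sum.inr ()) = 0 → v = 0 := by
  classical
  have hQ : fS (xpart P d) 0 ≠ 0 := by
    obtain ⟨x, hx⟩ := hdeg.2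
    intro h
    apply hx
    rw [← eval_fsub]
    have := congrArg (eval x) h
    simpa [fS] using this
  obtain ⟨l, hl, hlS, hb⟩ := bertini _ hQ (hW.toFinset.image fun p => p.rep) (by
    intro w hw
    obtain ⟨p, _, rfl⟩ := Finset.mem_image.1 hw
    exact p.rep_nonzero)
  refine ⟨l, hl, fun k v hD hlv h0 => ?_⟩
  by_contra hv
  set H := HA d P (0:ℂ) with hH
  have hHh : H.IsHomogeneous d := HA_hom d P (0:ℂ)
  have hvx := eq_inf v h0
  set x : Fin n → ℂ := fun i => v (Sum.inl i) with hx
  set lam := eval v (pderiv (Sum.inl k) H) / l k with hlam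
  have hder : ∀ i, eval v (pderiv (Sum.inl i) H) = lam * l i := by
    intro i
    have := hD i
    simp only [DG, map_sub, map_mul, eval_C] at this
    rw [sub_eq_zero.1 this, hlam]
    have := hl k
    field_simp
  have hlx : ldot l x = 0 := by rw [← ldot_lf_inf, ← hvx]; exact hlv
  by_cases h : lam = 0
  · obtain ⟨p, hp, a, ha, hpa⟩ := exists_W (d := d) (P := P) (s := 0) v hv h0 (by intro i; rw [← hH, hder, h, zero_mul])
    refine hlS p.rep (Finset.mem_image.2 ⟨p, hW.mem_toFinset.2 hp, rfl⟩) ?_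
    have : p.rep = fun i => a * x i := by
      funext i; exact congrFun hpa (Sum.inl i)
    have h2 : ldot l p.rep = 0 := by rw [this, ldot_smul, hlx, mul_zero]
    exact h2
  · obtain ⟨c, hc⟩ := IsAlgClosed.exists_pow_nat_eq (lam⁻¹) (n := d-1) (by omega)
    have hder2 : ∀ i, eval (inf fun i => c * x i) (pderiv (Sum.inl i) H) = l i := by
      intro i
      rw [inf_smul, eval_hom_smul hHh.pderiv, ← hvx, hder, hc, inv_mul_cancel_left₀ h]
    refine hb (fun i => c * x i) ?_ ?_
    · have he := euler_ev hHh (inf fun i => c * x i)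
      simp only [hder2] at he
      have h3 : ∑ i, inf (fun i => c * x i) (Sum.inl i) * l i = 0 := by
        have : ldot l (fun i => c * x i) = 0 := by rw [ldot_smul, hlx, mul_zero]
        rw [← this, ldot]
        exact Finset.sum_congr rfl fun i _ => by simp [inf]; ring
      rw [h3] at he
      have h4 : eval (inf fun i => c * x i) H = 0 := by
        have hd0 : (d : ℂ) ≠ 0 := by exact_mod_cast (by omega : d ≠ 0)
        simpa [inf, hd0] using he.symm
      rw [hH, eval_infH, ← eval_fsub] at h4
      exact h4
    · intro i
      rw [eval_pd_fS, ← eval_inf]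
      exact hder2 i

lemma choice_L {d : ℕ} (P : MvPolynomial (XS n) ℂ) (hdeg : DegXAt d P 0) (hW : (Wset d P 0).Finite)
    (hcr : {x : Fin n → ℂ | CritPt P x 0}.Finite) :
    ∃ L : HV n → ℂ, ∀ v : HV n → ℂ, (∀ i, eval v (pderiv (Sum.inl i) (HA d P 0)) = 0) → ldot L v = 0 → v = 0 := by
  classical
  obtain ⟨L, hL⟩ := avoid (hW.toFinset.image (fun p => inf p.rep) ∪ hcr.toFinset.image aff) (by
    intro w hw
    rcases Finset.mem_union.1 hw with hw | hw
    · obtain ⟨p, _, rfl⟩ := Finset.mem_image.1 hw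
      exact rep_ne p
    · obtain ⟨x, _, rfl⟩ := Finset.mem_image.1 hw
      intro h; simpa [aff] using congrFun h (Sum.inr ()))
  refine ⟨L, fun v hz hLv => ?_⟩
  by_contra hv
  by_cases h0 : v (Sum.inr ()) = 0
  · obtain ⟨p, hp, a, ha, hpa⟩ := exists_W v hv h0 hz
    refine hL (inf p.rep) (Finset.mem_union_left _ (Finset.mem_image.2 ⟨p, hW.mem_toFinset.2 hp, rfl⟩)) ?_
    have : ldot L (inf p.rep) = 0 := by rw [hpa, ldot_smul, hLv, mul_zero]
    exact this
  · have hx : aff (fun i => (v (Sum.inr ()))⁻¹ * v (Sum.inl i)) = fun i => (v (Sum.inr ()))⁻¹ * v i := by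
      funext i; rcases i with i | i
      · rfl
      · cases i; simp [aff, h0]
    refine hL (aff (fun i => (v (Sum.inr ()))⁻¹ * v (Sum.inl i))) (Finset.mem_union_right _
      (Finset.mem_image.2 ⟨_, hcr.mem_toFinset.2 ?_, rfl⟩)) ?_
    · intro i
      rw [← eval_aff hdeg, hx, eval_hom_smul (HA_hom d P (0:ℂ)).pderiv, hz i, mul_zero]
    · have : ldot L (fun i => (v (Sum.inr ()))⁻¹ * v i) = 0 := by rw [ldot_smul, hLv, mul_zero]
      rw [hx]; exact this

lemma span_sum {A α β : Type*} [CommRing A] (f : α ⊕ β → A) :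
    Ideal.span (Set.range f) = Ideal.span (Set.range fun a => f (Sum.inl a)) ⊔ Ideal.span (Set.range fun b => f (Sum.inr b)) := by
  rw [← Ideal.span_union]
  congr 1
  ext x; simp

/-- first family -/
def A1f (d : ℕ) (P : MvPolynomial (XS n) ℂ) (L : HV n → ℂ) : Fin n ⊕ Unit → MvPolynomial (HV n) (Polynomial ℂ) :=
  Sum.elim (fun i => pderiv (Sum.inl i) (HR d P)) (fun _ => incP (lin L))

lemma span_A1 (d : ℕ) (P : MvPolynomial (XS n) ℂ) (L : HV n → ℂ) (c : ℂ) :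
    Ideal.span (Set.range fun j => spec c (A1f d P L j) - C ((Sum.elim (fun _ => 0) (fun _ => 1) : Fin n ⊕ Unit → ℂ) j)) =
      KA (HA d P c) ⊔ Ideal.span {lin L - 1} := by
  rw [span_sum]
  congr 1
  · rw [KA]; congr 2; funext i; simp [A1f, spec_pd]
  · simp [A1f, spec_incP]

/-- second family -/
def A2f (d : ℕ) (P : MvPolynomial (XS n) ℂ) (l : Fin n → ℂ) (k : Fin n) :
    Fin n ⊕ (Unit ⊕ Unit) → MvPolynomial (HV n) (Polynomial ℂ) :=
  Sum.elim (DGR d P l k) (Sum.elim (fun _ => incP (lin (lf l))) (fun _ => incP (x0 n)))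

lemma span_A2 (d : ℕ) (P : MvPolynomial (XS n) ℂ) (l : Fin n → ℂ) (k : Fin n) (c : ℂ) :
    Ideal.span (Set.range fun j => spec c (A2f d P l k j) -
      C ((Sum.elim (fun _ => 0) (Sum.elim (fun _ => 1) (fun _ => 0)) : Fin n ⊕ (Unit ⊕ Unit) → ℂ) j)) =
      DI (HA d P c) l k ⊔ Ideal.span {lin (lf l) - 1} ⊔ Ideal.span {x0 n} := by
  rw [span_sum, span_sum, ← sup_assoc]
  refine congrArg₂ (· ⊔ ·) (congrArg₂ (· ⊔ ·) ?_ ?_) ?_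
  · rw [DI]; refine congrArg (fun f => Ideal.span (Set.range f)) ?_; funext i; simp [A2f, spec_DGR]
  · simp [A2f, spec_incP]
  · simp [A2f, spec_incP]

/-- third family -/
def A3f (d : ℕ) (P : MvPolynomial (XS n) ℂ) (l : Fin n → ℂ) (k : Fin n) (t : ℂ) (K : ℕ) :
    Fin n ⊕ (Unit ⊕ (Unit ⊕ Unit)) → MvPolynomial (HV n) (Polynomial ℂ) :=
  Sum.elim (DGR d P l k) (Sum.elim (fun _ => incP (lin (lf l))) (Sum.elim (fun _ => FtR d P t) (fun _ => incP (x0 n ^ K))))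

lemma span_A3 (d : ℕ) (P : MvPolynomial (XS n) ℂ) (l : Fin n → ℂ) (k : Fin n) (t : ℂ) (K : ℕ) (c : ℂ) :
    Ideal.span (Set.range fun j => spec c (A3f d P l k t K j) -
      C ((Sum.elim (fun _ => 0) (Sum.elim (fun _ => 1) (Sum.elim (fun _ => 0) (fun _ => 0))) :
        Fin n ⊕ (Unit ⊕ (Unit ⊕ Unit)) → ℂ) j)) =
      DI (HA d P c) l k ⊔ Ideal.span {lin (lf l) - 1} ⊔ Ideal.span {Ft d (HA d P c) t} ⊔ Ideal.span {x0 n ^ K} := by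
  rw [span_sum, span_sum, span_sum, ← sup_assoc, ← sup_assoc]
  refine congrArg₂ (· ⊔ ·) (congrArg₂ (· ⊔ ·) (congrArg₂ (· ⊔ ·) ?_ ?_) ?_) ?_
  · rw [DI]; refine congrArg (fun f => Ideal.span (Set.range f)) ?_; funext i; simp [A3f, spec_DGR]
  · simp [A3f, spec_incP]
  · simp [A3f, spec_FtR]
  · simp only [A3f, Sum.elim_inr, spec_incP, map_zero, sub_zero, Set.range_const]
end S9

section S10
variable {n : ℕ}

/-- the ideal of the polar germ in the fibre `t` -/
def BJ (d : ℕ) (P : MvPolynomial (XS n) ℂ) (s : ℂ) (l : Fin n → ℂ) (k : Fin n) (t : ℂ) : Ideal (MvPolynomial (HV n) ℂ) :=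
  DI (HA d P s) l k ⊔ Ideal.span {lin (lf l) - 1} ⊔ Ideal.span {Ft d (HA d P s) t}

lemma zerosJ {d : ℕ} (hd : 2 ≤ d) (P : MvPolynomial (XS n) ℂ) (s : ℂ) (l : Fin n → ℂ) (k : Fin n) (hl : ∀ i, l i ≠ 0)
    (t : ℂ) (K : ℕ) (hK : K ≠ 0) (v : HV n → ℂ)
    (hv : ∀ g ∈ BJ d P s l k t ⊔ Ideal.span {x0 n ^ K}, eval v g = 0) : ∃ p ∈ Wset d P s, vl l p = v := by
  set H := HA d P s with hH
  have hHh : H.IsHomogeneous d := HA_hom d P s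
  have h1 : ∀ i, eval v (DG H l k i) = 0 := fun i => hv _ (Ideal.mem_sup_left (Ideal.mem_sup_left
    (Ideal.mem_sup_left (Ideal.subset_span ⟨i, rfl⟩))))
  have h2 : ldot (lf l) v = 1 := by
    have := hv _ (Ideal.mem_sup_left (Ideal.mem_sup_left (Ideal.mem_sup_right (Ideal.subset_span rfl))))
    rw [map_sub, eval_lin, map_one, sub_eq_zero] at this
    exact this
  have h3 : eval v (Ft d H t) = 0 := hv _ (Ideal.mem_sup_left (Ideal.mem_sup_right (Ideal.subset_span rfl)))
  have h0 : v (Sum.inr ()) = 0 := by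
    have := hv _ (Ideal.mem_sup_right (Ideal.subset_span rfl))
    rw [map_pow, x0, eval_X] at this
    exact eq_zero_of_pow_eq_zero this
  have h4 : eval v H = 0 := by
    rw [Ft, x0, map_sub, map_mul, map_pow, eval_X, h0, zero_pow (by omega), mul_zero, sub_zero] at h3
    exact h3
  have hv0 : v ≠ 0 := by
    rintro rfl
    simp [ldot] at h2
  set lam := eval v (pderiv (Sum.inl k) H) / l k with hlam
  have hder : ∀ i, eval v (pderiv (Sum.inl i) H) = lam * l i := by
    intro i
    have := h1 i
    simp only [DG, map_sub, map_mul, eval_C] at this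
    rw [sub_eq_zero.1 this, hlam]
    have := hl k
    field_simp
  have hl0 : lam = 0 := by
    have he := euler_ev hHh v
    rw [h4, h0, zero_mul, add_zero, mul_zero] at he
    simp only [hder] at he
    have : ∑ i, v (Sum.inl i) * (lam * l i) = lam * ldot (lf l) v := by
      rw [ldot, lf_inr, Finset.mul_sum]
      exact Finset.sum_congr rfl fun i _ => by ring
    rw [this, h2, mul_one] at he
    exact he
  obtain ⟨p, hp, a, ha, hpa⟩ := exists_W (d := d) (P := P) (s := s) v hv0 h0 (by
    intro i; rw [← hH, hder, hl0, zero_mul])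
  exact ⟨p, hp, by rw [vl_eq, hpa]; exact nrm_smul _ v a ha h2⟩

lemma sumJ {d : ℕ} (hd : 2 ≤ d) (P : MvPolynomial (XS n) ℂ) (s : ℂ) (l : Fin n → ℂ) (k : Fin n) (hl : ∀ i, l i ≠ 0)
    (t : ℂ) (K : ℕ) (hK : K ≠ 0) (W : Finset (PrjInf n)) (hW : ∀ p, p ∈ W ↔ p ∈ Wset d P s)
    (hlp : ∀ p ∈ W, ldot l p.rep ≠ 0)
    (hfin : Module.Finite ℂ (MvPolynomial (HV n) ℂ ⧸ (BJ d P s l k t ⊔ Ideal.span {x0 n ^ K}))) :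
    Module.finrank ℂ (MvPolynomial (HV n) ℂ ⧸ (BJ d P s l k t ⊔ Ideal.span {x0 n ^ K})) =
      ∑ p ∈ W, imu (BJ d P s l k t ⊔ Ideal.span {x0 n ^ K}) (vl l p) := by
  classical
  rw [SUM hfin (W.image (vl l)), Finset.sum_image]
  · intro p hp q hq h
    rw [vl_eq, vl_eq] at h
    exact nrm_inj (lf l) (by rw [ldot_lf_inf]; exact hlp p hp) (by rw [ldot_lf_inf]; exact hlp q hq) h
  · intro v hv
    obtain ⟨p, hp, h⟩ := zerosJ hd P s l k hl t K hK v hv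
    exact Finset.mem_image.2 ⟨p, (hW p).2 hp, h⟩

theorem main_ev {d : ℕ} (hn : 2 ≤ n) (hd : 2 ≤ d) (P : MvPolynomial (XS n) ℂ)
    (hdeg : ∀ᶠ s in 𝓝 (0:ℂ), DegXAt d P s)
    (hcr : ∀ᶠ s in 𝓝 (0:ℂ), {x : Fin n → ℂ | CritPt P x s}.Finite) (hW : (Wset d P 0).Finite) :
    ∀ᶠ s in 𝓝 (0:ℂ), muTot P 0 + lamTot d P 0 ≤ muTot P s + lamTot d P s := by
  obtain ⟨l, hl, hlz⟩ := choice_l hd P hdeg.self_of_nhds hW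
  obtain ⟨L, hL⟩ := choice_L P hdeg.self_of_nhds hW hcr.self_of_nhds
  have k : Fin n := ⟨0, by omega⟩
  -- the homogeneity data
  have hA1 : ∀ j, (A1f d P L j).IsHomogeneous ((Sum.elim (fun _ => d-1) (fun _ => 1) : Fin n ⊕ Unit → ℕ) j) := by
    rintro (i | i)
    · exact (HR_hom d P).pderiv
    · exact incP_hom (lin_hom L)
  have hA1d : ∀ j, 1 ≤ (Sum.elim (fun _ => d-1) (fun _ => 1) : Fin n ⊕ Unit → ℕ) j := by
    rintro (i | i) <;> simp <;> omega
  have hA1z : ∀ x : HV n → ℂ, (∀ j, eval x (spec 0 (A1f d P L j)) = 0) → x = 0 := by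
    intro x hx
    refine hL x (fun i => ?_) ?_
    · have := hx (Sum.inl i)
      rwa [A1f, Sum.elim_inl, spec_pd] at this
    · have := hx (Sum.inr ())
      rwa [A1f, Sum.elim_inr, spec_incP, eval_lin] at this
  have hA2 : ∀ j, (A2f d P l k j).IsHomogeneous
      ((Sum.elim (fun _ => d-1) (fun _ => 1) : Fin n ⊕ (Unit ⊕ Unit) → ℕ) j) := by
    rintro (i | i | i)
    · exact DGR_hom d P l k i
    · exact incP_hom (lin_hom _)
    · have := incP_hom (x0_hom (n := n) 1); rwa [pow_one] at this
  have hA2d : ∀ j, 1 ≤ (Sum.elim (fun _ => d-1) (fun _ => 1) : Fin n ⊕ (Unit ⊕ Unit) → ℕ) j := by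
    rintro (i | i) <;> simp <;> omega
  have hA2z : ∀ x : HV n → ℂ, (∀ j, eval x (spec 0 (A2f d P l k j)) = 0) → x = 0 := by
    intro x hx
    refine hlz k x (fun i => ?_) ?_ ?_
    · have := hx (Sum.inl i)
      rwa [A2f, Sum.elim_inl, spec_DGR] at this
    · have := hx (Sum.inr (Sum.inl ()))
      rwa [A2f, Sum.elim_inr, Sum.elim_inl, spec_incP, eval_lin] at this
    · have := hx (Sum.inr (Sum.inr ()))
      rwa [A2f, Sum.elim_inr, Sum.elim_inr, spec_incP, x0, eval_X] at this
  have E1 := FAMhb (A1f d P L) _ hA1 hA1d (Sum.elim (fun _ => 0) (fun _ => 1)) hA1z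
  have E2 := FAMcone (A1f d P L) _ hA1 hA1d hA1z
  have E3 := FAMh (A2f d P l k) _ hA2 hA2d (Sum.elim (fun _ => 0) (Sum.elim (fun _ => 1) (fun _ => 0))) hA2z
  have E4 := FAMcone (A2f d P l k) _ hA2 hA2d hA2z
  replace E1 : ∀ᶠ c in 𝓝 (0:ℂ), Module.Finite ℂ (MvPolynomial (HV n) ℂ ⧸ (KA (HA d P c) ⊔ Ideal.span {lin L - 1})) ∧
      Module.finrank ℂ (MvPolynomial (HV n) ℂ ⧸ (KA (HA d P c) ⊔ Ideal.span {lin L - 1})) =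
      Module.finrank ℂ (MvPolynomial (HV n) ℂ ⧸ (KA (HA d P (0:ℂ)) ⊔ Ideal.span {lin L - 1})) := by
    filter_upwards [E1] with c hc
    rwa [span_A1, span_A1] at hc
  replace E3 : ∀ᶠ c in 𝓝 (0:ℂ), Module.Finite ℂ (MvPolynomial (HV n) ℂ ⧸ (DI (HA d P c) l k ⊔ Ideal.span {lin (lf l) - 1} ⊔ Ideal.span {x0 n})) ∧
      Module.finrank ℂ (MvPolynomial (HV n) ℂ ⧸ (DI (HA d P c) l k ⊔ Ideal.span {lin (lf l) - 1} ⊔ Ideal.span {x0 n})) ≤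
      Module.finrank ℂ (MvPolynomial (HV n) ℂ ⧸ (DI (HA d P (0:ℂ)) l k ⊔ Ideal.span {lin (lf l) - 1} ⊔ Ideal.span {x0 n})) := by
    filter_upwards [E3] with c hc
    rwa [span_A2, span_A2] at hc
  have hd4 : ∀ s, (∀ x : HV n → ℂ, (∀ j, eval x (spec s (A2f d P l k j)) = 0) → x = 0) →
      ∀ x : Fin n → ℂ, x ≠ 0 → (∀ i, eval (inf x) (pderiv (Sum.inl i) (HA d P s)) = 0) → ldot l x ≠ 0 := by
    intro s h4 x hx hz h0
    apply hx
    have := h4 (inf x) (by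
      rintro (i | i | i)
      · rw [A2f, Sum.elim_inl, spec_DGR, DG, map_sub, map_mul, hz, hz, mul_zero, sub_zero]
      · rw [A2f, Sum.elim_inr, Sum.elim_inl, spec_incP, eval_lin]
        have := ldot_lf_inf l x
        rw [h0] at this
        exact this
      · rw [A2f, Sum.elim_inr, Sum.elim_inr, spec_incP, x0, eval_X]; rfl)
    funext i
    exact congrFun this (Sum.inl i)
  have PK : ∀ᶠ s in 𝓝 (0:ℂ), (∀ p ∈ Wset d P s, ldot l p.rep ≠ 0) ∧
    ∃ (W : Finset (PrjInf n)) (G : PrjInf n → ℕ) (Z : PrjInf n → Finset ℂ),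
      (∀ p, p ∈ W ↔ p ∈ Wset d P s) ∧
      (∀ p ∈ W, ∀ t, FinAt (BJ d P s l k t) (vl l p)) ∧
      (∀ p ∈ W, ∀ t, G p ≤ imu (BJ d P s l k t) (vl l p)) ∧
      (∀ p ∈ W, ∀ t ∉ Z p, imu (BJ d P s l k t) (vl l p) = G p) ∧
      Module.finrank ℂ (MvPolynomial (HV n) ℂ ⧸ (KA (HA d P (0:ℂ)) ⊔ Ideal.span {lin L - 1})) =
        muTot P s + lamTot d P s + ∑ p ∈ W, G p := by
    filter_upwards [hdeg, hcr, E1, E2, E3, E4] with s g1 g2 g3 g4 g5 g6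
    have g7 := hd4 s g6
    refine ⟨fun p hp => g7 _ p.rep_nonzero (W_grad hp), ?_⟩
    rw [← g3.2]
    refine package hn hd P s g1 g2 l hl k L g3.1 ?_ g5.1 g7
    intro v hv hz h0
    apply hv
    apply g4
    rintro (i | i)
    · rw [A1f, Sum.elim_inl, spec_pd]; exact hz i
    · rw [A1f, Sum.elim_inr, spec_incP, eval_lin]; exact h0
  obtain ⟨hlp0, W0, G0, Z0, hW0, hF0, hG0, hZ0, hN0⟩ := PK.self_of_nhds
  obtain ⟨t0, ht0⟩ : ∃ t0 : ℂ, ∀ p ∈ W0, t0 ∉ Z0 p := by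
    classical
    obtain ⟨t, ht⟩ := Infinite.exists_notMem_finset (W0.biUnion Z0)
    exact ⟨t, fun p hp h => ht (Finset.mem_biUnion.2 ⟨p, hp, h⟩)⟩
  set D := ∑ p ∈ W0, G0 p with hD
  have hA3 : ∀ j, (A3f d P l k t0 (D+1) j).IsHomogeneous
      ((Sum.elim (fun _ => d-1) (Sum.elim (fun _ => 1) (Sum.elim (fun _ => d) (fun _ => D+1))) :
        Fin n ⊕ (Unit ⊕ (Unit ⊕ Unit)) → ℕ) j) := by
    rintro (i | i | i | i)
    · exact DGR_hom d P l k i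
    · exact incP_hom (lin_hom _)
    · exact FtR_hom d P t0
    · exact incP_hom (x0_hom (n := n) (D+1))
  have hA3d : ∀ j, 1 ≤ (Sum.elim (fun _ => d-1) (Sum.elim (fun _ => 1) (Sum.elim (fun _ => d) (fun _ => D+1))) :
        Fin n ⊕ (Unit ⊕ (Unit ⊕ Unit)) → ℕ) j := by
    rintro (i | i | i | i) <;> simp <;> omega
  have hA3z : ∀ x : HV n → ℂ, (∀ j, eval x (spec 0 (A3f d P l k t0 (D+1) j)) = 0) → x = 0 := by
    intro x hx
    refine hlz k x (fun i => ?_) ?_ ?_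
    · have := hx (Sum.inl i)
      rwa [A3f, Sum.elim_inl, spec_DGR] at this
    · have := hx (Sum.inr (Sum.inl ()))
      rwa [A3f, Sum.elim_inr, Sum.elim_inl, spec_incP, eval_lin] at this
    · have := hx (Sum.inr (Sum.inr (Sum.inr ())))
      rw [A3f, Sum.elim_inr, Sum.elim_inr, Sum.elim_inr, spec_incP, x0, map_pow, eval_X] at this
      exact eq_zero_of_pow_eq_zero this
  have E5 := FAMh (A3f d P l k t0 (D+1)) _ hA3 hA3d
    (Sum.elim (fun _ => 0) (Sum.elim (fun _ => 1) (Sum.elim (fun _ => 0) (fun _ => 0)))) hA3z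
  replace E5 : ∀ᶠ c in 𝓝 (0:ℂ), Module.Finite ℂ (MvPolynomial (HV n) ℂ ⧸ (BJ d P c l k t0 ⊔ Ideal.span {x0 n ^ (D+1)})) ∧
      Module.finrank ℂ (MvPolynomial (HV n) ℂ ⧸ (BJ d P c l k t0 ⊔ Ideal.span {x0 n ^ (D+1)})) ≤
      Module.finrank ℂ (MvPolynomial (HV n) ℂ ⧸ (BJ d P (0:ℂ) l k t0 ⊔ Ideal.span {x0 n ^ (D+1)})) := by
    filter_upwards [E5] with c hc
    rwa [span_A3, span_A3] at hc
  have hJ0 : Module.finrank ℂ (MvPolynomial (HV n) ℂ ⧸ (BJ d P 0 l k t0 ⊔ Ideal.span {x0 n ^ (D+1)})) ≤ D := by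
    rw [sumJ hd P 0 l k hl t0 (D+1) (by omega) W0 hW0 (fun p hp => hlp0 p ((hW0 p).1 hp)) E5.self_of_nhds.1]
    refine Finset.sum_le_sum fun p hp => ?_
    rw [← hZ0 p hp t0 (ht0 p hp)]
    exact (hF0 p hp t0).imu_le (le_sup_left.trans (le_locI _ _))
  filter_upwards [PK, E5] with s hP h5
  obtain ⟨hlp, W, G, Z, hW1, hF, hG, hZ, hN⟩ := hP
  have hJs : Module.finrank ℂ (MvPolynomial (HV n) ℂ ⧸ (BJ d P s l k t0 ⊔ Ideal.span {x0 n ^ (D+1)})) ≤ D :=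
    h5.2.trans hJ0
  have hsum := sumJ hd P s l k hl t0 (D+1) (by omega) W hW1 (fun p hp => hlp p ((hW1 p).1 hp)) h5.1
  rw [hsum] at hJs
  have hle : ∑ p ∈ W, G p ≤ D := by
    refine le_trans (Finset.sum_le_sum fun p hp => ?_) hJs
    refine (hG p hp t0).trans (le_of_eq ?_)
    have hi : imu (BJ d P s l k t0 ⊔ Ideal.span {x0 n ^ (D+1)}) (vl l p) ≤ D :=
      (Finset.single_le_sum (f := fun p => imu (BJ d P s l k t0 ⊔ Ideal.span {x0 n ^ (D+1)}) (vl l p))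
        (fun _ _ => Nat.zero_le _) hp).trans hJs
    have hm := pow_mem_loc (B := BJ d P s l k t0) (v := vl l p) (x := x0 n) (by rw [x0, eval_X]; rfl)
      (K := D+1) ((hF p hp t0).mono (le_sup_left.trans (le_locI _ _))) (by omega)
    refine imu_congr (le_sup_left.trans (le_locI _ _)) (sup_le (le_locI _ _) (Ideal.span_le.2 ?_))
    rintro _ rfl
    exact hm
  omega

end S10

/-- For a one-parameter FISI deformation, the number of vanishing
cycles `γ(s) = μ(s) + λ(s)` is upper semi-continuous at `s = 0`:
`μ(s) + λ(s) ≥ μ(0) + λ(0)` for all `|s| < ε`. -/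
theorem stmt9 {n d : ℕ} (hn : 2 ≤ n) (hd : 2 ≤ d) (P : MvPolynomial (XS n) ℂ)
    (hdeg : ∃ ε > (0:ℝ), ∀ s : ℂ, ‖s‖ < ε → DegXAt d P s)
    (hfisi : FISIdef d P) :
    ∃ ε > (0:ℝ), ∀ s : ℂ, ‖s‖ < ε →
      muTot P 0 + lamTot d P 0 ≤ muTot P s + lamTot d P s := by
  have key : ∀ p : ℂ → Prop, (∃ ε > (0:ℝ), ∀ s : ℂ, ‖s‖ < ε → p s) ↔ ∀ᶠ s in 𝓝 (0:ℂ), p s := by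
    intro p
    rw [Metric.eventually_nhds_iff]
    simp [dist_zero_right]
  rw [key] at hdeg ⊢
  exact main_ev hn hd P hdeg ((key _).1 hfisi.2) hfisi.1.2.2
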